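/- Let g be an indecomposable symmetrizable Kac-Moody algebra, finitely Σ-graded with grading subalgebra m, with adapted root basis Π_a and J = {i∈I : ρ_a(α_i)=0}. Then: (1) there exists a subspace h_{I_re} of h containing a such that (h_{I_re}, Π_{I_re}, Π∨_{I_re}) is a realization of the submatrix A_{I_re} of A, and the associated Kac-Moody subalgebra g(I_re) of g contains m; (2) g(I_re) is finitely Δ(I_re)^{J_re}-graded with grading subalgebra the C-admissible subalgebra g(I_re)^{J_re} associated to the C-admissible pair (I_re,J_re); (3) g(I_re)^{J_re} contains m. -/

import Mathlib

attribute [local instance] Classical.propDecidable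

noncomputable section

namespace KMG

open Module

/-! ### Generalized Cartan matrices -/

/-- `A` is a generalized Cartan matrix. -/
def IsGCM {I : Type*} (A : Matrix I I ℤ) : Prop :=
  (∀ i, A i i = 2) ∧ (∀ i j, i ≠ j → A i j ≤ 0) ∧ ∀ i j, A i j = 0 → A j i = 0

/-- `A` is indecomposable. -/
def Indecomposable {I : Type*} (A : Matrix I I ℤ) : Prop :=
  ∀ s : Set I, s.Nonempty → sᶜ.Nonempty → ∃ i ∈ s, ∃ j ∈ sᶜ, A i j ≠ 0

/-- `A` is symmetrizable: `D A` is symmetric for an invertible diagonal matrix `D`. -/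
def Symmetrizable {I : Type*} (A : Matrix I I ℤ) : Prop :=
  ∃ d : I → ℚ, (∀ i, d i ≠ 0) ∧ ∀ i j, d i * (A i j : ℚ) = d j * (A j i : ℚ)

/-- The principal submatrix of `A` indexed by a subset `S`. -/
def restrictM {I : Type*} (A : Matrix I I ℤ) (S : Set I) : Matrix S S ℤ :=
  fun i j => A i.1 j.1

/-- `A` is of finite type: `A u > 0` for some `u > 0` (Kac, Thm. 4.3). -/
def IsFiniteType {I : Type*} (A : Matrix I I ℤ) : Prop :=
  ∃ u : I → ℚ, (∀ i, 0 < u i) ∧ ∀ i, 0 < ∑ᶠ j, (A i j : ℚ) * u j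

/-- `A` is of affine type: `A` indecomposable and `A u = 0` for some `u > 0`. -/
def IsAffineType {I : Type*} (A : Matrix I I ℤ) : Prop :=
  Indecomposable A ∧ ∃ u : I → ℚ, (∀ i, 0 < u i) ∧ ∀ i, ∑ᶠ j, (A i j : ℚ) * u j = 0

/-- `A` is of indefinite type: `A u < 0` for some `u > 0`. -/
def IsIndefiniteType {I : Type*} (A : Matrix I I ℤ) : Prop :=
  ∃ u : I → ℚ, (∀ i, 0 < u i) ∧ ∀ i, ∑ᶠ j, (A i j : ℚ) * u j < 0

/-- The corank of a generalized Cartan matrix. -/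
def gcmCorank {I : Type*} [Fintype I] [DecidableEq I] (A : Matrix I I ℤ) : ℕ :=
  Fintype.card I - (A.map ((↑) : ℤ → ℚ)).rank

/-- The connected component of the vertex `k` in the subdiagram of the Dynkin diagram of `A`
with vertex set `S`. -/
def cmpnt {I : Type*} (A : Matrix I I ℤ) (S : Set I) (k : I) : Set I :=
  {i | i ∈ S ∧ Relation.ReflTransGen (fun x y => x ∈ S ∧ y ∈ S ∧ A x y ≠ 0) k i}

/-- `A` is hyperbolic: deleting any one vertex of the Dynkin diagram leaves a disjoint union
of diagrams of finite or affine type. -/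
def IsHyperbolic {I : Type*} (A : Matrix I I ℤ) : Prop :=
  ∀ i₀ k : I, k ≠ i₀ →
    IsFiniteType (restrictM A (cmpnt A {i | i ≠ i₀} k)) ∨
      IsAffineType (restrictM A (cmpnt A {i | i ≠ i₀} k))

/-- `A` is Lorentzian: `A` is nonsingular and its symmetrization has signature `(+,...,+,-)`. -/
def IsLorentzian {I : Type*} [Fintype I] [DecidableEq I] (A : Matrix I I ℤ) : Prop :=
  IsUnit (A.map ((↑) : ℤ → ℚ)).det ∧
    ∃ d : I → ℚ, (∀ i, 0 < d i) ∧ (∀ i j, d i * (A i j : ℚ) = d j * (A j i : ℚ)) ∧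
      ∃ P : Matrix I I ℝ, IsUnit P.det ∧ ∃ i₀ : I,
        P.transpose * (Matrix.of fun i j => ((d i : ℝ) * (A i j : ℝ))) * P =
          Matrix.diagonal fun i => if i = i₀ then (-1 : ℝ) else 1

/-! ### Weight spaces -/

variable {g : Type*} [LieRing g] [LieAlgebra ℂ g]

/-- The weight space of weight `χ` for the adjoint action on `g` of a space `V` mapping to `g`
by `ι`. -/
def wtSpaceι {V : Type*} [AddCommGroup V] [Module ℂ V] (ι : V →ₗ[ℂ] g)
    (χ : Module.Dual ℂ V) : Submodule ℂ g where
  carrier := {x | ∀ v : V, ⁅ι v, x⁆ = χ v • x}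
  add_mem' := fun ha hb v => by rw [lie_add, ha v, hb v, smul_add]
  zero_mem' := fun v => by rw [lie_zero, smul_zero]
  smul_mem' := fun c x hx v => by rw [lie_smul, hx v, smul_comm]

/-! ### Kac-Moody algebras -/

/-- A (symmetrizable) Kac-Moody algebra structure on the Lie algebra `g`, for the generalized
Cartan matrix `A` indexed by `I` : a realization `(H, root, coroot)` of `A` together with
Chevalley generators `e i`, `f i` satisfying the Chevalley-Serre relations, such that `g` is
generated by `H` and the `e i, f i`, is diagonalizable under `H`, with `0`-weight space `H`. -/
structure KacMoodyAlgebra {I : Type*} [Fintype I] [DecidableEq I] (A : Matrix I I ℤ)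
    (g : Type*) [LieRing g] [LieAlgebra ℂ g] : Type _ where
  H : Submodule ℂ g
  root : I → Module.Dual ℂ H
  coroot : I → H
  e : I → g
  f : I → g
  findimH : FiniteDimensional ℂ H
  finrankH : Module.finrank ℂ H = Fintype.card I + gcmCorank A
  indepRoot : LinearIndependent ℂ root
  indepCoroot : LinearIndependent ℂ coroot
  pairing : ∀ i j, root j (coroot i) = (A i j : ℂ)
  abelian : ∀ x y : H, ⁅(x : g), (y : g)⁆ = 0
  lie_e : ∀ (x : H) (i : I), ⁅(x : g), e i⁆ = root i x • e i
  lie_f : ∀ (x : H) (i : I), ⁅(x : g), f i⁆ = -(root i x) • f i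
  e_f : ∀ i j, ⁅e i, f j⁆ = if j = i then ((coroot i : g)) else 0
  serre_e : ∀ i j, i ≠ j →
    ((LieAlgebra.ad ℂ g (e i)) ^ (1 - A i j).toNat) (e j) = 0
  serre_f : ∀ i j, i ≠ j →
    ((LieAlgebra.ad ℂ g (f i)) ^ (1 - A i j).toNat) (f j) = 0
  generates : LieSubalgebra.lieSpan ℂ g ((H : Set g) ∪ Set.range e ∪ Set.range f) = ⊤
  weight_decomp : ⨆ χ : Module.Dual ℂ H, wtSpaceι H.subtype χ = ⊤
  zero_weight : wtSpaceι H.subtype (0 : Module.Dual ℂ H) = H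

variable {I : Type*} [Fintype I] [DecidableEq I] {A : Matrix I I ℤ}

/-- The root system of a Kac-Moody algebra: nonzero weights of the adjoint action of the
Cartan subalgebra. -/
def Delta (G : KacMoodyAlgebra A g) : Set (Module.Dual ℂ G.H) :=
  {χ | χ ≠ 0 ∧ wtSpaceι G.H.subtype χ ≠ ⊥}

/-- The positive roots with respect to the standard root basis. -/
def posRoots (G : KacMoodyAlgebra A g) : Set (Module.Dual ℂ G.H) :=
  {χ ∈ Delta G | ∃ c : I → ℕ, χ = ∑ i, (c i : ℂ) • G.root i}

/-- The real roots : the orbit of the simple roots under the Weyl group. -/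
inductive IsRealRoot (G : KacMoodyAlgebra A g) : Module.Dual ℂ G.H → Prop
  | simple (i : I) : IsRealRoot G (G.root i)
  | reflect (i : I) (χ : Module.Dual ℂ G.H) :
      IsRealRoot G χ → IsRealRoot G (χ - χ (G.coroot i) • G.root i)

/-- The subalgebra `g(S)` generated by the root spaces `g_{± α_i}`, `i ∈ S`. -/
def gS (G : KacMoodyAlgebra A g) (S : Set I) : LieSubalgebra ℂ g :=
  LieSubalgebra.lieSpan ℂ g ({x | ∃ i ∈ S, x = G.e i} ∪ {x | ∃ i ∈ S, x = G.f i})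

/-- The subspace `h^J = {h ∈ h | ⟨α_j, h⟩ = 0 ∀ j ∈ J}`. -/
def hJsub (G : KacMoodyAlgebra A g) (J : Set I) : Submodule ℂ G.H :=
  ⨅ j ∈ J, LinearMap.ker (G.root j)

/-- `Hk` is the canonical semisimple element attached to `k` and the component `S = I_k` :
it lies in the span of the coroots from `S` and satisfies `⟨α_i, H_k⟩ = 2 δ_{i,k}` on `S`. -/
def IsHGen (G : KacMoodyAlgebra A g) (S : Set I) (k : I) (Hk : G.H) : Prop :=
  Hk ∈ Submodule.span ℂ (G.coroot '' S) ∧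
    ∀ i ∈ S, G.root i Hk = if i = k then 2 else 0

/-- `g(S)` is `A₁`-graded by the `sl₂`-triple with semisimple element `Hk` :
`ad Hk` has only eigenvalues `0, 2, -2` on `g(S)`. -/
def A1GradedBy (G : KacMoodyAlgebra A g) (S : Set I) (Hk : g) : Prop :=
  ∀ x ∈ gS G S, x ∈ Module.End.eigenspace (LieAlgebra.ad ℂ g Hk) 0 ⊔
    Module.End.eigenspace (LieAlgebra.ad ℂ g Hk) 2 ⊔
      Module.End.eigenspace (LieAlgebra.ad ℂ g Hk) (-2)

/-- The pair `(I_k, J_k)` (for `I_k` the connected component of `k` in `J ∪ {k}`) is an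
irreducible `C`-admissible pair. -/
def CAdmissibleComponent (G : KacMoodyAlgebra A g) (J : Set I) (k : I) : Prop :=
  IsFiniteType (restrictM A (cmpnt A (J ∪ {k}) k)) ∧
    ∃ Hk : G.H, IsHGen G (cmpnt A (J ∪ {k}) k) k Hk ∧
      ∃ E F : g, E ∈ gS G (cmpnt A (J ∪ {k}) k) ∧ F ∈ gS G (cmpnt A (J ∪ {k}) k) ∧
        IsSl2Triple (Hk : g) E F ∧ A1GradedBy G (cmpnt A (J ∪ {k}) k) (Hk : g)

/-- The data of a `C`-admissible pair `(I, J)` : for each `k ∉ J`, the component `I_k` is of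
finite type and carries an `sl₂`-triple `(E_k, H_k, F_k)` which `A₁`-grades `g(I_k)`. -/
structure CAdmissibleData (G : KacMoodyAlgebra A g) (J : Set I) : Type _ where
  finJ : IsFiniteType (restrictM A J)
  Hc : {k : I // k ∉ J} → G.H
  E : {k : I // k ∉ J} → g
  F : {k : I // k ∉ J} → g
  finIk : ∀ k : {k : I // k ∉ J}, IsFiniteType (restrictM A (cmpnt A (J ∪ {k.1}) k.1))
  isHGen : ∀ k, IsHGen G (cmpnt A (J ∪ {k.1}) k.1) k.1 (Hc k)
  memE : ∀ k, E k ∈ gS G (cmpnt A (J ∪ {k.1}) k.1)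
  memF : ∀ k, F k ∈ gS G (cmpnt A (J ∪ {k.1}) k.1)
  sl2 : ∀ k, IsSl2Triple ((Hc k : g)) (E k) (F k)
  a1 : ∀ k, A1GradedBy G (cmpnt A (J ∪ {k.1}) k.1) ((Hc k : g))

/-- `(I,J)` is a `C`-admissible pair. -/
def CAdmissiblePair (G : KacMoodyAlgebra A g) (J : Set I) : Prop :=
  Nonempty (CAdmissibleData G J)

/-- The data of a `C`-admissible pair `(Itot, J)` for a subdiagram `Itot ⊆ I`. -/
structure CAdmissibleDataIn (G : KacMoodyAlgebra A g) (Itot J : Set I) : Type _ where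
  subJ : J ⊆ Itot
  finJ : IsFiniteType (restrictM A J)
  Hc : {k : I // k ∈ Itot ∧ k ∉ J} → G.H
  E : {k : I // k ∈ Itot ∧ k ∉ J} → g
  F : {k : I // k ∈ Itot ∧ k ∉ J} → g
  finIk : ∀ k : {k : I // k ∈ Itot ∧ k ∉ J},
    IsFiniteType (restrictM A (cmpnt A (J ∪ {k.1}) k.1))
  isHGen : ∀ k, IsHGen G (cmpnt A (J ∪ {k.1}) k.1) k.1 (Hc k)
  memE : ∀ k, E k ∈ gS G (cmpnt A (J ∪ {k.1}) k.1)
  memF : ∀ k, F k ∈ gS G (cmpnt A (J ∪ {k.1}) k.1)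
  sl2 : ∀ k, IsSl2Triple ((Hc k : g)) (E k) (F k)
  a1 : ∀ k, A1GradedBy G (cmpnt A (J ∪ {k.1}) k.1) ((Hc k : g))

/-- The `C`-admissible subalgebra `g^J` : generated by `h^J` and the `E_k, F_k`. -/
def CAdmissibleData.gJ {G : KacMoodyAlgebra A g} {J : Set I} (D : CAdmissibleData G J) :
    LieSubalgebra ℂ g :=
  LieSubalgebra.lieSpan ℂ g
    ((((hJsub G J).map G.H.subtype : Submodule ℂ g) : Set g) ∪ Set.range D.E ∪ Set.range D.F)

/-- `GJ` is "the" Kac-Moody structure on `g^J` associated to a `C`-admissible pair: its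
Cartan subalgebra is `h^J`, its coroots are the `H_k` and its Chevalley generators are the
`E_k, F_k`; the matrix `A'` is `A^J`, i.e. `a'_{k,l} = ⟨α_l, H_k⟩`. -/
def CAdmissibleData.IsAssocKM {G : KacMoodyAlgebra A g} {J : Set I} (D : CAdmissibleData G J)
    {A' : Matrix {k : I // k ∉ J} {k : I // k ∉ J} ℤ}
    (GJ : KacMoodyAlgebra A' ↥D.gJ) : Prop :=
  (∀ k l, (A' k l : ℂ) = G.root l.1 (D.Hc k)) ∧
  GJ.H.map D.gJ.toSubmodule.subtype = (hJsub G J).map G.H.subtype ∧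
  (∀ k, ((GJ.coroot k : ↥D.gJ) : g) = ((D.Hc k : ↥G.H) : g)) ∧
  (∀ k, ((GJ.e k : ↥D.gJ) : g) = D.E k) ∧ (∀ k, ((GJ.f k : ↥D.gJ) : g) = D.F k)

/-! ### Finite gradations -/

/-- `g` is finitely `Σ`-graded, where `Σ` is the root system of the Kac-Moody algebra `m`
(with Kac-Moody structure `M`) and `m` is embedded in `g` by `φ` (the grading subalgebra is
the image of `φ`): `g` is the sum of the weight spaces `V_γ`, `γ ∈ Σ ∪ {0}`, of the adjoint
action of the Cartan subalgebra of `m`, and each `V_γ` is finite dimensional. -/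
def IsFinGrading {S : Type*} [Fintype S] [DecidableEq S] {B : Matrix S S ℤ}
    {m : Type*} [LieRing m] [LieAlgebra ℂ m] (M : KacMoodyAlgebra B m)
    (φ : m →ₗ⁅ℂ⁆ g) : Prop :=
  Function.Injective φ ∧
  (⨆ χ ∈ insert (0 : Module.Dual ℂ M.H) (Delta M),
      wtSpaceι (φ.toLinearMap ∘ₗ M.H.subtype) χ) = ⊤ ∧
  ∀ χ ∈ insert (0 : Module.Dual ℂ M.H) (Delta M),
      FiniteDimensional ℂ (wtSpaceι (φ.toLinearMap ∘ₗ M.H.subtype) χ)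

section Grading

variable {S : Type*} [Fintype S] [DecidableEq S] {B : Matrix S S ℤ}
variable {m : Type*} [LieRing m] [LieAlgebra ℂ m]

/-- The inclusion of the Cartan subalgebra of the grading subalgebra into the Cartan
subalgebra of `g` (given `a ⊆ h`). -/
def cartanIncl (G : KacMoodyAlgebra A g) (M : KacMoodyAlgebra B m) (φ : m →ₗ⁅ℂ⁆ g)
    (hle : M.H.map φ.toLinearMap ≤ G.H) : M.H →ₗ[ℂ] G.H :=
  LinearMap.codRestrict G.H (φ.toLinearMap ∘ₗ M.H.subtype)
    (fun x => hle (Submodule.mem_map_of_mem x.2))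

/-- The restriction `ρ_a(χ)` to the Cartan subalgebra `a` of `m` of a linear form `χ` on `h`. -/
def resD (G : KacMoodyAlgebra A g) (M : KacMoodyAlgebra B m) (φ : m →ₗ⁅ℂ⁆ g)
    (hle : M.H.map φ.toLinearMap ≤ G.H) (χ : Module.Dual ℂ G.H) : Module.Dual ℂ M.H :=
  χ.comp (cartanIncl G M φ hle)

/-- The restriction `ρ_a(α_i)` of the simple root `α_i` to `a`. -/
def resRoot (G : KacMoodyAlgebra A g) (M : KacMoodyAlgebra B m) (φ : m →ₗ⁅ℂ⁆ g)
    (hle : M.H.map φ.toLinearMap ≤ G.H) (i : I) : Module.Dual ℂ M.H :=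
  resD G M φ hle (G.root i)

/-- The root basis of `M` is adapted to the root basis of `G` :
`ρ_a(Δ⁺) ⊆ Σ⁺ ∪ {0}`. -/
def Adapted (G : KacMoodyAlgebra A g) (M : KacMoodyAlgebra B m) (φ : m →ₗ⁅ℂ⁆ g)
    (hle : M.H.map φ.toLinearMap ≤ G.H) : Prop :=
  ∀ χ ∈ posRoots G, resD G M φ hle χ = 0 ∨ resD G M φ hle χ ∈ posRoots M

/-- The set `J = {i ∈ I | ρ_a(α_i) = 0}`. -/
def Jof (G : KacMoodyAlgebra A g) (M : KacMoodyAlgebra B m) (φ : m →ₗ⁅ℂ⁆ g)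
    (hle : M.H.map φ.toLinearMap ≤ G.H) : Set I :=
  {i | resRoot G M φ hle i = 0}

/-- The set `Γ_s = {i ∈ I' | ρ_a(α_i) = γ_s}`. -/
def GammaOf (G : KacMoodyAlgebra A g) (M : KacMoodyAlgebra B m) (φ : m →ₗ⁅ℂ⁆ g)
    (hle : M.H.map φ.toLinearMap ≤ G.H) (s : S) : Set I :=
  {i | resRoot G M φ hle i = M.root s}

/-- The set `I'_re = {i ∈ I' | ρ_a(α_i) ∈ Π_a}`. -/
def IpRe (G : KacMoodyAlgebra A g) (M : KacMoodyAlgebra B m) (φ : m →ₗ⁅ℂ⁆ g)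
    (hle : M.H.map φ.toLinearMap ≤ G.H) : Set I :=
  {i | ∃ s : S, resRoot G M φ hle i = M.root s}

/-- The set `I'_im = {i ∈ I | ρ_a(α_i) ∉ Π_a ∪ {0}}`. -/
def IpIm (G : KacMoodyAlgebra A g) (M : KacMoodyAlgebra B m) (φ : m →ₗ⁅ℂ⁆ g)
    (hle : M.H.map φ.toLinearMap ≤ G.H) : Set I :=
  {i | resRoot G M φ hle i ≠ 0 ∧ ∀ s : S, resRoot G M φ hle i ≠ M.root s}

/-- The set `I_re` : union of the components `I_k`, `k ∈ I'_re`. -/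
def IreOf (G : KacMoodyAlgebra A g) (M : KacMoodyAlgebra B m) (φ : m →ₗ⁅ℂ⁆ g)
    (hle : M.H.map φ.toLinearMap ≤ G.H) : Set I :=
  {i | ∃ k ∈ IpRe G M φ hle, i ∈ cmpnt A (Jof G M φ hle ∪ {k}) k}

/-- `g` is maximally finitely graded: finitely graded, with `a ⊆ h`, the root basis of the
grading subalgebra adapted, and the corresponding sets `J` and `I'_im` empty. -/
def MaxFinGrading (G : KacMoodyAlgebra A g) (M : KacMoodyAlgebra B m) (φ : m →ₗ⁅ℂ⁆ g) : Prop :=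
  IsFinGrading M φ ∧ ∃ hle : M.H.map φ.toLinearMap ≤ G.H,
    Adapted G M φ hle ∧ Jof G M φ hle = ∅ ∧ IpIm G M φ hle = ∅

end Grading

/-- `(π, πv)` is a root basis (with generalized Cartan matrix `B`) of the root system `Rts`. -/
def IsRootBasis {V : Type*} [AddCommGroup V] [Module ℂ V] {S : Type*} [Fintype S]
    (B : Matrix S S ℤ) (Rts : Set (Module.Dual ℂ V)) (π : S → Module.Dual ℂ V)
    (πv : S → V) : Prop :=
  LinearIndependent ℂ π ∧ LinearIndependent ℂ πv ∧
  (∀ s t, π t (πv s) = (B s t : ℂ)) ∧ (∀ s, π s ∈ Rts) ∧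
  ∀ χ ∈ Rts, (∃ c : S → ℕ, χ = ∑ s, (c s : ℂ) • π s) ∨
    (∃ c : S → ℕ, χ = -∑ s, (c s : ℂ) • π s)

/-- `Bf` is a nondegenerate invariant symmetric bilinear form on `g`. -/
def InvariantForm (Bf : g →ₗ[ℂ] g →ₗ[ℂ] ℂ) : Prop :=
  (∀ x y, Bf x y = Bf y x) ∧ (∀ x y z, Bf ⁅x, y⁆ z = Bf x ⁅y, z⁆) ∧
  ∀ x, (∀ y, Bf x y = 0) → x = 0

/-- `Bf` is "the" invariant bilinear form of the Kac-Moody algebra `G` : nondegenerate,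
invariant, symmetric, with `(α_i∨, α_i∨)` a positive rational for all `i`. -/
def NormalizedInvForm (G : KacMoodyAlgebra A g) (Bf : g →ₗ[ℂ] g →ₗ[ℂ] ℂ) : Prop :=
  InvariantForm Bf ∧ ∀ i : I, ∃ q : ℚ, 0 < q ∧ Bf ((G.coroot i : g)) ((G.coroot i : g)) = (q : ℂ)

/-- `(e', f')` is a system of Chevalley generators for `G` (with the given Cartan subalgebra,
simple roots and coroots). -/
def IsChevalleyGens (G : KacMoodyAlgebra A g) (e' f' : I → g) : Prop :=
  (∀ (x : G.H) (i : I), ⁅(x : g), e' i⁆ = G.root i x • e' i) ∧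
  (∀ (x : G.H) (i : I), ⁅(x : g), f' i⁆ = -(G.root i x) • f' i) ∧
  (∀ i j, ⁅e' i, f' j⁆ = if j = i then ((G.coroot i : g)) else 0) ∧
  (∀ i j, i ≠ j → ((LieAlgebra.ad ℂ g (e' i)) ^ (1 - A i j).toNat) (e' j) = 0) ∧
  (∀ i j, i ≠ j → ((LieAlgebra.ad ℂ g (f' i)) ^ (1 - A i j).toNat) (f' j) = 0) ∧
  LieSubalgebra.lieSpan ℂ g ((G.H : Set g) ∪ Set.range e' ∪ Set.range f') = ⊤


/-- The subalgebra `g(I_re)` of `g` generated by `h_{I_re}` and the `e_i, f_i`, `i ∈ I_re`. -/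
def gIre (G : KacMoodyAlgebra A g) (Ire : Set I) (hIre : Submodule ℂ g) : LieSubalgebra ℂ g :=
  LieSubalgebra.lieSpan ℂ g
    ((hIre : Set g) ∪ {x | ∃ i ∈ Ire, x = G.e i} ∪ {x | ∃ i ∈ Ire, x = G.f i})

/-- `GI` is "the" Kac-Moody structure on `g(I_re)` : its Cartan subalgebra is `h_{I_re}`,
its coroots and Chevalley generators are the `α_i∨, e_i, f_i` of `g`, for `i ∈ I_re`. -/
def IsAssocKMIre (G : KacMoodyAlgebra A g) (Ire : Set I) (hIre : Submodule ℂ g)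
    {A'' : Matrix ↥Ire ↥Ire ℤ} (GI : KacMoodyAlgebra A'' ↥(gIre G Ire hIre)) : Prop :=
  GI.H.map (gIre G Ire hIre).toSubmodule.subtype = hIre ∧
  (∀ i, ((GI.coroot i : ↥(gIre G Ire hIre)) : g) = ((G.coroot i.1 : ↥G.H) : g)) ∧
  (∀ i, ((GI.e i : ↥(gIre G Ire hIre)) : g) = G.e i.1) ∧
  (∀ i, ((GI.f i : ↥(gIre G Ire hIre)) : g) = G.f i.1)

/-! ### Admissible quotients and maximal gradations -/

/-- `ρ : I → S` is an admissible quotient map for `A` : fibers are totally disconnected (MG1)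
and the column sums over a fiber are constant along fibers (MG2). -/
def AdmissibleQuotient {I S : Type*} (A : Matrix I I ℤ) (ρ : I → S) : Prop :=
  Function.Surjective ρ ∧
  (∀ k l, k ≠ l → ρ k = ρ l → A k l = 0) ∧
  ∀ s t : S, s ≠ t → ∀ j j', ρ j = t → ρ j' = t →
    ∑ᶠ i ∈ {i | ρ i = s}, A i j = ∑ᶠ i ∈ {i | ρ i = s}, A i j'

section Quotient

variable {S : Type*} [Fintype S] [DecidableEq S]

/-- `γ_s∨ = ∑_{k ∈ Γ_s} α_k∨`. -/
def gammaV (G : KacMoodyAlgebra A g) (ρ : I → S) (s : S) : G.H :=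
  ∑ᶠ k ∈ {k | ρ k = s}, G.coroot k

/-- `X̄_s = ∑_{k ∈ Γ_s} e_k`. -/
def Xbar (G : KacMoodyAlgebra A g) (ρ : I → S) (s : S) : g :=
  ∑ᶠ k ∈ {k | ρ k = s}, G.e k

/-- `Ȳ_s = ∑_{k ∈ Γ_s} f_k`. -/
def Ybar (G : KacMoodyAlgebra A g) (ρ : I → S) (s : S) : g :=
  ∑ᶠ k ∈ {k | ρ k = s}, G.f k

/-- The subalgebra `g^ρ` generated by `a` and the `X̄_s, Ȳ_s`. -/
def gRho (G : KacMoodyAlgebra A g) (ρ : I → S) (a : Submodule ℂ G.H) : LieSubalgebra ℂ g :=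
  LieSubalgebra.lieSpan ℂ g
    (((a.map G.H.subtype : Submodule ℂ g) : Set g) ∪ Set.range (Xbar G ρ) ∪
      Set.range (Ybar G ρ))

/-- `Gρ` is "the" Kac-Moody structure on `g^ρ` : its Cartan subalgebra is `a`, its coroots
are the `γ_s∨` and its Chevalley generators are the `X̄_s, Ȳ_s`. -/
def IsAssocKMrho (G : KacMoodyAlgebra A g) (ρ : I → S) (a : Submodule ℂ G.H)
    {Abar : Matrix S S ℤ} (Gρ : KacMoodyAlgebra Abar ↥(gRho G ρ a)) : Prop :=
  Gρ.H.map (gRho G ρ a).toSubmodule.subtype = a.map G.H.subtype ∧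
  (∀ s, ((Gρ.coroot s : ↥(gRho G ρ a)) : g) = ((gammaV G ρ s : ↥G.H) : g)) ∧
  (∀ s, ((Gρ.e s : ↥(gRho G ρ a)) : g) = Xbar G ρ s) ∧
  (∀ s, ((Gρ.f s : ↥(gRho G ρ a)) : g) = Ybar G ρ s)

end Quotient

end KMG

namespace KMG

open Module

/-! ### Weight vectors and their spans -/

section Weights

variable {g : Type*} [LieRing g] [LieAlgebra ℂ g] {V : Type*} [AddCommGroup V] [Module ℂ V]

theorem lie_mem_wtSpaceι {ι : V →ₗ[ℂ] g} {χ ψ : Module.Dual ℂ V} {x y : g}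
    (hx : x ∈ wtSpaceι ι χ) (hy : y ∈ wtSpaceι ι ψ) : ⁅x, y⁆ ∈ wtSpaceι ι (χ + ψ) := fun v => by
  rw [leibniz_lie, hx v, hy v, smul_lie, lie_smul, LinearMap.add_apply, add_smul]

theorem ad_pow_mem_wtSpaceι {ι : V →ₗ[ℂ] g} {χ ψ : Module.Dual ℂ V} {x y : g}
    (hx : x ∈ wtSpaceι ι χ) (hy : y ∈ wtSpaceι ι ψ) (n : ℕ) :
    ((LieAlgebra.ad ℂ g x) ^ n) y ∈ wtSpaceι ι (ψ + (n : ℂ) • χ) := by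
  induction n with
  | zero => simpa using hy
  | succ n ih =>
    rw [pow_succ', Module.End.mul_apply, LieAlgebra.ad_apply]
    convert lie_mem_wtSpaceι hx ih using 2
    ext v
    simp
    ring

theorem eq_zero_of_sum_wt_eq_zero (ι : V →ₗ[ℂ] g) (s : Finset (Module.Dual ℂ V)) :
    ∀ x : Module.Dual ℂ V → g, (∀ χ ∈ s, x χ ∈ wtSpaceι ι χ) → ∑ χ ∈ s, x χ = 0 →
      ∀ χ ∈ s, x χ = 0 := by
  induction s using Finset.induction_on with
  | empty => simp
  | insert χ₀ s hχ₀ ih =>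
    intro x hx hsum
    have hs : ∀ χ ∈ s, x χ = 0 := by
      intro χ hχ
      obtain ⟨v, hv⟩ : ∃ v, χ v ≠ χ₀ v := by
        by_contra! h
        exact hχ₀ (LinearMap.ext h ▸ hχ)
      have key := ih (fun ψ => (ψ v - χ₀ v) • x ψ)
        (fun ψ hψ => Submodule.smul_mem _ _ (hx ψ (Finset.mem_insert_of_mem hψ))) (by
          have h1 : ⁅ι v, ∑ ψ ∈ insert χ₀ s, x ψ⁆ = 0 := by rw [hsum, lie_zero]
          have h2 : ∑ ψ ∈ insert χ₀ s, ψ v • x ψ = 0 := by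
            rw [← h1, lie_sum]
            exact Finset.sum_congr rfl fun ψ hψ => (hx ψ hψ v).symm
          have h3 : ∑ ψ ∈ insert χ₀ s, (ψ v - χ₀ v) • x ψ = 0 := by
            simp only [sub_smul, Finset.sum_sub_distrib, h2, ← Finset.smul_sum, hsum, smul_zero,
              sub_zero]
          simpa [Finset.sum_insert hχ₀] using h3) χ hχ
      exact (smul_eq_zero.1 key).resolve_left (sub_ne_zero.2 hv)
    intro χ hχ
    rcases Finset.mem_insert.1 hχ with rfl | hχ
    · rw [Finset.sum_insert hχ₀, Finset.sum_eq_zero hs, add_zero] at hsum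
      exact hsum
    · exact hs χ hχ

theorem mem_span_inter_wtSpaceι {ι : V →ₗ[ℂ] g} {s : Set g}
    (hs : ∀ x ∈ s, ∃ χ, x ∈ wtSpaceι ι χ) {z : g} (hz : z ∈ Submodule.span ℂ s)
    {χ : Module.Dual ℂ V} (hzχ : z ∈ wtSpaceι ι χ) :
    z ∈ Submodule.span ℂ (s ∩ wtSpaceι ι χ) := by
  have key : ∃ x : Module.Dual ℂ V →₀ g, (∀ ψ, x ψ ∈ Submodule.span ℂ (s ∩ wtSpaceι ι ψ)) ∧
      x.sum (fun _ y => y) = z := by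
    clear hzχ
    induction hz using Submodule.span_induction with
    | mem x hx =>
      obtain ⟨ψ, hψ⟩ := hs x hx
      refine ⟨Finsupp.single ψ x, fun ψ' => ?_, by simp⟩
      rcases eq_or_ne ψ ψ' with rfl | h
      · rw [Finsupp.single_eq_same]
        exact Submodule.subset_span (s := s ∩ wtSpaceι ι ψ) ⟨hx, hψ⟩
      · rw [Finsupp.single_eq_of_ne h.symm]; exact zero_mem _
    | zero => exact ⟨0, fun _ => zero_mem _, by simp⟩
    | add x y _ _ hx hy =>
      obtain ⟨a, ha, rfl⟩ := hx
      obtain ⟨b, hb, rfl⟩ := hy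
      exact ⟨a + b, fun ψ => add_mem (ha ψ) (hb ψ),
        Finsupp.sum_add_index' (fun _ => rfl) fun _ _ _ => rfl⟩
    | smul c x _ hx =>
      obtain ⟨a, ha, rfl⟩ := hx
      refine ⟨c • a, fun ψ => Submodule.smul_mem _ _ (ha ψ), ?_⟩
      rw [Finsupp.sum_smul_index' (fun _ => rfl), Finsupp.smul_sum]
  obtain ⟨x, hx, hsum⟩ := key
  have hle : ∀ ψ, Submodule.span ℂ (s ∩ wtSpaceι ι ψ) ≤ wtSpaceι ι ψ := fun ψ =>
    Submodule.span_le.2 Set.inter_subset_right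
  have h0 := eq_zero_of_sum_wt_eq_zero ι (insert χ x.support)
    (fun ψ => x ψ - if ψ = χ then z else 0) (fun ψ _ => by
      refine sub_mem (hle ψ (hx ψ)) ?_
      split_ifs with h
      · exact h ▸ hzχ
      · exact zero_mem _) (by
      rw [Finset.sum_sub_distrib, Finset.sum_ite_eq' , if_pos (Finset.mem_insert_self _ _),
        ← hsum, sub_eq_zero, Finsupp.sum]
      exact (Finset.sum_subset (Finset.subset_insert _ _) fun ψ _ hψ => by simpa using hψ).symm)
    χ (Finset.mem_insert_self _ _)
  simp only [if_true] at h0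
  rw [← sub_eq_zero.1 h0]
  exact hx χ

theorem exists_mem_of_wtSpaceι_ne_bot {ι : V →ₗ[ℂ] g} {s : Set g}
    (hs : ∀ x ∈ s, ∃ χ, x ∈ wtSpaceι ι χ) (htop : Submodule.span ℂ s = ⊤)
    {χ : Module.Dual ℂ V} (hχ : wtSpaceι ι χ ≠ ⊥) : ∃ x ∈ s, x ≠ 0 ∧ x ∈ wtSpaceι ι χ := by
  obtain ⟨z, hz, hz0⟩ := (Submodule.ne_bot_iff _).1 hχ
  by_contra! h
  have := mem_span_inter_wtSpaceι hs (htop ▸ Submodule.mem_top : z ∈ _) hz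
  rw [Submodule.span_eq_bot.2 fun x hx => by_contra fun h0 => h x hx.1 h0 hx.2] at this
  exact hz0 this

theorem eq_of_mem_wtSpaceι {ι : V →ₗ[ℂ] g} {χ ψ : Module.Dual ℂ V} {x : g} (hx : x ≠ 0)
    (h1 : x ∈ wtSpaceι ι χ) (h2 : x ∈ wtSpaceι ι ψ) : χ = ψ := LinearMap.ext fun v =>
  smul_left_injective ℂ hx ((h1 v).symm.trans (h2 v))

theorem mem_of_iSup_wtSpaceι_eq_top {ι : V →ₗ[ℂ] g} {Φ : Set (Module.Dual ℂ V)}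
    (htop : (⨆ χ ∈ Φ, wtSpaceι ι χ) = ⊤) {χ : Module.Dual ℂ V} (hχ : wtSpaceι ι χ ≠ ⊥) :
    χ ∈ Φ := by
  have hspan : Submodule.span ℂ {x | ∃ ψ ∈ Φ, x ∈ wtSpaceι ι ψ} = ⊤ := by
    refine top_unique (htop.ge.trans (iSup₂_le fun ψ hψ x hx => Submodule.subset_span ⟨ψ, hψ, hx⟩))
  obtain ⟨x, ⟨ψ, hψ, hxψ⟩, hx0, hx⟩ := exists_mem_of_wtSpaceι_ne_bot
    (s := {x | ∃ ψ ∈ Φ, x ∈ wtSpaceι ι ψ}) (fun x hx => hx.imp fun _ h => h.2) hspan hχ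
  exact eq_of_mem_wtSpaceι hx0 hxψ hx ▸ hψ

theorem finite_setOf_wtSpaceι_ne_bot {ι : V →ₗ[ℂ] g} {T : Type*} (w : T → Module.Dual ℂ V)
    (hw : Function.Injective w) (U : Submodule ℂ g) [FiniteDimensional ℂ U]
    (hU : ∀ t, wtSpaceι ι (w t) ≤ U) : {t | wtSpaceι ι (w t) ≠ ⊥}.Finite := by
  choose x hx using fun t : {t | wtSpaceι ι (w t) ≠ ⊥} => (Submodule.ne_bot_iff _).1 t.2
  have hli : LinearIndependent ℂ (fun t => (⟨x t, hU _ (hx t).1⟩ : U)) := by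
    refine LinearIndependent.of_comp U.subtype ?_
    rw [linearIndependent_iff']
    intro s c hc t ht
    have hinj : Function.Injective fun t : {t | wtSpaceι ι (w t) ≠ ⊥} => w t.1 :=
      hw.comp Subtype.val_injective
    have h0 := eq_zero_of_sum_wt_eq_zero ι (s.image fun t => w t.1)
      (fun ψ => if h : ∃ t : {t | wtSpaceι ι (w t) ≠ ⊥}, w t.1 = ψ then
        c h.choose • x h.choose else 0) ?_ ?_ (w t.1) (Finset.mem_image_of_mem _ ht)
    · have h : ∃ t' : {t | wtSpaceι ι (w t) ≠ ⊥}, w t'.1 = w t.1 := ⟨t, rfl⟩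
      rw [dif_pos h, hinj h.choose_spec] at h0
      exact (smul_eq_zero.1 h0).resolve_right (hx t).2
    · intro ψ hψ
      split_ifs with h
      · exact Submodule.smul_mem _ _ (by have := (hx h.choose).1; rwa [h.choose_spec] at this)
      · exact zero_mem _
    · rw [Finset.sum_image fun a _ b _ hab => hinj hab, ← hc]
      refine Finset.sum_congr rfl fun t _ => ?_
      have h : ∃ t' : {t | wtSpaceι ι (w t) ≠ ⊥}, w t'.1 = w t.1 := ⟨t, rfl⟩
      rw [dif_pos h, hinj h.choose_spec]
      rfl
  exact Set.finite_coe_iff.1 hli.finite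
end Weights

/-! ### Integrable `sl₂`-triples -/

section Sl2

variable {g : Type*} [LieRing g] [LieAlgebra ℂ g]

theorem exists_nat_of_primitive {h e f : g} (t : IsSl2Triple h e f) {x : g} {μ : ℂ} (hx : x ≠ 0)
    (hh : ⁅h, x⁆ = μ • x) (he : ⁅e, x⁆ = 0) (hf : x ∈ LieSubalgebra.engel ℂ f) :
    ∃ N : ℕ, μ = N ∧ (∀ j ≤ N, ((LieAlgebra.ad ℂ g f) ^ j) x ≠ 0) ∧
      ((LieAlgebra.ad ℂ g f) ^ (N + 1)) x = 0 := by
  have P : t.HasPrimitiveVectorWith x μ := ⟨hx, hh, he⟩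
  rw [LieSubalgebra.mem_engel_iff] at hf
  obtain ⟨N, h1, h2⟩ := Nat.exists_not_and_succ_of_not_zero_of_exists
    (p := fun n => ((LieAlgebra.ad ℂ g f) ^ n) x = 0) (by simpa using hx) hf
  refine ⟨N, ?_, fun j hj h0 => h1 (Module.End.pow_map_zero_of_le hj h0), h2⟩
  have h3 := P.lie_e_pow_succ_toEnd_f N
  rw [show ((LieModule.toEnd ℂ g g f) ^ (N + 1)) x = 0 from h2, lie_zero, eq_comm,
    smul_eq_zero] at h3
  have h4 := h3.resolve_right h1
  rw [mul_eq_zero, sub_eq_zero] at h4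
  exact h4.resolve_left (Nat.cast_add_one_ne_zero N)

theorem exists_nat_of_lowest {h e f : g} (t : IsSl2Triple h e f) {x : g} {μ : ℂ} (hx : x ≠ 0)
    (hh : ⁅h, x⁆ = μ • x) (hf : ⁅f, x⁆ = 0) (he : x ∈ LieSubalgebra.engel ℂ e) :
    ∃ N : ℕ, μ = -(N : ℂ) ∧ (∀ j ≤ N, ((LieAlgebra.ad ℂ g e) ^ j) x ≠ 0) ∧
      ((LieAlgebra.ad ℂ g e) ^ (N + 1)) x = 0 := by
  obtain ⟨N, h1, h2⟩ := exists_nat_of_primitive t.symm hx (μ := -μ) (by rw [neg_lie, hh, neg_smul])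
    hf he
  exact ⟨N, by rw [← h1, neg_neg], h2⟩

variable {V : Type*} [AddCommGroup V] [Module ℂ V]

theorem exists_reflect_of_nonneg {ι : V →ₗ[ℂ] g} {h : V} {e f : g} (t : IsSl2Triple (ι h) e f)
    {β : Module.Dual ℂ V} (he : e ∈ wtSpaceι ι β) (hf : f ∈ wtSpaceι ι (-β))
    (hne : ∀ y, y ∈ LieSubalgebra.engel ℂ e) (hnf : ∀ y, y ∈ LieSubalgebra.engel ℂ f)
    (hβ : β h = 2)
    {χ : Module.Dual ℂ V} (hχ : wtSpaceι ι χ ≠ ⊥) :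
    ∃ (p N : ℕ), χ h + 2 * p = N ∧ ∀ j ≤ N, wtSpaceι ι (χ + ((p : ℂ) - j) • β) ≠ ⊥ := by
  obtain ⟨x, hx, hx0⟩ := (Submodule.ne_bot_iff _).1 hχ
  obtain ⟨p, h1, h2⟩ := Nat.exists_not_and_succ_of_not_zero_of_exists
    (p := fun n => ((LieAlgebra.ad ℂ g e) ^ n) x = 0) (by simpa using hx0)
    ((LieSubalgebra.mem_engel_iff _ _ _).1 (hne x))
  have hy := ad_pow_mem_wtSpaceι he hx p
  set y := ((LieAlgebra.ad ℂ g e) ^ p) x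
  rw [pow_succ', Module.End.mul_apply, LieAlgebra.ad_apply] at h2
  obtain ⟨N, h3, h4, -⟩ := exists_nat_of_primitive t h1 (hy h) h2 (hnf y)
  refine ⟨p, N, ?_, fun j hj => (Submodule.ne_bot_iff _).2 ⟨_, ?_, h4 j hj⟩⟩
  · rw [← h3]; simp [hβ, mul_comm]
  · convert ad_pow_mem_wtSpaceι hf hy j using 2
    ext v
    simp
    ring

/-- The weights of an integrable `sl₂`-triple are integral and stable under the simple
reflection. -/
theorem exists_reflect {ι : V →ₗ[ℂ] g} {h : V} {e f : g} (t : IsSl2Triple (ι h) e f)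
    {β : Module.Dual ℂ V} (he : e ∈ wtSpaceι ι β) (hf : f ∈ wtSpaceι ι (-β))
    (hne : ∀ y, y ∈ LieSubalgebra.engel ℂ e) (hnf : ∀ y, y ∈ LieSubalgebra.engel ℂ f)
    (hβ : β h = 2)
    {χ : Module.Dual ℂ V} (hχ : wtSpaceι ι χ ≠ ⊥) :
    ∃ n : ℤ, χ h = n ∧ wtSpaceι ι (χ - (n : ℂ) • β) ≠ ⊥ := by
  obtain ⟨p, N, h1, h2⟩ := exists_reflect_of_nonneg t he hf hne hnf hβ hχ
  have hn : χ h = ((N - 2 * p : ℤ) : ℂ) := by push_cast; linear_combination h1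
  refine ⟨N - 2 * p, hn, ?_⟩
  rcases le_total p N with hp | hp
  · convert h2 (N - p) (by omega) using 2
    ext v
    simp [Nat.cast_sub hp]
    ring
  · have t' : IsSl2Triple (ι (-h)) f e := by rw [map_neg]; exact t.symm
    obtain ⟨q, N', h3, h4⟩ := exists_reflect_of_nonneg t' hf (by rwa [neg_neg]) hnf hne
      (by simpa using hβ) hχ
    have h5 : (N' : ℂ) = ((2 * q + 2 * p - N : ℤ) : ℂ) := by
      push_cast; rw [← h3]; simp only [map_neg]; rw [hn]; push_cast; ring
    have h6 : (N' : ℤ) = 2 * q + 2 * p - N := by exact_mod_cast h5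
    convert h4 (2 * p - N + q) (by omega) using 2
    have : N ≤ 2 * p := by omega
    ext v
    simp [Nat.cast_sub this]
    ring

end Sl2

/-! ### Triangular decomposition -/

section Triangular

theorem lieSpan_le_submodule {g : Type*} [LieRing g] [LieAlgebra ℂ g] {s : Set g}
    {K : Submodule ℂ g} (hs : s ⊆ K) (h : ∀ x ∈ s, ∀ y ∈ K, ⁅x, y⁆ ∈ K) :
    (LieSubalgebra.lieSpan ℂ g s).toSubmodule ≤ K := by
  have h1 : ∀ x ∈ LieSubalgebra.lieSpan ℂ g s, (∀ y ∈ K, ⁅x, y⁆ ∈ K) ∧ x ∈ K := fun x hx => by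
    induction hx using LieSubalgebra.lieSpan_induction with
    | mem x hx => exact ⟨h x hx, hs hx⟩
    | zero => exact ⟨fun y _ => by rw [zero_lie]; exact zero_mem _, zero_mem _⟩
    | smul a x _ hx =>
      exact ⟨fun y hy => by rw [smul_lie]; exact K.smul_mem _ (hx.1 y hy), K.smul_mem _ hx.2⟩
    | add x y _ _ hx hy =>
      exact ⟨fun z hz => by rw [add_lie]; exact add_mem (hx.1 z hz) (hy.1 z hz),
        add_mem hx.2 hy.2⟩
    | lie x y _ _ hx hy =>
      exact ⟨fun z hz => by
        rw [lie_lie]; exact sub_mem (hx.1 _ (hy.1 z hz)) (hy.1 _ (hx.1 z hz)), hx.1 y hy.2⟩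
  exact fun x hx => (h1 x hx).2

/-- Chevalley generators, without any Serre relation. -/
structure Pre (I : Type*) [DecidableEq I] (g : Type*) [LieRing g] [LieAlgebra ℂ g] where
  H : Submodule ℂ g
  root : I → Module.Dual ℂ H
  coroot : I → H
  e : I → g
  f : I → g
  indepRoot : LinearIndependent ℂ root
  abelian : ∀ x y : H, ⁅(x : g), (y : g)⁆ = 0
  lie_e : ∀ (x : H) (i : I), ⁅(x : g), e i⁆ = root i x • e i
  lie_f : ∀ (x : H) (i : I), ⁅(x : g), f i⁆ = -(root i x) • f i
  e_f : ∀ i j, ⁅e i, f j⁆ = if j = i then ((coroot i : g)) else 0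
  generates : LieSubalgebra.lieSpan ℂ g ((H : Set g) ∪ Set.range e ∪ Set.range f) = ⊤

variable {g : Type*} [LieRing g] [LieAlgebra ℂ g] {I : Type*} [DecidableEq I]

namespace Pre

/-- The Chevalley generators with the roles of `e` and `f` exchanged. -/
@[reducible, simps] def flip (P : Pre I g) : Pre I g where
  H := P.H
  root i := -P.root i
  coroot i := -P.coroot i
  e := P.f
  f := P.e
  indepRoot := P.indepRoot.neg
  abelian := P.abelian
  lie_e x i := by simpa using P.lie_f x i
  lie_f x i := by simpa using P.lie_e x i
  e_f i j := by
    rw [← lie_skew, P.e_f]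
    by_cases h : i = j
    · subst h; simp
    · simp [h, Ne.symm h]
  generates := by rw [← P.generates, Set.union_right_comm]

/-- Iterated brackets of the generators `e i`, `i ∈ T`, with their multidegree. -/
inductive Word (P : Pre I g) (T : Set I) : (I → ℤ) → g → Prop
  | base (i : I) : i ∈ T → Word P T (Pi.single i 1) (P.e i)
  | step (i : I) (c : I → ℤ) (x : g) : i ∈ T → Word P T c x →
      Word P T (c + Pi.single i 1) ⁅P.e i, x⁆

variable {P : Pre I g} {T T' : Set I} {c : I → ℤ} {x : g}

namespace Word

theorem nonneg (h : P.Word T c x) : 0 ≤ c := by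
  induction h with
  | base i hi => exact Pi.single_nonneg.2 zero_le_one
  | step i c x hi _ ih => exact add_nonneg ih (Pi.single_nonneg.2 zero_le_one)

theorem ne_zero (h : P.Word T c x) : c ≠ 0 := by
  cases h with
  | base i hi => intro h; simpa using congrFun h i
  | step i c x hi h =>
    intro h0
    have h1 := congrFun h0 i
    have h2 := h.nonneg i
    simp at h1 h2
    omega

theorem eq_zero_of_notMem (h : P.Word T c x) {j : I} (hj : j ∉ T) : c j = 0 := by
  induction h with
  | base i hi => exact Pi.single_eq_of_ne (ne_of_mem_of_not_mem hi hj).symm _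
  | step i c x hi _ ih =>
    rw [Pi.add_apply, ih, Pi.single_eq_of_ne (ne_of_mem_of_not_mem hi hj).symm, add_zero]

theorem of_support (h : P.Word T c x) (hT : ∀ j, c j ≠ 0 → j ∈ T') : P.Word T' c x := by
  induction h with
  | base i hi => exact .base i (hT i (by simp))
  | step i c x hi h ih =>
    have hc := h.nonneg
    refine .step i c x (hT i ?_) (ih fun j hj => hT j ?_)
    · have := hc i; simp at this ⊢; omega
    · have := hc j
      by_cases hji : j = i
      · subst hji; simp at this ⊢; omega
      · simpa [hji] using hj

theorem eq_single_or (h : P.Word T c x) (hx : x ≠ 0) : (∃ i ∈ T, c = Pi.single i 1 ∧ x = P.e i) ∨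
    ∃ i ∈ T, ∃ y, y ≠ 0 ∧ P.Word T (c - Pi.single i 1) y ∧ x = ⁅P.e i, y⁆ := by
  cases h with
  | base i hi => exact .inl ⟨i, hi, rfl, rfl⟩
  | step i c x hi h =>
    refine .inr ⟨i, hi, x, ?_, by simpa using h, rfl⟩
    rintro rfl; simp at hx

theorem mem_of_mem {K : LieSubalgebra ℂ g} (h : P.Word T c x) (hK : ∀ i ∈ T, P.e i ∈ K) :
    x ∈ K := by
  induction h with
  | base i hi => exact hK i hi
  | step i c x hi _ ih => exact K.lie_mem (hK i hi) ih

theorem lie_eq_zero (h : P.Word T c x) {y : g} (hy : ∀ i ∈ T, ⁅y, P.e i⁆ = 0) : ⁅y, x⁆ = 0 := by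
  induction h with
  | base i hi => exact hy i hi
  | step i c x hi _ ih => rw [leibniz_lie, hy i hi, ih, zero_lie, lie_zero, add_zero]

end Word

theorem e_mem_wtSpaceι (P : Pre I g) (i : I) : P.e i ∈ wtSpaceι P.H.subtype (P.root i) :=
  fun h => P.lie_e h i

theorem f_mem_wtSpaceι (P : Pre I g) (i : I) : P.f i ∈ wtSpaceι P.H.subtype (-P.root i) :=
  fun h => P.lie_f h i

theorem flip_flip (P : Pre I g) : P.flip.flip = P := by
  cases P; simp [flip]

/-- Words of either sign supported on `T`, together with `D`. -/
def gens (P : Pre I g) (T : Set I) (D : Submodule ℂ g) : Set g :=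
  {x | (∃ c, P.Word T c x) ∨ x ∈ D ∨ ∃ c, P.flip.Word T c x}

theorem gens_flip (P : Pre I g) (T : Set I) (D : Submodule ℂ g) : P.flip.gens T D = P.gens T D := by
  ext x
  simp only [gens, flip_flip, Set.mem_ofPred_eq]
  tauto

variable [Fintype I]

/-- The linear form of multidegree `c`. -/
def wt (P : Pre I g) (c : I → ℤ) : Module.Dual ℂ P.H := ∑ i, (c i : ℂ) • P.root i

theorem wt_apply (P : Pre I g) (c : I → ℤ) (h : P.H) : P.wt c h = ∑ i, (c i : ℂ) * P.root i h := by
  simp [wt]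

@[simp] theorem wt_zero (P : Pre I g) : P.wt 0 = 0 := by simp [wt]

theorem wt_add (P : Pre I g) (c d : I → ℤ) : P.wt (c + d) = P.wt c + P.wt d := by
  simp [wt, add_smul, Finset.sum_add_distrib]

theorem wt_neg (P : Pre I g) (c : I → ℤ) : P.wt (-c) = -P.wt c := by
  simp [wt]

theorem wt_sub (P : Pre I g) (c d : I → ℤ) : P.wt (c - d) = P.wt c - P.wt d := by
  rw [sub_eq_add_neg, wt_add, wt_neg, sub_eq_add_neg]

@[simp] theorem wt_single (P : Pre I g) (i : I) (n : ℤ) :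
    P.wt (Pi.single i n) = (n : ℂ) • P.root i := by
  rw [wt, Finset.sum_eq_single i]
  · simp
  · intro j _ hj; simp [hj]
  · simp

theorem wt_flip (P : Pre I g) (c : I → ℤ) : P.flip.wt c = -P.wt c := by
  simp [wt]

theorem wt_injective (P : Pre I g) : Function.Injective P.wt := by
  intro c d h
  have h0 : P.wt (c - d) = 0 := by rw [wt_sub, h, sub_self]
  have := Fintype.linearIndependent_iff.1 P.indepRoot (fun i => ((c - d) i : ℂ)) h0
  ext i
  have h1 := this i
  simp only [Pi.sub_apply, Int.cast_sub, sub_eq_zero] at h1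
  exact_mod_cast h1

theorem Word.mem_wtSpaceι (h : P.Word T c x) : x ∈ wtSpaceι P.H.subtype (P.wt c) := by
  induction h with
  | base i hi => simpa using P.e_mem_wtSpaceι i
  | step i c x hi _ ih =>
    rw [wt_add, add_comm]
    simpa using lie_mem_wtSpaceι (P.e_mem_wtSpaceι i) ih

theorem Word.mem_wtSpaceι_flip (h : P.flip.Word T c x) :
    x ∈ wtSpaceι P.H.subtype (P.wt (-c)) := by
  rw [wt_neg, ← wt_flip]; exact h.mem_wtSpaceι

theorem lie_e_flip_word_mem {D : Submodule ℂ g} (hD : D ≤ P.H)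
    (hT : ∀ i ∈ T, (P.coroot i : g) ∈ D) {i : I} (hi : i ∈ T) (hx : P.flip.Word T c x) :
    ⁅P.e i, x⁆ ∈ Submodule.span ℂ (P.gens T D) := by
  suffices h : ⁅P.e i, x⁆ ∈ Submodule.span ℂ ((D : Set g) ∪ {x | ∃ c, P.flip.Word T c x}) from
    Submodule.span_mono (fun y hy => .inr hy) h
  have hstep : ∀ j ∈ T, ∀ y ∈ Submodule.span ℂ ((D : Set g) ∪ {x | ∃ c, P.flip.Word T c x}),
      ⁅P.f j, y⁆ ∈ Submodule.span ℂ ((D : Set g) ∪ {x | ∃ c, P.flip.Word T c x}) := by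
    intro j hj y hy
    induction hy using Submodule.span_induction with
    | mem y hy =>
      rcases hy with hy | ⟨c, hy⟩
      · rw [← lie_skew, P.lie_f ⟨y, hD hy⟩ j, neg_smul, neg_neg]
        exact Submodule.smul_mem _ _ (Submodule.subset_span (.inr ⟨_, .base (P := P.flip) j hj⟩))
      · exact Submodule.subset_span (.inr ⟨_, .step (P := P.flip) j c y hj hy⟩)
    | zero => rw [lie_zero]; exact zero_mem _
    | add x y _ _ hx hy => rw [lie_add]; exact add_mem hx hy
    | smul a x _ hx => rw [lie_smul]; exact Submodule.smul_mem _ _ hx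
  induction hx with
  | base j hj =>
    rw [flip_e, P.e_f]
    split_ifs with h
    · exact Submodule.subset_span (.inl (hT i hi))
    · exact zero_mem _
  | step j c x hj hx ih =>
    rw [flip_e, leibniz_lie, P.e_f]
    refine add_mem ?_ (hstep j hj _ ih)
    split_ifs with h
    · rw [show ⁅(P.coroot i : g), x⁆ = _ from hx.mem_wtSpaceι (P.coroot i)]
      exact Submodule.smul_mem _ _ (Submodule.subset_span (.inr ⟨c, hx⟩))
    · rw [zero_lie]; exact zero_mem _

theorem lie_e_mem_span_gens {D : Submodule ℂ g} (hD : D ≤ P.H)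
    (hT : ∀ i ∈ T, (P.coroot i : g) ∈ D) {i : I} (hi : i ∈ T)
    (hx : x ∈ Submodule.span ℂ (P.gens T D)) : ⁅P.e i, x⁆ ∈ Submodule.span ℂ (P.gens T D) := by
  induction hx using Submodule.span_induction with
  | mem x hx =>
    rcases hx with ⟨c, hx⟩ | hx | ⟨c, hx⟩
    · exact Submodule.subset_span (.inl ⟨_, .step i c x hi hx⟩)
    · rw [← lie_skew, P.lie_e ⟨x, hD hx⟩ i]
      exact neg_mem (Submodule.smul_mem _ _ (Submodule.subset_span (.inl ⟨_, .base i hi⟩)))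
    · exact lie_e_flip_word_mem hD hT hi hx
  | zero => rw [lie_zero]; exact zero_mem _
  | add x y _ _ hx hy => rw [lie_add]; exact add_mem hx hy
  | smul a x _ hx => rw [lie_smul]; exact Submodule.smul_mem _ _ hx

theorem exists_mem_wtSpaceι_of_mem_gens {D : Submodule ℂ g} (hD : D ≤ P.H)
    (hx : x ∈ P.gens T D) : ∃ c, x ∈ wtSpaceι P.H.subtype (P.wt c) := by
  rcases hx with ⟨c, hx⟩ | hx | ⟨c, hx⟩
  · exact ⟨c, hx.mem_wtSpaceι⟩
  · exact ⟨0, fun h => by simpa using P.abelian h ⟨x, hD hx⟩⟩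
  · exact ⟨_, hx.mem_wtSpaceι_flip⟩

theorem lie_H_mem_span_gens {D : Submodule ℂ g} (hD : D ≤ P.H) (h : P.H)
    (hx : x ∈ Submodule.span ℂ (P.gens T D)) :
    ⁅(h : g), x⁆ ∈ Submodule.span ℂ (P.gens T D) := by
  induction hx using Submodule.span_induction with
  | mem x hx =>
    obtain ⟨c, hc⟩ := exists_mem_wtSpaceι_of_mem_gens hD hx
    rw [show ⁅(h : g), x⁆ = _ from hc h]
    exact Submodule.smul_mem _ _ (Submodule.subset_span hx)
  | zero => rw [lie_zero]; exact zero_mem _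
  | add x y _ _ hx hy => rw [lie_add]; exact add_mem hx hy
  | smul a x _ hx => rw [lie_smul]; exact Submodule.smul_mem _ _ hx

/-- The triangular decomposition of the subalgebra generated by `D ⊆ H` and the `e i`, `f i`
with `i ∈ T`. -/
theorem lieSpan_le_span_gens {D : Submodule ℂ g} (hD : D ≤ P.H)
    (hT : ∀ i ∈ T, (P.coroot i : g) ∈ D) :
    (LieSubalgebra.lieSpan ℂ g ((D : Set g) ∪ {x | ∃ i ∈ T, x = P.e i} ∪
      {x | ∃ i ∈ T, x = P.f i})).toSubmodule ≤ Submodule.span ℂ (P.gens T D) := by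
  refine lieSpan_le_submodule ?_ ?_
  · rintro x ((hx | ⟨i, hi, rfl⟩) | ⟨i, hi, rfl⟩)
    · exact Submodule.subset_span (.inr (.inl hx))
    · exact Submodule.subset_span (.inl ⟨_, .base i hi⟩)
    · exact Submodule.subset_span (.inr (.inr ⟨_, .base (P := P.flip) i hi⟩))
  · rintro x ((hx | ⟨i, hi, rfl⟩) | ⟨i, hi, rfl⟩) y hy
    · exact lie_H_mem_span_gens hD ⟨x, hD hx⟩ hy
    · exact lie_e_mem_span_gens hD hT hi hy
    · rw [← gens_flip] at hy ⊢
      exact lie_e_mem_span_gens (P := P.flip) hD (fun i hi => by simpa using hT i hi) hi hy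

theorem span_gens_eq_top (P : Pre I g) : Submodule.span ℂ (P.gens Set.univ P.H) = ⊤ := by
  refine top_unique (le_trans (le_of_eq ?_) (lieSpan_le_span_gens (P := P) (T := Set.univ) le_rfl
    fun i _ => (P.coroot i).2))
  rw [eq_comm, LieSubalgebra.toSubmodule_eq_top, ← P.generates]
  congr 2
  · congr 1; ext x; simp [eq_comm]
  · ext x; simp [eq_comm]

theorem eq_zero_of_mem_gens {D : Submodule ℂ g} (hx : x ∈ P.gens T D) (hx0 : x ≠ 0)
    (h : x ∈ wtSpaceι P.H.subtype 0) : x ∈ D := by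
  rcases hx with ⟨c, hx⟩ | hx | ⟨c, hx⟩
  · exact absurd (P.wt_injective ((eq_of_mem_wtSpaceι hx0 hx.mem_wtSpaceι h).trans P.wt_zero.symm))
      hx.ne_zero
  · exact hx
  · exact absurd (P.wt_injective ((eq_of_mem_wtSpaceι hx0 hx.mem_wtSpaceι_flip h).trans
      P.wt_zero.symm)) (neg_ne_zero.2 hx.ne_zero)

theorem mem_of_mem_span_gens {D : Submodule ℂ g} (hD : D ≤ P.H)
    (hx : x ∈ Submodule.span ℂ (P.gens T D)) (h : x ∈ wtSpaceι P.H.subtype 0) : x ∈ D := by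
  have h1 := mem_span_inter_wtSpaceι
    (fun y hy => (exists_mem_wtSpaceι_of_mem_gens hD hy).imp' P.wt fun _ h => h) hx h
  refine (Submodule.span_le (p := D)).2 (fun y hy => ?_) h1
  rcases eq_or_ne y 0 with rfl | hy0
  · exact zero_mem _
  · exact eq_zero_of_mem_gens hy.1 hy0 hy.2

theorem wtSpaceι_zero (P : Pre I g) : wtSpaceι P.H.subtype (0 : Module.Dual ℂ P.H) = P.H := by
  refine le_antisymm (fun x hx => mem_of_mem_span_gens le_rfl (T := Set.univ) ?_ hx) fun x hx h => ?_
  · rw [span_gens_eq_top]; trivial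
  · simpa using P.abelian h ⟨x, hx⟩

theorem iSup_wtSpaceι (P : Pre I g) :
    ⨆ χ : Module.Dual ℂ P.H, wtSpaceι P.H.subtype χ = ⊤ := by
  rw [eq_top_iff, ← span_gens_eq_top P, Submodule.span_le]
  intro x hx
  obtain ⟨c, hc⟩ := exists_mem_wtSpaceι_of_mem_gens le_rfl hx
  exact (le_iSup (fun χ => wtSpaceι P.H.subtype χ) _) hc

/-- The weights of `g` under a space mapping to `H` are restrictions of multidegrees of
nonzero words. -/
theorem exists_word {V : Type*} [AddCommGroup V] [Module ℂ V] {τ : V →ₗ[ℂ] P.H}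
    {χ : Module.Dual ℂ V} (hχ : wtSpaceι (P.H.subtype ∘ₗ τ) χ ≠ ⊥) :
    ∃ c : I → ℤ, χ = (P.wt c).comp τ ∧ (c = 0 ∨ (∃ x, x ≠ 0 ∧ P.Word Set.univ c x) ∨
      ∃ x, x ≠ 0 ∧ P.flip.Word Set.univ (-c) x) := by
  have hw : ∀ {x : g} {c : I → ℤ}, x ∈ wtSpaceι P.H.subtype (P.wt c) →
      x ∈ wtSpaceι (P.H.subtype ∘ₗ τ) ((P.wt c).comp τ) := fun h v => h (τ v)
  obtain ⟨x, hx, hx0, hxχ⟩ := exists_mem_of_wtSpaceι_ne_bot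
    (fun y hy => (exists_mem_wtSpaceι_of_mem_gens le_rfl hy).imp' (fun c => (P.wt c).comp τ)
      fun _ h => hw h) P.span_gens_eq_top hχ
  rcases hx with ⟨c, hx⟩ | hx | ⟨c, hx⟩
  · exact ⟨c, eq_of_mem_wtSpaceι hx0 hxχ (hw hx.mem_wtSpaceι), .inr (.inl ⟨x, hx0, hx⟩)⟩
  · refine ⟨0, eq_of_mem_wtSpaceι hx0 hxχ (hw ?_), .inl rfl⟩
    rw [wt_zero, wtSpaceι_zero]; exact hx
  · exact ⟨-c, eq_of_mem_wtSpaceι hx0 hxχ (hw hx.mem_wtSpaceι_flip),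
      .inr (.inr ⟨x, hx0, by simpa using hx⟩)⟩

/-- The root spaces. -/
def W (P : Pre I g) (c : I → ℤ) : Submodule ℂ g := wtSpaceι P.H.subtype (P.wt c)

theorem W_flip (P : Pre I g) (c : I → ℤ) : P.flip.W c = P.W (-c) := by
  rw [W, W, wt_neg, ← wt_flip]

theorem Word.mem_W (h : P.Word T c x) : x ∈ P.W c := h.mem_wtSpaceι

theorem word_of_W_ne_bot (h : P.W c ≠ ⊥) : c = 0 ∨ (∃ x, x ≠ 0 ∧ P.Word Set.univ c x) ∨
    ∃ x, x ≠ 0 ∧ P.flip.Word Set.univ (-c) x := by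
  obtain ⟨d, hd, h⟩ := exists_word (P := P) (τ := LinearMap.id) h
  rw [LinearMap.comp_id] at hd
  rwa [P.wt_injective hd]

theorem nonneg_or_nonpos_of_W_ne_bot (h : P.W c ≠ ⊥) : 0 ≤ c ∨ c ≤ 0 := by
  rcases word_of_W_ne_bot h with rfl | ⟨x, -, hx⟩ | ⟨x, -, hx⟩
  · exact .inl le_rfl
  · exact .inl hx.nonneg
  · exact .inr (by simpa using hx.nonneg)

theorem word_of_W_ne_bot_of_pos (h : P.W c ≠ ⊥) {i : I} (hi : 0 < c i) :
    ∃ x, x ≠ 0 ∧ P.Word Set.univ c x := by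
  rcases word_of_W_ne_bot h with rfl | h | ⟨x, -, hx⟩
  · simp at hi
  · exact h
  · have := hx.nonneg i; simp at this; omega

theorem W_single_eq_bot {i : I} {n : ℤ} (hn : 2 ≤ n) : P.W (Pi.single i n) = ⊥ := by
  by_contra h
  obtain ⟨x, hx0, hx⟩ := word_of_W_ne_bot_of_pos h (i := i) (by simp; omega)
  have hx : P.Word {i} (Pi.single i n) x := hx.of_support fun j hj => by
    by_contra hji
    exact hj (Pi.single_eq_of_ne hji _)
  rcases hx.eq_single_or hx0 with ⟨j, rfl, h, -⟩ | ⟨j, rfl, y, hy0, hy, rfl⟩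
  · have := congrFun h j; simp at this; omega
  · have : ∀ c (y : g), P.Word {j} c y → y ≠ 0 → y = P.e j := fun c y hy hy0 => by
      induction hy with
      | base i hi => rw [show i = j from hi]
      | step i c x hi h ih =>
        rcases eq_or_ne x 0 with rfl | hx
        · simp at hy0
        · rw [ih hx, show i = j from hi] at hy0; simp at hy0
    rw [this _ _ hy hy0] at hx0
    simp at hx0

end Pre
end Triangular

/-! ### Kac-Moody algebras from Chevalley generators -/

section Construction

variable {g : Type*} [LieRing g] [LieAlgebra ℂ g] {I : Type*} [Fintype I] [DecidableEq I]
  {A : Matrix I I ℤ}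

/-- The underlying Chevalley generators of a Kac-Moody algebra. -/
abbrev KacMoodyAlgebra.toPre (G : KacMoodyAlgebra A g) : Pre I g where
  H := G.H
  root := G.root
  coroot := G.coroot
  e := G.e
  f := G.f
  indepRoot := G.indepRoot
  abelian := G.abelian
  lie_e := G.lie_e
  lie_f := G.lie_f
  e_f := G.e_f
  generates := G.generates

/-- The Kac-Moody structure with the roles of `e` and `f` exchanged. -/
@[reducible] def KacMoodyAlgebra.flip (G : KacMoodyAlgebra A g) : KacMoodyAlgebra A g where
  H := G.H
  root i := -G.root i
  coroot i := -G.coroot i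
  e := G.f
  f := G.e
  findimH := G.findimH
  finrankH := G.finrankH
  indepRoot := G.indepRoot.neg
  indepCoroot := G.indepCoroot.neg
  pairing i j := by simpa using G.pairing i j
  abelian := G.abelian
  lie_e x i := by simpa using G.lie_f x i
  lie_f x i := by simpa using G.lie_e x i
  e_f := G.toPre.flip.e_f
  serre_e := G.serre_f
  serre_f := G.serre_e
  generates := G.toPre.flip.generates
  weight_decomp := G.weight_decomp
  zero_weight := G.zero_weight

theorem gS_flip (G : KacMoodyAlgebra A g) (T : Set I) : gS G.flip T = gS G T := by
  rw [gS, gS, Set.union_comm]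

/-- A realization inside an ambient Lie algebra, together with Chevalley generators satisfying
the Serre relations, generates a Kac-Moody algebra. -/
theorem exists_kacMoodyAlgebra (L : LieSubalgebra ℂ g) (h0 : Submodule ℂ g)
    (rt : I → Module.Dual ℂ h0) (co : I → h0) (e f : I → g)
    (hL : L = LieSubalgebra.lieSpan ℂ g ((h0 : Set g) ∪ Set.range e ∪ Set.range f))
    (hfin : FiniteDimensional ℂ h0)
    (hrank : Module.finrank ℂ h0 = Fintype.card I + gcmCorank A)
    (indepRoot : LinearIndependent ℂ rt) (indepCoroot : LinearIndependent ℂ co)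
    (pairing : ∀ i j, rt j (co i) = (A i j : ℂ))
    (abelian : ∀ x ∈ h0, ∀ y ∈ h0, ⁅x, y⁆ = 0)
    (lie_e : ∀ (x : h0) (i : I), ⁅(x : g), e i⁆ = rt i x • e i)
    (lie_f : ∀ (x : h0) (i : I), ⁅(x : g), f i⁆ = -(rt i x) • f i)
    (e_f : ∀ i j, ⁅e i, f j⁆ = if j = i then ((co i : g)) else 0)
    (serre_e : ∀ i j, i ≠ j → ((LieAlgebra.ad ℂ g (e i)) ^ (1 - A i j).toNat) (e j) = 0)
    (serre_f : ∀ i j, i ≠ j → ((LieAlgebra.ad ℂ g (f i)) ^ (1 - A i j).toNat) (f j) = 0) :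
    ∃ K : KacMoodyAlgebra A L, K.H.map L.toSubmodule.subtype = h0 ∧
      (∀ i, ((K.coroot i : L) : g) = co i) ∧ (∀ i, (K.e i : g) = e i) ∧
      (∀ i, (K.f i : g) = f i) ∧
      ∀ i (x : K.H) (y : h0), ((x : L) : g) = y → K.root i x = rt i y := by
  have hs : ((h0 : Set g) ∪ Set.range e ∪ Set.range f) ⊆ L := hL ▸ LieSubalgebra.subset_lieSpan
  have hh : ∀ x ∈ h0, x ∈ L := fun x hx => hs (.inl (.inl hx))
  have he : ∀ i, e i ∈ L := fun i => hs (.inl (.inr ⟨i, rfl⟩))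
  have hf : ∀ i, f i ∈ L := fun i => hs (.inr ⟨i, rfl⟩)
  let H : Submodule ℂ L := h0.comap L.toSubmodule.subtype
  let E : H ≃ₗ[ℂ] h0 :=
    { toFun := fun x => ⟨(x : L), x.2⟩
      invFun := fun y => ⟨⟨y, hh y y.2⟩, y.2⟩
      map_add' := fun _ _ => rfl
      map_smul' := fun _ _ => rfl
      left_inv := fun _ => rfl
      right_inv := fun _ => rfl }
  have had : ∀ (x y : L) (n : ℕ), ((((LieAlgebra.ad ℂ L x) ^ n) y : L) : g) =
      ((LieAlgebra.ad ℂ g (x : g)) ^ n) (y : g) := by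
    intro x y n
    induction n with
    | zero => rfl
    | succ n ih => 
      rw [pow_succ', pow_succ', Module.End.mul_apply, Module.End.mul_apply, ← ih]; rfl
  have hgen : LieSubalgebra.lieSpan ℂ L ((H : Set L) ∪ Set.range (fun i => (⟨e i, he i⟩ : L)) ∪
      Set.range (fun i => (⟨f i, hf i⟩ : L))) = ⊤ := by
    rw [eq_top_iff]
    rintro ⟨x, hx⟩ -
    have key : ∀ y ∈ LieSubalgebra.lieSpan ℂ g ((h0 : Set g) ∪ Set.range e ∪ Set.range f),
        ∃ hy : y ∈ L, (⟨y, hy⟩ : L) ∈ LieSubalgebra.lieSpan ℂ L ((H : Set L) ∪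
          Set.range (fun i => (⟨e i, he i⟩ : L)) ∪ Set.range (fun i => (⟨f i, hf i⟩ : L))) := by
      intro y hy
      induction hy using LieSubalgebra.lieSpan_induction with
      | mem y hy =>
        refine ⟨hs hy, LieSubalgebra.subset_lieSpan ?_⟩
        rcases hy with (hy | ⟨i, rfl⟩) | ⟨i, rfl⟩
        · exact .inl (.inl hy)
        · exact .inl (.inr ⟨i, rfl⟩)
        · exact .inr ⟨i, rfl⟩
      | zero => exact ⟨zero_mem _, zero_mem _⟩
      | smul a y _ hy => exact ⟨L.smul_mem a hy.1, LieSubalgebra.smul_mem _ a hy.2⟩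
      | add y z _ _ hy hz => exact ⟨add_mem hy.1 hz.1, add_mem hy.2 hz.2⟩
      | lie y z _ _ hy hz => exact ⟨L.lie_mem hy.1 hz.1, LieSubalgebra.lie_mem _ hy.2 hz.2⟩
    exact (key x (hL ▸ hx)).2
  let P : Pre I L :=
    { H := H
      root := fun i => (rt i).comp E.toLinearMap
      coroot := fun i => E.symm (co i)
      e := fun i => ⟨e i, he i⟩
      f := fun i => ⟨f i, hf i⟩
      indepRoot := by
        rw [Fintype.linearIndependent_iff] at indepRoot ⊢
        refine fun c hc => indepRoot c (LinearMap.ext fun y => ?_)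
        simpa using LinearMap.congr_fun hc (E.symm y)
      abelian := fun x y => Subtype.ext (abelian _ x.2 _ y.2)
      lie_e := fun x i => Subtype.ext (lie_e (E x) i)
      lie_f := fun x i => Subtype.ext (lie_f (E x) i)
      e_f := fun i j => Subtype.ext ((e_f i j).trans (by split_ifs <;> rfl))
      generates := hgen }
  refine ⟨{ P with
      findimH := E.symm.finiteDimensional
      finrankH := E.finrank_eq.trans hrank
      indepCoroot := LinearIndependent.map' indepCoroot E.symm.toLinearMap (LinearEquiv.ker _)
      pairing := fun i j => by
        change rt j (E (E.symm (co i))) = _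
        rw [E.apply_symm_apply, pairing]
      serre_e := fun i j hij => Subtype.ext ((had _ _ _).trans (serre_e i j hij))
      serre_f := fun i j hij => Subtype.ext ((had _ _ _).trans (serre_f i j hij))
      weight_decomp := P.iSup_wtSpaceι
      zero_weight := P.wtSpaceι_zero }, ?_, fun _ => rfl, fun _ => rfl, fun _ => rfl, ?_⟩
  · refine le_antisymm ?_ fun y hy => ⟨⟨y, hh y hy⟩, hy, rfl⟩
    rintro _ ⟨y, hy, rfl⟩
    exact hy
  · intro i x y hxy
    change rt i (E x) = rt i y
    congr 1
    exact Subtype.ext hxy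

end Construction

/-! ### Weights of Kac-Moody algebras -/

section KacMoody

variable {g : Type*} [LieRing g] [LieAlgebra ℂ g] {I : Type*} [Fintype I] [DecidableEq I]
  {A : Matrix I I ℤ}

namespace KacMoodyAlgebra

theorem isSl2Triple (G : KacMoodyAlgebra A g) (hA : IsGCM A) (i : I) :
    IsSl2Triple (G.coroot i : g) (G.e i) (G.f i) where
  h_ne_zero := fun h => G.indepCoroot.ne_zero i (Subtype.ext h)
  lie_e_f := by rw [G.e_f, if_pos rfl]
  lie_h_e_nsmul := by
    rw [G.lie_e, G.pairing, hA.1]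
    norm_num [two_smul]
  lie_h_f_nsmul := by
    rw [G.lie_f, G.pairing, hA.1]
    norm_num [two_smul]

theorem mem_engel_e (G : KacMoodyAlgebra A g) (i : I) (y : g) :
    y ∈ LieSubalgebra.engel ℂ (G.e i) := by
  have hH : ∀ x : G.H, ⁅G.e i, (x : g)⁆ = -(G.root i x) • G.e i := fun x => by
    rw [← lie_skew, G.lie_e, neg_smul]
  suffices h : LieSubalgebra.lieSpan ℂ g ((G.H : Set g) ∪ Set.range G.e ∪ Set.range G.f) ≤
      LieSubalgebra.engel ℂ (G.e i) from h (G.generates ▸ LieSubalgebra.mem_top y)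
  rw [LieSubalgebra.lieSpan_le]
  rintro x ((hx | ⟨j, rfl⟩) | ⟨j, rfl⟩) <;> rw [SetLike.mem_coe, LieSubalgebra.mem_engel_iff]
  · refine ⟨2, ?_⟩
    rw [pow_two, Module.End.mul_apply, LieAlgebra.ad_apply, LieAlgebra.ad_apply, hH ⟨x, hx⟩,
      lie_smul, lie_self, smul_zero]
  · rcases eq_or_ne i j with rfl | h
    · exact ⟨1, by rw [pow_one, LieAlgebra.ad_apply, lie_self]⟩
    · exact ⟨_, G.serre_e i j h⟩
  · by_cases h : j = i
    · subst h
      refine ⟨3, ?_⟩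
      rw [pow_succ', pow_succ', pow_one, Module.End.mul_apply, Module.End.mul_apply,
        LieAlgebra.ad_apply, LieAlgebra.ad_apply, LieAlgebra.ad_apply, G.e_f, if_pos rfl, hH,
        lie_smul, lie_self, smul_zero]
    · exact ⟨1, by rw [pow_one, LieAlgebra.ad_apply, G.e_f, if_neg h]⟩

theorem mem_engel_f (G : KacMoodyAlgebra A g) (i : I) (y : g) :
    y ∈ LieSubalgebra.engel ℂ (G.f i) := G.flip.mem_engel_e i y

theorem e_ne_zero (G : KacMoodyAlgebra A g) (i : I) : G.e i ≠ 0 := fun h =>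
  G.indepCoroot.ne_zero i (Subtype.ext (by simpa [h] using (G.e_f i i).symm))

theorem wt_coroot (G : KacMoodyAlgebra A g) (c : I → ℤ) (i : I) :
    G.toPre.wt c (G.coroot i) = ((∑ j, A i j * c j : ℤ) : ℂ) := by
  rw [Pre.wt_apply]
  push_cast
  exact Finset.sum_congr rfl fun j _ => by rw [G.pairing, mul_comm]

theorem W_reflect (G : KacMoodyAlgebra A g) (hA : IsGCM A) (i : I) {c : I → ℤ}
    (h : G.toPre.W c ≠ ⊥) : G.toPre.W (c - Pi.single i (∑ j, A i j * c j)) ≠ ⊥ := by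
  obtain ⟨n, h1, h2⟩ := exists_reflect (ι := G.H.subtype) (G.isSl2Triple hA i)
    (G.toPre.e_mem_wtSpaceι i) (G.toPre.f_mem_wtSpaceι i) (G.mem_engel_e i)
    (G.mem_engel_f i) (by rw [G.pairing, hA.1]; norm_num) h
  rw [G.wt_coroot] at h1
  rw [Int.cast_inj.1 h1, Pre.W, Pre.wt_sub, Pre.wt_single]
  exact h2

theorem exists_forall_W_add_eq_bot (G : KacMoodyAlgebra A g) (hA : IsGCM A) (i : I) (c : I → ℤ) :
    ∃ n₀ : ℕ, ∀ n : ℕ, n₀ ≤ n → G.toPre.W (c + Pi.single i (n : ℤ)) = ⊥ := by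
  by_cases h0 : ∃ t, t ≠ i ∧ c t ≠ 0
  · obtain ⟨t, hti, ht⟩ := h0
    refine ⟨(|c i| + |∑ j, A i j * c j|).toNat + 1, fun n hn => ?_⟩
    have hn : |c i| + |∑ j, A i j * c j| < n := by
      have := Int.self_le_toNat (|c i| + |∑ j, A i j * c j|)
      omega
    by_contra hW
    have h1 := Pre.nonneg_or_nonpos_of_W_ne_bot hW
    have h2 := Pre.nonneg_or_nonpos_of_W_ne_bot (G.W_reflect hA i hW)
    have h3 : ∑ j, A i j * (c + Pi.single i (n : ℤ) : I → ℤ) j = (∑ j, A i j * c j) + 2 * n := by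
      simp [mul_add, Finset.sum_add_distrib, Pi.single_apply, hA.1]
    rw [h3] at h2
    have := abs_le.1 (le_refl |c i|)
    have := abs_le.1 (le_refl |∑ j, A i j * c j|)
    rcases h1 with h1 | h1 <;> rcases h2 with h2 | h2
    · have h4 := h2 i; simp at h4; omega
    · have h4 := h1 t; have h5 := h2 t; simp [hti] at h4 h5; omega
    · have h4 := h1 i; simp at h4; omega
    · have h4 := h1 i; simp at h4; omega
  · push Not at h0
    refine ⟨(|c i|).toNat + 2, fun n hn => ?_⟩
    have hc : c + Pi.single i (n : ℤ) = Pi.single i (c i + n) := by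
      ext t
      by_cases ht : t = i
      · subst ht; simp
      · simp [ht, h0 t ht]
    rw [hc]
    refine Pre.W_single_eq_bot ?_
    have := abs_le.1 (le_refl |c i|)
    have := Int.self_le_toNat (|c i|)
    omega

/-- A set of vertices supporting only finitely many roots is of finite type. -/
theorem isFiniteType_of_finite (G : KacMoodyAlgebra A g) (hA : IsGCM A) (T : Set I)
    (hfin : {c : I → ℤ | (∀ j ∉ T, c j = 0) ∧ G.toPre.W c ≠ ⊥}.Finite) :
    IsFiniteType (restrictM A T) := by
  classical
  let Φ : Finset (I → ℤ) := hfin.toFinset.filter fun c => 0 ≤ c ∧ c ≠ 0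
  have hΦ : ∀ c, c ∈ Φ ↔ ((∀ j ∉ T, c j = 0) ∧ G.toPre.W c ≠ ⊥) ∧ 0 ≤ c ∧ c ≠ 0 := fun c => by
    simp [Φ]
  let u : I → ℤ := ∑ c ∈ Φ, c
  have hδ : ∀ i ∈ T, (Pi.single i 1 : I → ℤ) ∈ Φ := fun i hi => by
    rw [hΦ]
    refine ⟨⟨fun j hj => Pi.single_eq_of_ne (ne_of_mem_of_not_mem hi hj).symm _, ?_⟩,
      Pi.single_nonneg.2 zero_le_one, by simp⟩
    exact (Submodule.ne_bot_iff _).2 ⟨_, by simpa [Pre.W] using G.toPre.e_mem_wtSpaceι i,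
      G.e_ne_zero i⟩
  have hu : ∀ i ∈ T, 0 < u i := fun i hi => by
    have : u i = ∑ c ∈ Φ, c i := Finset.sum_apply ..
    rw [this]
    exact Finset.sum_pos' (fun c hc => ((hΦ c).1 hc).2.1 i) ⟨_, hδ i hi, by simp⟩
  have hu0 : ∀ j ∉ T, u j = 0 := fun j hj => by
    have : u j = ∑ c ∈ Φ, c j := Finset.sum_apply ..
    rw [this]
    exact Finset.sum_eq_zero fun c hc => ((hΦ c).1 hc).1.1 j hj
  have hAu : ∀ i ∈ T, ∑ j, A i j * u j = 2 := fun i hi => by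
    have h1 : ∑ j, A i j * u j = ∑ c ∈ Φ, ∑ j, A i j * c j := by
      rw [Finset.sum_comm]
      refine Finset.sum_congr rfl fun j _ => ?_
      rw [← Finset.mul_sum]
      congr 1
      exact Finset.sum_apply ..
    have hsi : ∀ n : ℤ, ∑ j, A i j * (Pi.single i n : I → ℤ) j = 2 * n := fun n => by
      simp [Pi.single_apply, hA.1]
    have hr : ∀ c : I → ℤ, ∑ j, A i j * (c - Pi.single i (∑ j, A i j * c j) : I → ℤ) j =
        -∑ j, A i j * c j := fun c => by
      simp only [Pi.sub_apply, mul_sub, Finset.sum_sub_distrib, hsi]; ring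
    rw [h1, ← Finset.add_sum_erase _ _ (hδ i hi), hsi]
    rw [Finset.sum_involution (fun c _ => c - Pi.single i (∑ j, A i j * c j))]
    · rfl
    · intro c _
      rw [hr]; ring
    · intro c _ hc h
      have := congrFun h i
      simp at this
      exact hc this
    · intro c hc
      rw [Finset.mem_erase, hΦ] at hc
      obtain ⟨hci, ⟨hcT, hcW⟩, hc0, hcne⟩ := hc
      obtain ⟨t, hti, ht⟩ : ∃ t, t ≠ i ∧ c t ≠ 0 := by
        by_contra! h
        have hc' : c = Pi.single i (c i) := by
          ext t
          by_cases ht : t = i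
          · subst ht; simp
          · simp [ht, h t ht]
        have h0 := hc0 i
        simp at h0
        have h2 : ¬ 2 ≤ c i := fun h2 => hcW (by rw [hc']; exact Pre.W_single_eq_bot h2)
        have : c i ≠ 0 := fun h => hcne (by rw [hc', h]; simp)
        have : c i ≠ 1 := fun h => hci (by rw [hc', h])
        omega
      have hW := G.W_reflect hA i hcW
      have htt : (c - Pi.single i (∑ j, A i j * c j) : I → ℤ) t = c t := by simp [hti]
      rw [Finset.mem_erase, hΦ]
      refine ⟨fun h => ?_, ⟨fun j hj => ?_, hW⟩, ?_, fun h => ?_⟩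
      · rw [h, Pi.single_eq_of_ne hti] at htt; exact ht htt.symm
      · simp [hcT j hj, (ne_of_mem_of_not_mem hi hj).symm]
      · rcases Pre.nonneg_or_nonpos_of_W_ne_bot hW with h | h
        · exact h
        · have h3 := h t
          have h4 := hc0 t
          rw [htt] at h3
          simp at h3 h4
          omega
      · rw [h] at htt; exact ht htt.symm
    · intro c _
      have h := congrArg (fun n : ℤ => (Pi.single i n : I → ℤ)) (hr c)
      have h' : ∀ s : ℤ, c - Pi.single i s - Pi.single i (-s) = c := fun s => by
        rw [Pi.single_neg, sub_neg_eq_add, sub_add_cancel]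
      exact (congrArg _ h).trans (h' _)
  refine ⟨fun i => u i.1, fun i => Int.cast_pos.2 (hu i.1 i.2), fun i => ?_⟩
  have h1 : ∑ᶠ j : T, (restrictM A T i j : ℚ) * ((u j.1 : ℤ) : ℚ) =
      ∑ j, (A i.1 j : ℚ) * (u j : ℚ) := by
    rw [← finsum_eq_sum_of_fintype]
    rw [show (∑ᶠ j : T, (restrictM A T i j : ℚ) * ((u j.1 : ℤ) : ℚ)) = _ from
      finsum_set_coe_eq_finsum_mem (f := fun j => (A i.1 j : ℚ) * (u j : ℚ)) T, finsum_mem_def]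
    congr 1
    ext j
    by_cases hj : j ∈ T
    · simp [hj]
    · simp [hj, hu0 j hj]
  rw [h1]
  have := hAu i.1 i.2
  rw [show ∑ j, (A i.1 j : ℚ) * (u j : ℚ) = ((∑ j, A i.1 j * u j : ℤ) : ℚ) by push_cast; rfl, this]
  norm_num

end KacMoodyAlgebra

theorem isUnit_det_of_isFiniteType {I : Type*} [Fintype I] [DecidableEq I] {A : Matrix I I ℤ} (hA : IsGCM A) (hfin : IsFiniteType A) :
    (A.map ((↑) : ℤ → ℂ)).det ≠ 0 := by
  obtain ⟨u, hu, hAu⟩ := hfin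
  have h1 : (A.map ((↑) : ℤ → ℂ) * Matrix.diagonal fun i => ((u i : ℚ) : ℂ)).det ≠ 0 := by
    refine det_ne_zero_of_sum_row_lt_diag fun k => ?_
    have h2 := hAu k
    rw [finsum_eq_sum_of_fintype, ← Finset.add_sum_erase _ _ (Finset.mem_univ k), hA.1] at h2
    have h3 : ∀ j ∈ Finset.univ.erase k, ‖(A.map ((↑) : ℤ → ℂ) *
        Matrix.diagonal fun i => ((u i : ℚ) : ℂ)) k j‖ = ((-(A k j * u j : ℚ) : ℚ) : ℝ) := by
      intro j hj
      rw [Matrix.mul_diagonal, Matrix.map_apply, norm_mul, Complex.norm_intCast,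
        Complex.norm_ratCast, abs_of_pos (a := ((u j : ℚ) : ℝ)) (by exact_mod_cast hu j),
        abs_of_nonpos (a := ((A k j : ℤ) : ℝ)) (by exact_mod_cast hA.2.1 k j (Finset.ne_of_mem_erase hj).symm)]
      push_cast; ring
    rw [Finset.sum_congr rfl h3, Matrix.mul_diagonal, Matrix.map_apply, norm_mul, hA.1,
      Complex.norm_ratCast, abs_of_pos (a := ((u k : ℚ) : ℝ)) (by exact_mod_cast hu k),
      ← Rat.cast_sum, Finset.sum_neg_distrib]
    have h4 : (-∑ j ∈ Finset.univ.erase k, (A k j * u j : ℚ)) < 2 * u k := by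
      push_cast at h2; linarith
    calc _ < ((2 * u k : ℚ) : ℝ) := by exact_mod_cast h4
      _ = _ := by push_cast; simp
  rw [Matrix.det_mul] at h1
  exact left_ne_zero_of_mul h1

end KacMoody

/-! ### Connected components -/

section Component

variable {I : Type*} {A : Matrix I I ℤ} {T T' : Set I} {i j k : I}

theorem self_mem_cmpnt (hk : k ∈ T) : k ∈ cmpnt A T k := ⟨hk, .refl⟩

theorem cmpnt_subset : cmpnt A T k ⊆ T := fun _ h => h.1

theorem cmpnt_mono (h : T ⊆ T') : cmpnt A T k ⊆ cmpnt A T' k := fun _ hi =>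
  ⟨h hi.1, Relation.ReflTransGen.mono (fun _ _ hxy => ⟨h hxy.1, h hxy.2.1, hxy.2.2⟩) _ _ hi.2⟩

theorem mem_cmpnt_trans (h1 : j ∈ cmpnt A T k) (h2 : i ∈ cmpnt A T j) : i ∈ cmpnt A T k :=
  ⟨h2.1, h1.2.trans h2.2⟩

theorem mem_cmpnt_of_ne_zero (h : i ∈ cmpnt A T k) (hj : j ∈ T) (hij : A i j ≠ 0) :
    j ∈ cmpnt A T k := ⟨hj, h.2.tail ⟨h.1, hj, hij⟩⟩

theorem IsGCM.ne_zero_symm (hA : IsGCM A) (h : A i j ≠ 0) : A j i ≠ 0 := fun h' => h (hA.2.2 _ _ h')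

theorem mem_cmpnt_symm (hA : IsGCM A) (hk : k ∈ T) (h : i ∈ cmpnt A T k) : k ∈ cmpnt A T i :=
  ⟨hk, by
    have : Std.Symm (fun x y => x ∈ T ∧ y ∈ T ∧ A x y ≠ 0) :=
      ⟨fun _ _ h => ⟨h.2.1, h.1, hA.ne_zero_symm h.2.2⟩⟩
    exact Std.Symm.symm _ _ h.2⟩

theorem Pre.Word.connected [DecidableEq I] {g : Type*} [LieRing g] [LieAlgebra ℂ g] {P : Pre I g}
    (hA : IsGCM A) (hcomm : ∀ i j, A i j = 0 → ⁅P.e i, P.e j⁆ = 0) {c : I → ℤ} {x : g}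
    (h : P.Word T c x) (hx : x ≠ 0) (hk : c k ≠ 0) (hi : c i ≠ 0) :
    i ∈ cmpnt A {j | c j ≠ 0} k := by
  induction h generalizing i k with
  | base l hl =>
    obtain rfl : k = l := by by_contra h; exact hk (Pi.single_eq_of_ne h _)
    obtain rfl : i = k := by by_contra h; exact hi (Pi.single_eq_of_ne h _)
    exact self_mem_cmpnt hi
  | step l c x hl h ih =>
    have hx0 : x ≠ 0 := by rintro rfl; simp at hx
    obtain ⟨j, hj, hlj⟩ : ∃ j, c j ≠ 0 ∧ A l j ≠ 0 := by
      by_contra! h0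
      refine hx ((h.of_support (T' := {j | c j ≠ 0}) fun _ h => h).lie_eq_zero fun j hj =>
        hcomm _ _ (h0 j hj))
    have hsub : ∀ t, c t ≠ 0 → (c + Pi.single l 1 : I → ℤ) t ≠ 0 := fun t ht => by
      have h0 := h.nonneg t
      by_cases htl : t = l
      · subst htl; simp at h0 ⊢; omega
      · simpa [htl] using ht
    have hmono := cmpnt_mono (A := A) (k := j) (T := {t | c t ≠ 0})
      (T' := {t | (c + Pi.single l 1 : I → ℤ) t ≠ 0}) hsub
    have hall : ∀ t, (c + Pi.single l 1 : I → ℤ) t ≠ 0 →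
        t ∈ cmpnt A {t | (c + Pi.single l 1 : I → ℤ) t ≠ 0} j := fun t ht => by
      by_cases htl : t = l
      · subst htl
        exact mem_cmpnt_of_ne_zero (self_mem_cmpnt (hsub j hj)) ht (hA.ne_zero_symm hlj)
      · exact hmono (ih hx0 hj (by simpa [htl] using ht))
    exact mem_cmpnt_trans (mem_cmpnt_symm hA (hsub j hj) (hall k hk)) (hall i hi)

end Component

/-! ### The subalgebras `g(S)` -/

section SubDiagram

variable {g : Type*} [LieRing g] [LieAlgebra ℂ g] {I : Type*} [Fintype I] [DecidableEq I]
  {A : Matrix I I ℤ} {T T' : Set I}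

namespace KacMoodyAlgebra

theorem lie_e_e_eq_zero (G : KacMoodyAlgebra A g) (hA : IsGCM A) (i j : I) (h : A i j = 0) :
    ⁅G.e i, G.e j⁆ = 0 := by
  have hij : i ≠ j := by rintro rfl; rw [hA.1] at h; norm_num at h
  simpa [h] using G.serre_e i j hij

theorem e_mem_gS (G : KacMoodyAlgebra A g) {i : I} (hi : i ∈ T) : G.e i ∈ gS G T :=
  LieSubalgebra.subset_lieSpan (.inl ⟨i, hi, rfl⟩)

theorem gS_mono (G : KacMoodyAlgebra A g) (h : T ⊆ T') : gS G T ≤ gS G T' :=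
  LieSubalgebra.lieSpan_mono (Set.union_subset_union (fun _ ⟨i, hi, hx⟩ => ⟨i, h hi, hx⟩)
    fun _ ⟨i, hi, hx⟩ => ⟨i, h hi, hx⟩)

theorem gS_le (G : KacMoodyAlgebra A g) {K : LieSubalgebra ℂ g} (he : ∀ i ∈ T, G.e i ∈ K)
    (hf : ∀ i ∈ T, G.f i ∈ K) : gS G T ≤ K := by
  rw [gS, LieSubalgebra.lieSpan_le]
  rintro x (⟨i, hi, rfl⟩ | ⟨i, hi, rfl⟩)
  exacts [he i hi, hf i hi]

theorem word_mem_gS (G : KacMoodyAlgebra A g) {c : I → ℤ} {x : g} (h : G.toPre.Word T c x) :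
    x ∈ gS G T := h.mem_of_mem fun _ hi => G.e_mem_gS hi

theorem lie_eq_zero_of_mem_gS (G : KacMoodyAlgebra A g) (hA : IsGCM A)
    (h : ∀ i ∈ T, ∀ j ∈ T', A i j = 0) {x y : g} (hx : x ∈ gS G T) (hy : y ∈ gS G T') :
    ⁅x, y⁆ = 0 := by
  have hne : ∀ i ∈ T, ∀ j ∈ T', i ≠ j := fun i hi j hj hij => by
    have := h i hi j hj
    rw [hij, hA.1] at this
    norm_num at this
  have hcent : ∀ x : g, ⁅x, x⁆ = 0 := lie_self
  have key : ∀ (s : Set g) (x : g), (∀ z ∈ s, ⁅x, z⁆ = 0) → ∀ y ∈ LieSubalgebra.lieSpan ℂ g s,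
      ⁅x, y⁆ = 0 := fun s x hs y hy => by
    induction hy using LieSubalgebra.lieSpan_induction with
    | mem y hy => exact hs y hy
    | zero => exact lie_zero _
    | smul a y _ hy => rw [lie_smul, hy, smul_zero]
    | add y z _ _ hy hz => rw [lie_add, hy, hz, add_zero]
    | lie y z _ _ hy hz => rw [leibniz_lie, hy, hz, zero_lie, lie_zero, add_zero]
  refine key _ x (fun z hz => ?_) y hy
  rw [← lie_skew, neg_eq_zero]
  refine key _ z (fun w hw => ?_) x hx
  rw [← lie_skew, neg_eq_zero]
  rcases hw with ⟨i, hi, rfl⟩ | ⟨i, hi, rfl⟩ <;> rcases hz with ⟨j, hj, rfl⟩ | ⟨j, hj, rfl⟩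
  · exact G.lie_e_e_eq_zero hA _ _ (h i hi j hj)
  · rw [G.e_f, if_neg (hne i hi j hj).symm]
  · rw [← lie_skew, G.e_f, if_neg (hne i hi j hj), neg_zero]
  · exact G.flip.lie_e_e_eq_zero hA _ _ (h i hi j hj)

theorem lie_H_eq_zero (G : KacMoodyAlgebra A g) {h : G.H} (hh : ∀ i ∈ T, G.root i h = 0) {x : g}
    (hx : x ∈ gS G T) : ⁅(h : g), x⁆ = 0 := by
  induction hx using LieSubalgebra.lieSpan_induction with
  | mem y hy =>
    rcases hy with ⟨i, hi, rfl⟩ | ⟨i, hi, rfl⟩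
    · rw [G.lie_e, hh i hi, zero_smul]
    · rw [G.lie_f, hh i hi, neg_zero, zero_smul]
  | zero => exact lie_zero _
  | smul a y _ hy => rw [lie_smul, hy, smul_zero]
  | add y z _ _ hy hz => rw [lie_add, hy, hz, add_zero]
  | lie y z _ _ hy hz => rw [leibniz_lie, hy, hz, zero_lie, lie_zero, add_zero]

theorem lie_H_congr (G : KacMoodyAlgebra A g) {h h' : G.H}
    (hh : ∀ i ∈ T, G.root i h = G.root i h') {x : g} (hx : x ∈ gS G T) :
    ⁅(h : g), x⁆ = ⁅(h' : g), x⁆ := by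
  have := G.lie_H_eq_zero (h := h - h') (fun i hi => by rw [map_sub, hh i hi, sub_self]) hx
  rwa [Submodule.coe_sub, sub_lie, sub_eq_zero] at this

/-- The span of the coroots from `T`, as a subspace of `g`. -/
def corootSpan (G : KacMoodyAlgebra A g) (T : Set I) : Submodule ℂ g :=
  (Submodule.span ℂ (G.coroot '' T)).map G.H.subtype

theorem corootSpan_le (G : KacMoodyAlgebra A g) : G.corootSpan T ≤ G.H :=
  Submodule.map_subtype_le _ _

theorem coroot_mem_corootSpan (G : KacMoodyAlgebra A g) {i : I} (hi : i ∈ T) :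
    (G.coroot i : g) ∈ G.corootSpan T :=
  Submodule.mem_map_of_mem (f := G.H.subtype) (Submodule.subset_span ⟨i, hi, rfl⟩)

theorem gS_le_span_gens (G : KacMoodyAlgebra A g) :
    (gS G T).toSubmodule ≤ Submodule.span ℂ (G.toPre.gens T (G.corootSpan T)) := by
  refine le_trans ?_ (Pre.lieSpan_le_span_gens (P := G.toPre) G.corootSpan_le
    fun i hi => G.coroot_mem_corootSpan hi)
  exact LieSubalgebra.lieSpan_mono (Set.union_subset_union_left _ Set.subset_union_right)

theorem mem_span_coroot_of_mem_gS (G : KacMoodyAlgebra A g) {h : G.H} (hh : (h : g) ∈ gS G T) :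
    h ∈ Submodule.span ℂ (G.coroot '' T) := by
  have h1 := Pre.mem_of_mem_span_gens (P := G.toPre) G.corootSpan_le (G.gS_le_span_gens hh)
    (by rw [Pre.wtSpaceι_zero]; exact h.2)
  obtain ⟨y, hy, hyh⟩ := h1
  rwa [← Subtype.ext hyh]

end KacMoodyAlgebra
end SubDiagram

/-! ### The corank -/

section Corank

theorem rank_map_complex {K : Type*} [Fintype K] [DecidableEq K] (M : Matrix K K ℚ) :
    (M.map ((↑) : ℚ → ℂ)).rank = M.rank := by
  obtain ⟨L, L', D, h⟩ := Matrix.Pivot.exists_list_transvec_mul_mul_list_transvec_eq_diagonal M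
  set P := (L.map Matrix.TransvectionStruct.toMatrix).prod
  set Q := (L'.map Matrix.TransvectionStruct.toMatrix).prod
  have hP : P.det = 1 := Matrix.TransvectionStruct.det_toMatrix_prod L
  have hQ : Q.det = 1 := Matrix.TransvectionStruct.det_toMatrix_prod L'
  let φ : ℚ →+* ℂ := Rat.castHom ℂ
  have hdet : ∀ N : Matrix K K ℚ, N.det = 1 → IsUnit (N.map φ).det := fun N hN => by
    have := φ.map_det N
    rw [hN, map_one] at this
    rw [show N.map φ = φ.mapMatrix N from rfl, ← this]
    exact isUnit_one
  have h1 : P.map φ * M.map φ * Q.map φ = Matrix.diagonal fun i => φ (D i) := by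
    rw [← Matrix.map_mul, ← Matrix.map_mul, h, Matrix.diagonal_map (map_zero φ)]
  have h2 : (M.map φ).rank = (Matrix.diagonal fun i => φ (D i)).rank := by
    rw [← h1, Matrix.rank_mul_eq_left_of_isUnit_det _ _ (hdet Q hQ),
      Matrix.rank_mul_eq_right_of_isUnit_det _ _ (hdet P hP)]
  have h3 : M.rank = (Matrix.diagonal D).rank := by
    rw [← h, Matrix.rank_mul_eq_left_of_isUnit_det _ _ (hQ ▸ isUnit_one),
      Matrix.rank_mul_eq_right_of_isUnit_det _ _ (hP ▸ isUnit_one)]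
  rw [show (M.map ((↑) : ℚ → ℂ)) = M.map φ from rfl, h2, h3, Matrix.rank_diagonal,
    Matrix.rank_diagonal]
  exact Fintype.card_congr (Equiv.subtypeEquivRight fun i => by simp)

theorem finrank_center_eq_gcmCorank {K V : Type*} [Fintype K] [DecidableEq K] [AddCommGroup V]
    [Module ℂ V] (A : Matrix K K ℤ) (co : K → V) (rt : K → Module.Dual ℂ V)
    (hco : LinearIndependent ℂ co) (h : ∀ i j, rt j (co i) = (A i j : ℂ)) :
    Module.finrank ℂ (Submodule.span ℂ (Set.range co) ⊓ ⨅ j, LinearMap.ker (rt j) : Submodule ℂ V) =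
      gcmCorank A := by
  let ψ : (K → ℂ) →ₗ[ℂ] V := Fintype.linearCombination ℂ co
  have hψ : Function.Injective ψ := hco.fintypeLinearCombination_injective
  let B : Matrix K K ℂ := A.map ((↑) : ℤ → ℂ)
  have hmem : ∀ p : K → ℂ, p ∈ LinearMap.ker B.transpose.mulVecLin ↔ ∀ j, rt j (ψ p) = 0 := by
    intro p
    rw [LinearMap.mem_ker, funext_iff]
    refine forall_congr' fun j => ?_
    simp [ψ, Fintype.linearCombination_apply, Matrix.vecMul, dotProduct, B, h]
  have hmap : (LinearMap.ker B.transpose.mulVecLin).map ψ =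
      (Submodule.span ℂ (Set.range co) ⊓ ⨅ j, LinearMap.ker (rt j) : Submodule ℂ V) := by
    rw [← Fintype.range_linearCombination ℂ co]
    ext v
    simp only [Submodule.mem_map, Submodule.mem_inf, LinearMap.mem_range, Submodule.mem_iInf,
      LinearMap.mem_ker (f := rt _)]
    constructor
    · rintro ⟨p, hp, rfl⟩; exact ⟨⟨p, rfl⟩, (hmem p).1 hp⟩
    · rintro ⟨⟨p, rfl⟩, hp⟩; exact ⟨p, (hmem p).2 hp, rfl⟩
  rw [← hmap, ← (Submodule.equivMapOfInjective ψ hψ _).finrank_eq]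
  have h1 := B.transpose.mulVecLin.finrank_range_add_finrank_ker
  rw [show Module.finrank ℂ (LinearMap.range B.transpose.mulVecLin) = B.transpose.rank from rfl,
    Matrix.rank_transpose, Module.finrank_fintype_fun_eq_card] at h1
  have h2 : B.rank = (A.map ((↑) : ℤ → ℚ)).rank := by
    rw [← rank_map_complex]
    congr 1
  rw [gcmCorank, ← h2]
  omega

end Corank

/-! ### Gradations: restricted degrees -/

section Graded

variable {g : Type*} [LieRing g] [LieAlgebra ℂ g] {I : Type*} [Fintype I] [DecidableEq I]
  {A : Matrix I I ℤ} {S : Type*} [Fintype S] [DecidableEq S] {B : Matrix S S ℤ}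
  {m : Type*} [LieRing m] [LieAlgebra ℂ m]

theorem KacMoodyAlgebra.exists_root_eq (G : KacMoodyAlgebra A g) (v : I → ℂ) :
    ∃ x : G.H, ∀ i, G.root i x = v i := by
  have := G.findimH
  obtain ⟨q, hq⟩ := LinearMap.exists_leftInverse_of_injective (Finsupp.linearCombination ℂ G.root)
    (LinearMap.ker_eq_bot.2 G.indepRoot)
  refine ⟨(Module.evalEquiv ℂ G.H).symm (Finsupp.linearCombination ℂ v ∘ₗ q), fun i => ?_⟩
  rw [Module.apply_evalEquiv_symm_apply]
  have := LinearMap.congr_fun hq (Finsupp.single i 1)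
  simp only [LinearMap.comp_apply, Finsupp.linearCombination_single, one_smul,
    LinearMap.id_apply] at this
  simp [this]

/-- A finite gradation such that the restrictions of the simple roots are nonnegative combinations
of the simple roots of the grading subalgebra. -/
structure IsGraded (G : KacMoodyAlgebra A g) (M : KacMoodyAlgebra B m) (φ : m →ₗ⁅ℂ⁆ g)
    (hle : M.H.map φ.toLinearMap ≤ G.H) : Prop where
  gcm : IsGCM A
  gcm' : IsGCM B
  grading : IsFinGrading M φ
  nonneg : ∀ i, ∃ n : S → ℕ, resRoot G M φ hle i = ∑ s, (n s : ℂ) • M.root s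

theorem Jof_flip (G : KacMoodyAlgebra A g) (M : KacMoodyAlgebra B m) (φ : m →ₗ⁅ℂ⁆ g)
    (hle : M.H.map φ.toLinearMap ≤ G.H) : Jof G.flip M.flip φ hle = Jof G M φ hle :=
  Set.ext fun i => neg_eq_zero (a := resRoot G M φ hle i)

theorem GammaOf_flip (G : KacMoodyAlgebra A g) (M : KacMoodyAlgebra B m) (φ : m →ₗ⁅ℂ⁆ g)
    (hle : M.H.map φ.toLinearMap ≤ G.H) (s : S) :
    GammaOf G.flip M.flip φ hle s = GammaOf G M φ hle s :=
  Set.ext fun i => neg_inj (a := resRoot G M φ hle i) (b := M.root s)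

namespace IsGraded

variable {G : KacMoodyAlgebra A g} {M : KacMoodyAlgebra B m} {φ : m →ₗ⁅ℂ⁆ g}
  {hle : M.H.map φ.toLinearMap ≤ G.H} (Γ : IsGraded G M φ hle)

include Γ

theorem flip : IsGraded G.flip M.flip φ hle where
  gcm := Γ.gcm
  gcm' := Γ.gcm'
  grading := Γ.grading
  nonneg i := by
    obtain ⟨n, hn⟩ := Γ.nonneg i
    refine ⟨n, ?_⟩
    change -resRoot G M φ hle i = _
    simp [hn]

/-- The coordinates of the restriction of `α_i`. -/
def n (i : I) : S → ℤ := fun s => ((Γ.nonneg i).choose s : ℤ)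

theorem n_nonneg (i : I) (s : S) : 0 ≤ Γ.n i s := Int.natCast_nonneg _

theorem resRoot_eq (i : I) : resRoot G M φ hle i = M.toPre.wt (Γ.n i) := by
  rw [(Γ.nonneg i).choose_spec]
  simp [Pre.wt, n]

theorem mem_Jof {i : I} : i ∈ Jof G M φ hle ↔ Γ.n i = 0 := by
  rw [Jof, Set.mem_ofPred_eq, Γ.resRoot_eq, ← (Pre.wt_injective M.toPre).eq_iff, Pre.wt_zero]

theorem mem_GammaOf {i : I} {s : S} : i ∈ GammaOf G M φ hle s ↔ Γ.n i = Pi.single s 1 := by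
  rw [GammaOf, Set.mem_ofPred_eq, Γ.resRoot_eq, ← (Pre.wt_injective M.toPre).eq_iff, Pre.wt_single,
    Int.cast_one, one_smul]

/-- The restricted degree. -/
def deg (c : I → ℤ) : S → ℤ := ∑ i, c i • Γ.n i

theorem deg_apply (c : I → ℤ) (s : S) : Γ.deg c s = ∑ i, c i * Γ.n i s := by
  simp [deg, Finset.sum_apply]

theorem deg_nonneg {c : I → ℤ} (hc : 0 ≤ c) : 0 ≤ Γ.deg c := fun s => by
  rw [deg_apply]
  exact Finset.sum_nonneg fun i _ => mul_nonneg (hc i) (Γ.n_nonneg i s)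

@[simp] theorem deg_zero : Γ.deg 0 = 0 := by simp [deg]

theorem deg_neg (c : I → ℤ) : Γ.deg (-c) = -Γ.deg c := by simp [deg]

theorem wt_comp (c : I → ℤ) :
    (G.toPre.wt c).comp (cartanIncl G M φ hle) = M.toPre.wt (Γ.deg c) := by
  have h : ∀ i, (G.root i).comp (cartanIncl G M φ hle) = M.toPre.wt (Γ.n i) := Γ.resRoot_eq
  ext x
  rw [LinearMap.comp_apply, Pre.wt_apply, Pre.wt_apply]
  simp only [deg_apply, Int.cast_sum, Int.cast_mul, Finset.sum_mul]
  rw [Finset.sum_comm]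
  refine Finset.sum_congr rfl fun i _ => ?_
  have := LinearMap.congr_fun (h i) x
  rw [LinearMap.comp_apply, Pre.wt_apply] at this
  simp only [this, Finset.mul_sum, mul_assoc]

/-- The homogeneous components of the gradation. -/
def V (_ : IsGraded G M φ hle) (d : S → ℤ) : Submodule ℂ g :=
  wtSpaceι (φ.toLinearMap ∘ₗ M.H.subtype) (M.toPre.wt d)

theorem W_le_V (c : I → ℤ) : G.toPre.W c ≤ Γ.V (Γ.deg c) := fun x hx v => by
  rw [← Γ.wt_comp]
  exact hx (cartanIncl G M φ hle v)

theorem V_ne_bot {d : S → ℤ} (hd : Γ.V d ≠ ⊥) : d = 0 ∨ M.toPre.W d ≠ ⊥ := by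
  rcases mem_of_iSup_wtSpaceι_eq_top Γ.grading.2.1 hd with h | h
  · left
    rwa [← Pre.wt_zero M.toPre, (Pre.wt_injective _).eq_iff] at h
  · exact .inr h.2

theorem finiteDimensional_wtSpaceι (χ : Module.Dual ℂ M.H) :
    FiniteDimensional ℂ (wtSpaceι (φ.toLinearMap ∘ₗ M.H.subtype) χ) := by
  by_cases h : wtSpaceι (φ.toLinearMap ∘ₗ M.H.subtype) χ = ⊥
  · rw [h]; infer_instance
  · exact Γ.grading.2.2 _ (mem_of_iSup_wtSpaceι_eq_top Γ.grading.2.1 h)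

theorem iSup_V : ⨆ d, Γ.V d = ⊤ := by
  rw [eq_top_iff, ← Γ.grading.2.1]
  refine iSup₂_le fun χ _ => ?_
  by_cases h : wtSpaceι (φ.toLinearMap ∘ₗ M.H.subtype) χ = ⊥
  · rw [h]; exact bot_le
  · obtain ⟨c, hc, -⟩ := Pre.exists_word (P := G.toPre) (τ := cartanIncl G M φ hle) (χ := χ) h
    rw [hc, Γ.wt_comp]
    exact le_iSup Γ.V (Γ.deg c)

theorem mem_engel {s : S} {x : g} (hx : x ∈ Γ.V (Pi.single s 1)) (y : g) :
    y ∈ LieSubalgebra.engel ℂ x := by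
  have key : ∀ d, Γ.V d ≤ (LieSubalgebra.engel ℂ x).toSubmodule := fun d y hy => by
    obtain ⟨n₀, hn⟩ := M.exists_forall_W_add_eq_bot Γ.gcm' s d
    have hn0 := hn (n₀ + (|d s|).toNat + 1) (by omega)
    set N := n₀ + (|d s|).toNat + 1
    refine (LieSubalgebra.mem_engel_iff ℂ x y).2 ⟨N, ?_⟩
    have h1 : ((LieAlgebra.ad ℂ g x) ^ N) y ∈ Γ.V (d + Pi.single s (N : ℤ)) := by
      have := ad_pow_mem_wtSpaceι hx hy N
      rw [V, Pre.wt_add, Pre.wt_single]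
      simpa using this
    by_contra h2
    rcases Γ.V_ne_bot (fun h => h2 (by rwa [h] at h1)) with h3 | h3
    · have := congrFun h3 s
      have h4 := neg_abs_le (d s)
      have := Int.self_le_toNat (|d s|)
      simp at *
      omega
    · exact h3 hn0
  have : (⊤ : Submodule ℂ g) ≤ (LieSubalgebra.engel ℂ x).toSubmodule :=
    Γ.iSup_V ▸ iSup_le key
  exact this trivial

theorem apply_mem_V {d : S → ℤ} {x : m} (hx : x ∈ M.toPre.W d) : φ x ∈ Γ.V d := fun v => by
  have := congrArg φ (hx v)
  rwa [LieHom.map_lie, map_smul] at this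

/-- A set of vertices with finitely many restricted degrees is of finite type. -/
theorem isFiniteType {T : Set I} (D : Finset (S → ℤ))
    (h : ∀ c : I → ℤ, (∀ j ∉ T, c j = 0) → G.toPre.W c ≠ ⊥ → Γ.deg c ∈ D) :
    IsFiniteType (restrictM A T) := by
  refine G.isFiniteType_of_finite Γ.gcm T ?_
  have : ∀ d : D, FiniteDimensional ℂ (Γ.V d) := fun d => Γ.finiteDimensional_wtSpaceι _
  have h1 := finite_setOf_wtSpaceι_ne_bot (ι := G.H.subtype)
    (T := {c : I → ℤ // (∀ j ∉ T, c j = 0) ∧ G.toPre.W c ≠ ⊥}) (fun c => G.toPre.wt c.1)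
    (fun c d hcd => Subtype.ext (Pre.wt_injective _ hcd)) (⨆ d : D, Γ.V d)
    (fun c => (Γ.W_le_V c.1).trans
      (le_iSup (fun d : D => Γ.V d) ⟨_, h _ c.2.1 c.2.2⟩))
  rw [← Set.finite_coe_iff]
  refine Set.finite_univ_iff.1 (h1.subset fun c _ => c.2.2)

end IsGraded

end Graded

/-! ### Gradations: the `sl₂`-triples attached to the simple roots -/

section Triples

variable {g : Type*} [LieRing g] [LieAlgebra ℂ g] {I : Type*} [Fintype I] [DecidableEq I]
  {A : Matrix I I ℤ} {S : Type*} [Fintype S] [DecidableEq S] {B : Matrix S S ℤ}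
  {m : Type*} [LieRing m] [LieAlgebra ℂ m]

namespace KacMoodyAlgebra

/-- The span of the words on `T` containing the letter `k` exactly once. -/
def degOne (G : KacMoodyAlgebra A g) (T : Set I) (k : I) : Submodule ℂ g :=
  Submodule.span ℂ {x | ∃ c, G.toPre.Word T c x ∧ c k = 1}

theorem degOne_le_gS (G : KacMoodyAlgebra A g) (T : Set I) (k : I) :
    G.degOne T k ≤ (gS G T).toSubmodule :=
  Submodule.span_le.2 fun _ ⟨_, h, _⟩ => G.word_mem_gS h

theorem lie_degOne (G : KacMoodyAlgebra A g) {T : Set I} {k : I} {h : G.H}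
    (hh : ∀ j ∈ T, j ≠ k → G.root j h = 0) {x : g} (hx : x ∈ G.degOne T k) :
    ⁅(h : g), x⁆ = G.root k h • x := by
  induction hx using Submodule.span_induction with
  | mem x hx =>
    obtain ⟨c, hc, hk⟩ := hx
    have h1 := hc.mem_wtSpaceι h
    rw [Pre.wt_apply, Finset.sum_eq_single k, hk, Int.cast_one, one_mul] at h1
    · exact h1
    · intro j _ hjk
      by_cases hj : j ∈ T
      · exact mul_eq_zero_of_right _ (hh j hj hjk)
      · rw [hc.eq_zero_of_notMem hj, Int.cast_zero, zero_mul]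
    · exact fun h => absurd (Finset.mem_univ k) h
  | zero => rw [lie_zero, smul_zero]
  | add x y _ _ hx hy => rw [lie_add, hx, hy, smul_add]
  | smul a x _ hx => rw [lie_smul, hx, smul_comm]

theorem exists_W_of_mem_cmpnt (G : KacMoodyAlgebra A g) (hA : IsGCM A) {T : Set I} {k i : I}
    (hk : k ∈ T) (hi : i ∈ cmpnt A T k) :
    ∃ c : I → ℤ, 0 ≤ c ∧ (∀ j ∉ T, c j = 0) ∧ 0 < c k ∧ 0 < c i ∧ G.toPre.W c ≠ ⊥ := by
  obtain ⟨-, hi⟩ := hi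
  induction hi with
  | refl =>
    refine ⟨Pi.single k 1, Pi.single_nonneg.2 zero_le_one, fun j hj => Pi.single_eq_of_ne
      (fun h : j = k => hj (h.symm ▸ hk)) _, by simp, by simp, fun h => G.e_ne_zero k ?_⟩
    have := (Pre.Word.base (P := G.toPre) (T := T) k hk).mem_W
    rwa [h] at this
  | @tail i j _ hij ih =>
    obtain ⟨c, hc0, hcT, hck, hci, hW⟩ := ih
    by_cases hj : 0 < c j
    · exact ⟨c, hc0, hcT, hck, hj, hW⟩
    have hj : c j = 0 := le_antisymm (not_lt.1 hj) (hc0 j)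
    have hne : ∀ t, c t ≠ 0 → j ≠ t := by rintro t ht rfl; exact ht hj
    have hneg : ∑ t, A j t * c t < 0 := by
      refine Finset.sum_neg' (fun t _ => ?_) ⟨i, Finset.mem_univ i, ?_⟩
      · by_cases ht : c t = 0
        · rw [ht, mul_zero]
        · exact mul_nonpos_of_nonpos_of_nonneg (hA.2.1 _ _ (hne t ht)) (hc0 t)
      · exact mul_neg_of_neg_of_pos (lt_of_le_of_ne (hA.2.1 _ _ (hne i hci.ne'))
          (hA.ne_zero_symm hij.2.2)) hci
    refine ⟨_, fun t => ?_, fun t ht => ?_, ?_, ?_, G.W_reflect hA j hW⟩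
    · by_cases htj : t = j
      · subst htj; simp [hj]; exact hneg.le
      · simpa [htj] using hc0 t
    · have htj : t ≠ j := by rintro rfl; exact ht hij.2.1
      simp [htj, hcT t ht]
    · have htj : k ≠ j := (hne k hck.ne').symm
      simpa [htj]
    · simpa [hj]

end KacMoodyAlgebra

/-- The component `I_k`. -/
abbrev Ik (G : KacMoodyAlgebra A g) (M : KacMoodyAlgebra B m) (φ : m →ₗ⁅ℂ⁆ g)
    (hle : M.H.map φ.toLinearMap ≤ G.H) (k : I) : Set I := cmpnt A (Jof G M φ hle ∪ {k}) k

namespace IsGraded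

variable {G : KacMoodyAlgebra A g} {M : KacMoodyAlgebra B m} {φ : m →ₗ⁅ℂ⁆ g}
  {hle : M.H.map φ.toLinearMap ≤ G.H} (Γ : IsGraded G M φ hle)

include Γ

theorem deg_eq_single {c : I → ℤ} {s : S}
    (hc : ∀ j ∉ GammaOf G M φ hle s ∪ Jof G M φ hle, c j = 0) :
    Γ.deg c = Pi.single s (∑ i with i ∈ GammaOf G M φ hle s, c i) := by
  rw [deg, ← Finset.sum_filter_add_sum_filter_not _ (fun i => i ∈ GammaOf G M φ hle s),
    Finset.sum_eq_zero (s := Finset.filter (fun i => i ∉ GammaOf G M φ hle s) _), add_zero]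
  · have : ∀ i ∈ Finset.univ.filter (· ∈ GammaOf G M φ hle s), c i • Γ.n i = Pi.single s (c i) := by
      intro i hi
      rw [Γ.mem_GammaOf.1 (Finset.mem_filter.1 hi).2, ← Pi.single_smul, smul_eq_mul, mul_one]
    rw [Finset.sum_congr rfl this]
    exact (map_sum (AddMonoidHom.single (fun _ : S => ℤ) s) c _).symm
  · intro i hi
    by_cases hJ : i ∈ Jof G M φ hle
    · rw [Γ.mem_Jof.1 hJ, smul_zero]
    · rw [hc i, zero_smul]
      rintro (h | h)
      exacts [(Finset.mem_filter.1 hi).2 h, hJ h]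

theorem deg_le_one {c : I → ℤ} {s : S} {n : ℤ} (hW : G.toPre.W c ≠ ⊥)
    (hc : Γ.deg c = Pi.single s n) : n ≤ 1 := by
  by_contra! hn
  have h1 : Γ.V (Pi.single s n) ≠ ⊥ := fun h => hW (by
    rw [← hc] at h; exact le_bot_iff.1 (h ▸ Γ.W_le_V c))
  rcases Γ.V_ne_bot h1 with h | h
  · have := congrFun h s
    simp at this
    omega
  · exact h (Pre.W_single_eq_bot (by omega))

theorem notMem_Jof {k : I} {s : S} (hk : k ∈ GammaOf G M φ hle s) : k ∉ Jof G M φ hle := fun h => by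
  have := congrFun ((Γ.mem_GammaOf.1 hk).symm.trans (Γ.mem_Jof.1 h)) s
  simp at this

theorem GammaOf_unique {k : I} {s t : S} (hk : k ∈ GammaOf G M φ hle s)
    (hk' : k ∈ GammaOf G M φ hle t) : s = t := by
  have := congrFun ((Γ.mem_GammaOf.1 hk).symm.trans (Γ.mem_GammaOf.1 hk')) s
  by_contra h
  simp [h] at this

theorem notMem_cmpnt {k l : I} {s : S} (hk : k ∈ GammaOf G M φ hle s)
    (hl : l ∈ GammaOf G M φ hle s) (hkl : k ≠ l) :
    l ∉ cmpnt A (GammaOf G M φ hle s ∪ Jof G M φ hle) k := fun h => by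
  obtain ⟨c, hc0, hcT, hck, hcl, hW⟩ := G.exists_W_of_mem_cmpnt Γ.gcm (.inl hk) h
  have h1 := Γ.deg_le_one hW (Γ.deg_eq_single hcT)
  have h2 : ∑ i ∈ {k, l}, c i ≤ ∑ i with i ∈ GammaOf G M φ hle s, c i := by
    refine Finset.sum_le_sum_of_subset_of_nonneg ?_ fun i _ _ => hc0 i
    intro i hi
    rcases Finset.mem_insert.1 hi with rfl | hi
    · simpa using hk
    · rw [Finset.mem_singleton.1 hi]; simpa using hl
  rw [Finset.sum_pair hkl] at h2
  omega

end IsGraded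

end Triples

section Triples

variable {g : Type*} [LieRing g] [LieAlgebra ℂ g] {I : Type*} [Fintype I] [DecidableEq I]
  {A : Matrix I I ℤ} {S : Type*} [Fintype S] [DecidableEq S] {B : Matrix S S ℤ}
  {m : Type*} [LieRing m] [LieAlgebra ℂ m]

namespace IsGraded

variable {G : KacMoodyAlgebra A g} {M : KacMoodyAlgebra B m} {φ : m →ₗ⁅ℂ⁆ g}
  {hle : M.H.map φ.toLinearMap ≤ G.H} (Γ : IsGraded G M φ hle)

include Γ

theorem Ik_orthogonal {k l i j : I} {s : S} (hk : k ∈ GammaOf G M φ hle s)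
    (hl : l ∈ GammaOf G M φ hle s) (hkl : k ≠ l) (hi : i ∈ Ik G M φ hle k)
    (hj : j ∈ Ik G M φ hle l) : A i j = 0 := by
  have hsub : ∀ k ∈ GammaOf G M φ hle s,
      Jof G M φ hle ∪ {k} ⊆ GammaOf G M φ hle s ∪ Jof G M φ hle := fun k hk =>
    Set.union_subset Set.subset_union_right (Set.singleton_subset_iff.2 (.inl hk))
  by_contra h
  have hi' := cmpnt_mono (hsub k hk) hi
  have hj' := cmpnt_mono (hsub l hl) hj
  exact Γ.notMem_cmpnt hk hl hkl (mem_cmpnt_trans (mem_cmpnt_of_ne_zero hi' hj'.1 h)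
    (mem_cmpnt_symm Γ.gcm (.inl hl) hj'))

theorem V_single_le (s : S) : Γ.V (Pi.single s 1) ≤
    ⨆ k ∈ Finset.univ.filter (· ∈ GammaOf G M φ hle s), G.degOne (Ik G M φ hle k) k := by
  intro z hz
  have h1 := mem_span_inter_wtSpaceι (ι := φ.toLinearMap ∘ₗ M.H.subtype) (z := z)
    (s := G.toPre.gens Set.univ G.H) (fun x hx => by
      obtain ⟨c, hc⟩ := Pre.exists_mem_wtSpaceι_of_mem_gens le_rfl hx
      exact ⟨_, Γ.W_le_V c hc⟩) (by rw [G.toPre.span_gens_eq_top]; trivial) hz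
  refine Submodule.span_le.2 ?_ h1
  rintro x ⟨hx, hxV⟩
  by_cases hx0 : x = 0
  · rw [hx0]; exact zero_mem _
  have hdeg : ∀ c, x ∈ G.toPre.W c → Γ.deg c = Pi.single s 1 := fun c hc =>
    Pre.wt_injective M.toPre (eq_of_mem_wtSpaceι hx0 (Γ.W_le_V c hc) hxV)
  rcases hx with ⟨c, hc⟩ | hx | ⟨c, hc⟩
  · have hd := hdeg c hc.mem_W
    have hc0 := hc.nonneg
    have hn : ∀ i, c i ≠ 0 → ∀ t, Γ.n i t ≤ (Pi.single s 1 : S → ℤ) t := fun i hi t => by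
      have h2 : Γ.n i t ≤ c i * Γ.n i t :=
        le_mul_of_one_le_left (Γ.n_nonneg i t) (by have := hc0 i; simp at this; omega)
      refine h2.trans ?_
      rw [← hd, deg_apply]
      exact Finset.single_le_sum (f := fun i => c i * Γ.n i t)
        (fun i _ => mul_nonneg (hc0 i) (Γ.n_nonneg i t)) (Finset.mem_univ i)
    have hsupp : ∀ i ∉ GammaOf G M φ hle s ∪ Jof G M φ hle, c i = 0 := fun i hi => by
      by_contra hci
      have hoff : ∀ t, t ≠ s → Γ.n i t = 0 := fun t ht =>
        le_antisymm (by simpa [ht] using hn i hci t) (Γ.n_nonneg i t)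
      have hs := hn i hci s
      rw [Pi.single_eq_same] at hs
      have hs0 := Γ.n_nonneg i s
      obtain h0 | h1 : Γ.n i s = 0 ∨ Γ.n i s = 1 := by omega
      · refine hi (.inr (Γ.mem_Jof.2 (funext fun t => ?_)))
        by_cases ht : t = s
        · rw [ht, h0]; rfl
        · exact hoff t ht
      · refine hi (.inl (Γ.mem_GammaOf.2 (funext fun t => ?_)))
        by_cases ht : t = s
        · rw [ht, h1, Pi.single_eq_same]
        · rw [hoff t ht, Pi.single_eq_of_ne ht]
    rw [Γ.deg_eq_single hsupp] at hd
    have hsum := congrFun hd s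
    rw [Pi.single_eq_same, Pi.single_eq_same] at hsum
    obtain ⟨k, hk, hck⟩ : ∃ k ∈ GammaOf G M φ hle s, c k ≠ 0 := by
      by_contra! h
      rw [Finset.sum_eq_zero fun i hi => h i (Finset.mem_filter.1 hi).2] at hsum
      omega
    have hkf : k ∈ Finset.univ.filter (· ∈ GammaOf G M φ hle s) := by simpa using hk
    have hk1 : 1 ≤ c k := by have := hc0 k; simp at this; omega
    have hrest : ∑ i ∈ (Finset.univ.filter (· ∈ GammaOf G M φ hle s)).erase k, c i = 1 - c k := by
      rw [← hsum, ← Finset.add_sum_erase _ _ hkf]; ring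
    have hrest0 : 0 ≤ ∑ i ∈ (Finset.univ.filter (· ∈ GammaOf G M φ hle s)).erase k, c i :=
      Finset.sum_nonneg fun i _ => hc0 i
    have hck1 : c k = 1 := by omega
    rw [hck1, sub_self, Finset.sum_eq_zero_iff_of_nonneg fun i _ => hc0 i] at hrest
    have hsub : {j | c j ≠ 0} ⊆ Jof G M φ hle ∪ {k} := fun j hj => by
      by_cases hjk : j = k
      · exact .inr hjk
      · left
        by_contra hjJ
        have hjΓ : j ∈ GammaOf G M φ hle s := by
          by_contra hjΓ
          exact hj (hsupp j (by rintro (h | h); exacts [hjΓ h, hjJ h]))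
        exact hj (hrest j (Finset.mem_erase.2 ⟨hjk, by simpa using hjΓ⟩))
    refine Submodule.mem_iSup_of_mem k (Submodule.mem_iSup_of_mem hkf
      (Submodule.subset_span ⟨c, hc.of_support fun j hj => ?_, hck1⟩))
    exact cmpnt_mono hsub (hc.connected Γ.gcm (G.lie_e_e_eq_zero Γ.gcm) hx0 hck hj)
  · have := hdeg 0 (by rw [Pre.W, Pre.wt_zero, Pre.wtSpaceι_zero]; exact hx)
    rw [deg_zero] at this
    have := congrFun this s
    simp at this
  · have hd := hdeg _ hc.mem_wtSpaceι_flip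
    have h2 := Γ.deg_nonneg hc.nonneg s
    rw [← neg_neg (Γ.deg c), ← deg_neg, hd] at h2
    simp at h2

theorem exists_eq_sum {s : S} {x : g} (hx : x ∈ Γ.V (Pi.single s 1)) :
    ∃ E : I → g, (∀ k, E k ∈ G.degOne (Ik G M φ hle k) k) ∧
      x = ∑ k with k ∈ GammaOf G M φ hle s, E k := by
  obtain ⟨μ, hμ⟩ := (Submodule.mem_iSup_finset_iff_exists_sum _ _).1 (Γ.V_single_le s hx)
  exact ⟨fun k => μ k, fun k => (μ k).2, hμ.symm⟩

theorem degOne_le_V {k : I} {s : S} (hk : k ∈ GammaOf G M φ hle s) :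
    G.degOne (Ik G M φ hle k) k ≤ Γ.V (Pi.single s 1) := by
  rw [KacMoodyAlgebra.degOne, Submodule.span_le]
  rintro x ⟨c, hc, hck⟩
  have h1 := Γ.W_le_V c hc.mem_W
  have hJ : ∀ j, j ≠ k → c j ≠ 0 → Γ.n j = 0 := fun j hjk hj => by
    have hj' : j ∈ Ik G M φ hle k := by by_contra h; exact hj (hc.eq_zero_of_notMem h)
    rcases hj'.1 with h | h
    · exact Γ.mem_Jof.1 h
    · exact absurd h hjk
  have : Γ.deg c = Pi.single s 1 := by
    rw [deg, Finset.sum_eq_single k, hck, one_smul, Γ.mem_GammaOf.1 hk]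
    · intro j _ hjk
      by_cases hj : c j = 0
      · rw [hj, zero_smul]
      · rw [hJ j hjk hj, smul_zero]
    · exact fun h => absurd (Finset.mem_univ k) h
  rwa [this] at h1

theorem exists_triples (s : S) : ∃ (E F : I → g) (Hc : I → G.H),
    (∀ k ∈ GammaOf G M φ hle s, E k ∈ G.degOne (Ik G M φ hle k) k ∧
      F k ∈ G.flip.degOne (Ik G M φ hle k) k ∧ IsHGen G (Ik G M φ hle k) k (Hc k) ∧
      IsSl2Triple (Hc k : g) (E k) (F k)) ∧
    φ (M.e s) = ∑ k with k ∈ GammaOf G M φ hle s, E k ∧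
    φ (M.f s) = ∑ k with k ∈ GammaOf G M φ hle s, F k ∧
    φ (M.coroot s) = ∑ k with k ∈ GammaOf G M φ hle s, (Hc k : g) := by
  have hflip : GammaOf G.flip M.flip φ hle s = GammaOf G M φ hle s := GammaOf_flip G M φ hle s
  have hIk : ∀ k, Ik G.flip M.flip φ hle k = Ik G M φ hle k := fun k => by
    rw [Ik, Jof_flip]
  have heV : ∀ (M : KacMoodyAlgebra B m), M.e s ∈ M.toPre.W (Pi.single s 1) := fun M => by
    rw [Pre.W, Pre.wt_single, Int.cast_one, one_smul]
    exact Pre.e_mem_wtSpaceι M.toPre s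
  obtain ⟨E, hE, hsE⟩ := Γ.exists_eq_sum (Γ.apply_mem_V (heV M))
  obtain ⟨F, hF, hsF⟩ := Γ.flip.exists_eq_sum (Γ.flip.apply_mem_V (heV M.flip))
  simp only [hIk, hflip] at hF hsF
  have hEg : ∀ k, E k ∈ gS G (Ik G M φ hle k) := fun k => G.degOne_le_gS _ _ (hE k)
  have hFg : ∀ k, F k ∈ gS G (Ik G M φ hle k) := fun k => by
    rw [← gS_flip]; exact G.flip.degOne_le_gS _ _ (hF k)
  have hzg : ∀ k, ⁅E k, F k⁆ ∈ gS G (Ik G M φ hle k) := fun k => LieSubalgebra.lie_mem _ (hEg k) (hFg k)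
  have hcom : ∀ k ∈ GammaOf G M φ hle s, ∀ l ∈ GammaOf G M φ hle s, k ≠ l → ∀ x ∈ gS G (Ik G M φ hle k),
      ∀ y ∈ gS G (Ik G M φ hle l), ⁅x, y⁆ = 0 := fun k hk l hl hkl x hx y hy =>
    G.lie_eq_zero_of_mem_gS Γ.gcm (fun i hi j hj => Γ.Ik_orthogonal hk hl hkl hi hj) hx hy
  have hsum : φ (M.coroot s) = ∑ k with k ∈ GammaOf G M φ hle s, ⁅E k, F k⁆ := by
    have h1 : ⁅M.e s, M.f s⁆ = (M.coroot s : m) := by rw [M.e_f, if_pos rfl]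
    rw [← h1, LieHom.map_lie, hsE, show φ (M.f s) = _ from hsF, sum_lie]
    refine Finset.sum_congr rfl fun k hk => ?_
    rw [lie_sum, Finset.sum_eq_single_of_mem k hk]
    intro l hl hlk
    exact hcom k (Finset.mem_filter.1 hk).2 l (Finset.mem_filter.1 hl).2 hlk.symm _ (hEg k) _ (hFg l)
  have hzH : ∀ k ∈ GammaOf G M φ hle s, ⁅E k, F k⁆ ∈ G.H := fun k hk => by
    suffices ⁅E k, F k⁆ ∈ wtSpaceι G.H.subtype (0 : Module.Dual ℂ G.H) by rwa [G.zero_weight] at this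
    intro h
    obtain ⟨x, hx⟩ := G.exists_root_eq fun i => if i ∈ Ik G M φ hle k then G.root i h else 0
    have h1 : ⁅(x : g), φ (M.coroot s)⁆ = 0 :=
      G.abelian x ⟨φ (M.coroot s), hle (Submodule.mem_map_of_mem (M.coroot s).2)⟩
    rw [hsum, lie_sum, Finset.sum_eq_single_of_mem k (by simpa using hk)] at h1
    · rw [LinearMap.zero_apply, zero_smul, Submodule.subtype_apply, ← h1]
      exact G.lie_H_congr (fun i hi => by rw [hx, if_pos hi]) (hzg k)
    · intro l hl hlk
      refine G.lie_H_eq_zero (fun i hi => ?_) (hzg l)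
      rw [hx, if_neg]
      intro hik
      have := Γ.Ik_orthogonal hk (Finset.mem_filter.1 hl).2 hlk.symm hik hi
      rw [Γ.gcm.1] at this
      norm_num at this
  let Hc : I → G.H := fun k =>
    if hk : k ∈ GammaOf G M φ hle s then ⟨⁅E k, F k⁆, hzH k hk⟩ else 0
  have hHc : ∀ k ∈ GammaOf G M φ hle s, (Hc k : g) = ⁅E k, F k⁆ := fun k hk => by simp [Hc, hk]
  have hsumH : φ (M.coroot s) = ∑ k with k ∈ GammaOf G M φ hle s, (Hc k : g) :=
    hsum.trans (Finset.sum_congr rfl fun k hk => (hHc k (Finset.mem_filter.1 hk).2).symm)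
  have hgen : ∀ k ∈ GammaOf G M φ hle s, IsHGen G (Ik G M φ hle k) k (Hc k) := by
    have hspan : ∀ k ∈ GammaOf G M φ hle s,
        Hc k ∈ Submodule.span ℂ (G.coroot '' Ik G M φ hle k) := fun k hk =>
      G.mem_span_coroot_of_mem_gS (by rw [hHc k hk]; exact hzg k)
    refine fun k hk => ⟨hspan k hk, fun i hi => ?_⟩
    have h0 : ∀ l ∈ Finset.univ.filter (· ∈ GammaOf G M φ hle s), l ≠ k → G.root i (Hc l) = 0 := by
      intro l hl hlk
      have hl := (Finset.mem_filter.1 hl).2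
      have := hspan l hl
      generalize Hc l = y at this
      induction this using Submodule.span_induction with
      | mem x hx =>
        obtain ⟨j, hj, rfl⟩ := hx
        rw [G.pairing, Γ.Ik_orthogonal hl hk hlk hj hi, Int.cast_zero]
      | zero => exact map_zero _
      | add x y _ _ hx hy => rw [map_add, hx, hy, add_zero]
      | smul a x _ hx => rw [map_smul, hx, smul_zero]
    have h1 : cartanIncl G M φ hle (M.coroot s) = ∑ k with k ∈ GammaOf G M φ hle s, Hc k :=
      Subtype.ext (hsumH.trans (by simp))
    have h2 : G.root i (Hc k) = resRoot G M φ hle i (M.coroot s) := by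
      change _ = G.root i (cartanIncl G M φ hle (M.coroot s))
      rw [h1, map_sum, Finset.sum_eq_single_of_mem k (by simpa using hk) h0]
    rw [h2]
    rcases hi.1 with hJ | rfl
    · have hne : i ≠ k := by rintro rfl; exact Γ.notMem_Jof hk hJ
      rw [if_neg hne, show resRoot G M φ hle i = 0 from hJ, LinearMap.zero_apply]
    · rw [if_pos rfl, show resRoot G M φ hle i = M.root s from hk, M.pairing, Γ.gcm'.1]
      norm_num
  have hself : ∀ k, k ∈ Ik G M φ hle k := fun k => self_mem_cmpnt (.inr rfl)
  refine ⟨E, F, Hc, fun k hk => ⟨hE k, hF k, hgen k hk, ?_, (hHc k hk).symm, ?_, ?_⟩, hsE, hsF, hsumH⟩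
  · intro h
    have := (hgen k hk).2 k (hself k)
    rw [Subtype.ext (a2 := (0 : G.H)) h, map_zero, if_pos rfl] at this
    norm_num at this
  · rw [G.lie_degOne (fun j hj hjk => by rw [(hgen k hk).2 j hj, if_neg hjk]) (hE k),
      (hgen k hk).2 k (hself k), if_pos rfl, ofNat_smul_eq_nsmul]
  · rw [G.flip.lie_degOne (h := Hc k) (fun j hj hjk => by
      rw [LinearMap.neg_apply, (hgen k hk).2 j hj, if_neg hjk, neg_zero]) (hF k), LinearMap.neg_apply,
      (hgen k hk).2 k (hself k), if_pos rfl, neg_smul, ofNat_smul_eq_nsmul]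

end IsGraded

end Triples

section Triples

variable {g : Type*} [LieRing g] [LieAlgebra ℂ g] {I : Type*} [Fintype I] [DecidableEq I]
  {A : Matrix I I ℤ} {S : Type*} [Fintype S] [DecidableEq S] {B : Matrix S S ℤ}
  {m : Type*} [LieRing m] [LieAlgebra ℂ m]

namespace IsGraded

theorem Ik_subset {G : KacMoodyAlgebra A g} {M : KacMoodyAlgebra B m} {φ : m →ₗ⁅ℂ⁆ g}
    {hle : M.H.map φ.toLinearMap ≤ G.H} {k : I} {s : S} (hk : k ∈ GammaOf G M φ hle s) :
    Ik G M φ hle k ⊆ GammaOf G M φ hle s ∪ Jof G M φ hle := fun _ hi =>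
  hi.1.elim .inr fun h => .inl (h.symm ▸ hk)

variable {G : KacMoodyAlgebra A g} {M : KacMoodyAlgebra B m} {φ : m →ₗ⁅ℂ⁆ g}
  {hle : M.H.map φ.toLinearMap ≤ G.H} (Γ : IsGraded G M φ hle)

include Γ

theorem exists_sl2Triples : ∃ (E F : I → g) (Hc : I → G.H),
    (∀ s, ∀ k ∈ GammaOf G M φ hle s, E k ∈ G.degOne (Ik G M φ hle k) k ∧
      F k ∈ G.flip.degOne (Ik G M φ hle k) k ∧ IsHGen G (Ik G M φ hle k) k (Hc k) ∧
      IsSl2Triple (Hc k : g) (E k) (F k)) ∧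
    (∀ s, φ (M.e s) = ∑ k with k ∈ GammaOf G M φ hle s, E k) ∧
    (∀ s, φ (M.f s) = ∑ k with k ∈ GammaOf G M φ hle s, F k) ∧
    ∀ s, φ (M.coroot s) = ∑ k with k ∈ GammaOf G M φ hle s, (Hc k : g) := by
  choose E F Hc h hE hF hH using Γ.exists_triples
  have key : ∀ {X : Type _} [AddCommMonoid X] (x : S → I → X) (s : S) (k : I),
      k ∈ GammaOf G M φ hle s → ∑ t, (if k ∈ GammaOf G M φ hle t then x t k else 0) = x s k := by
    intro X _ x s k hk
    rw [Finset.sum_eq_single s, if_pos hk]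
    · exact fun t _ hts => if_neg fun hk' => hts (Γ.GammaOf_unique hk' hk)
    · exact fun h => absurd (Finset.mem_univ s) h
  refine ⟨fun k => ∑ t, if k ∈ GammaOf G M φ hle t then E t k else 0,
    fun k => ∑ t, if k ∈ GammaOf G M φ hle t then F t k else 0,
    fun k => ∑ t, if k ∈ GammaOf G M φ hle t then Hc t k else 0, fun s k hk => ?_, fun s => ?_,
    fun s => ?_, fun s => ?_⟩
  · dsimp only
    rw [key E s k hk, key F s k hk, key Hc s k hk]
    exact h s k hk
  · exact (hE s).trans (Finset.sum_congr rfl fun k hk => (key E s k (Finset.mem_filter.1 hk).2).symm)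
  · exact (hF s).trans (Finset.sum_congr rfl fun k hk => (key F s k (Finset.mem_filter.1 hk).2).symm)
  · exact (hH s).trans (Finset.sum_congr rfl fun k hk =>
      congrArg Subtype.val (key Hc s k (Finset.mem_filter.1 hk).2).symm)

theorem isFiniteType_Jof : IsFiniteType (restrictM A (Jof G M φ hle)) := by
  refine Γ.isFiniteType {0} fun c hc _ => ?_
  rw [Finset.mem_singleton, deg, Finset.sum_eq_zero]
  intro i _
  by_cases hi : i ∈ Jof G M φ hle
  · rw [Γ.mem_Jof.1 hi, smul_zero]
  · rw [hc i hi, zero_smul]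

theorem neg_one_le_deg {c : I → ℤ} {s : S} {n : ℤ} (hW : G.toPre.W c ≠ ⊥)
    (hc : Γ.deg c = Pi.single s n) : -1 ≤ n := by
  by_contra! hn
  have h1 : Γ.V (Pi.single s n) ≠ ⊥ := fun h => hW (by
    rw [← hc] at h; exact le_bot_iff.1 (h ▸ Γ.W_le_V c))
  rcases Γ.V_ne_bot h1 with h | h
  · have := congrFun h s
    simp at this
    omega
  · have h2 := Pre.W_single_eq_bot (P := M.toPre.flip) (i := s) (n := -n) (by omega)
    rw [Pre.W_flip, Pi.single_neg, neg_neg] at h2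
    exact h h2

theorem isFiniteType_of_subset {T : Set I} {s : S}
    (hT : T ⊆ GammaOf G M φ hle s ∪ Jof G M φ hle) : IsFiniteType (restrictM A T) := by
  refine Γ.isFiniteType {0, Pi.single s 1, Pi.single s (-1)} fun c hc hW => ?_
  have hc' : ∀ j ∉ GammaOf G M φ hle s ∪ Jof G M φ hle, c j = 0 := fun j hj =>
    hc j fun h => hj (hT h)
  have hd := Γ.deg_eq_single hc'
  set n := ∑ i with i ∈ GammaOf G M φ hle s, c i
  have h1 : n ≤ 1 := Γ.deg_le_one hW hd
  have h2 : -n ≤ 1 := by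
    have := Γ.neg_one_le_deg hW hd
    omega
  rw [hd]
  obtain h | h | h : n = 0 ∨ n = 1 ∨ n = -1 := by omega
  all_goals simp [h]

theorem a1GradedBy {k : I} {s : S} (hk : k ∈ GammaOf G M φ hle s) {Hk : G.H}
    (hH : IsHGen G (Ik G M φ hle k) k Hk) : A1GradedBy G (Ik G M φ hle k) (Hk : g) := by
  intro x hx
  have hx := G.gS_le_span_gens hx
  refine (Submodule.span_le (p := Module.End.eigenspace (LieAlgebra.ad ℂ g (Hk : g)) 0 ⊔
    Module.End.eigenspace (LieAlgebra.ad ℂ g (Hk : g)) 2 ⊔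
      Module.End.eigenspace (LieAlgebra.ad ℂ g (Hk : g)) (-2))).2 ?_ hx
  have key : ∀ c : I → ℤ, 0 ≤ c → (∀ j ∉ Ik G M φ hle k, c j = 0) → (∀ n, Γ.deg c = Pi.single s n → n ≤ 1) →
      G.toPre.wt c Hk = 0 ∨ G.toPre.wt c Hk = 2 := by
    intro c hc0 hc hle1
    have h1 : G.toPre.wt c Hk = c k * 2 := by
      rw [Pre.wt_apply, Finset.sum_eq_single k, hH.2 k (self_mem_cmpnt (.inr rfl)), if_pos rfl]
      · intro j _ hjk
        by_cases hj : j ∈ Ik G M φ hle k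
        · rw [hH.2 j hj, if_neg hjk, mul_zero]
        · rw [hc j hj, Int.cast_zero, zero_mul]
      · exact fun h => absurd (Finset.mem_univ k) h
    have hd := Γ.deg_eq_single (c := c) fun j hj => hc j fun h => hj (Ik_subset hk h)
    have h2 : ∑ i with i ∈ GammaOf G M φ hle s, c i = c k := by
      refine Finset.sum_eq_single_of_mem k (by simpa using hk) fun j hj hjk => hc j fun h => ?_
      rcases h.1 with h | h
      · exact Γ.notMem_Jof (Finset.mem_filter.1 hj).2 h
      · exact hjk h
    rw [h2] at hd
    have h3 := hle1 _ hd
    have h4 := hc0 k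
    simp only [Pi.zero_apply] at h4
    obtain h | h : c k = 0 ∨ c k = 1 := by omega
    all_goals simp [h1, h]
  rintro y (⟨c, hc⟩ | hy | ⟨c, hc⟩)
  · by_cases hy : y = 0
    · rw [hy]; exact zero_mem _
    have hW : G.toPre.W c ≠ ⊥ := fun h => hy (by simpa [h] using hc.mem_W)
    have h1 := hc.mem_wtSpaceι Hk
    rcases key c hc.nonneg (fun j hj => hc.eq_zero_of_notMem hj)
      (fun n hn => Γ.deg_le_one hW hn) with h | h <;> rw [h] at h1
    · exact Submodule.mem_sup_left (Submodule.mem_sup_left (Module.End.mem_eigenspace_iff.2 h1))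
    · exact Submodule.mem_sup_left (Submodule.mem_sup_right (Module.End.mem_eigenspace_iff.2 h1))
  · refine Submodule.mem_sup_left (Submodule.mem_sup_left (Module.End.mem_eigenspace_iff.2 ?_))
    rw [zero_smul]
    exact G.abelian Hk ⟨y, G.corootSpan_le hy⟩
  · by_cases hy : y = 0
    · rw [hy]; exact zero_mem _
    have h1 := hc.mem_wtSpaceι_flip Hk
    have hW : G.toPre.W (-c) ≠ ⊥ := fun h => hy (by
      have h2 : y ∈ G.toPre.W (-c) := hc.mem_wtSpaceι_flip
      simpa [h] using h2)
    rw [Pre.wt_neg, LinearMap.neg_apply] at h1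
    rcases key c hc.nonneg (fun j hj => hc.eq_zero_of_notMem hj)
      (fun n hn => by
        have := Γ.neg_one_le_deg (n := -n) hW (by rw [deg_neg, hn, Pi.single_neg])
        omega) with h | h <;> rw [h] at h1
    · rw [neg_zero] at h1
      exact Submodule.mem_sup_left (Submodule.mem_sup_left (Module.End.mem_eigenspace_iff.2 h1))
    · exact Submodule.mem_sup_right (Module.End.mem_eigenspace_iff.2 h1)

end IsGraded

end Triples

/-! ### The subspace generated by the grading Cartan subalgebra and the coroots -/

section Symmetrized

theorem exists_pos_symmetrization {I : Type*} {A : Matrix I I ℤ} (hA : IsGCM A)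
    (hInd : Indecomposable A) (hSym : Symmetrizable A) :
    ∃ ε : I → ℝ, (∀ i, 0 < ε i) ∧ ∀ i j, ε i * A j i = ε j * A i j := by
  obtain ⟨d, hd0, hd⟩ := hSym
  have hsign : (∀ i, 0 < d i) ∨ ∀ i, d i < 0 := by
    by_contra! h
    obtain ⟨⟨i₀, hi₀⟩, i₁, hi₁⟩ := h
    obtain ⟨i, hi, j, hj, hij⟩ := hInd {i | 0 < d i} ⟨i₁, lt_of_le_of_ne hi₁ (hd0 i₁).symm⟩
      ⟨i₀, fun h => absurd h (not_lt.2 hi₀)⟩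
    have hi' : 0 < d i := hi
    have hj' : d j < 0 := lt_of_le_of_ne (not_lt.1 hj) (hd0 j)
    have hne : i ≠ j := fun h => by rw [h] at hi'; exact lt_asymm hi' hj'
    have h1 : (A i j : ℚ) < 0 := by exact_mod_cast lt_of_le_of_ne (hA.2.1 i j hne) hij
    have h2 : (A j i : ℚ) ≤ 0 := by exact_mod_cast hA.2.1 j i hne.symm
    have := hd i j
    have := mul_neg_of_pos_of_neg hi' h1
    have := mul_nonneg_of_nonpos_of_nonpos hj'.le h2
    linarith
  have hd' : ∀ i j, (d i : ℝ) * A i j = d j * A j i := fun i j => by exact_mod_cast hd i j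
  have hd0' : ∀ i, (d i : ℝ) ≠ 0 := fun i => by exact_mod_cast hd0 i
  have key : ∀ i j, (d i : ℝ)⁻¹ * A j i = (d j : ℝ)⁻¹ * A i j := fun i j => by
    have h1 := hd0' i
    have h2 := hd0' j
    field_simp
    linarith [hd' i j]
  rcases hsign with h | h
  · exact ⟨fun i => (d i : ℝ)⁻¹, fun i => inv_pos.2 (by exact_mod_cast h i), key⟩
  · refine ⟨fun i => -(d i : ℝ)⁻¹, fun i => neg_pos.2 (inv_lt_zero.2 (by exact_mod_cast h i)),
      fun i j => ?_⟩
    simpa using key i j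

theorem nonneg_of_isFiniteType {I : Type*} [Fintype I] {A : Matrix I I ℤ} (hA : IsGCM A)
    (hfin : IsFiniteType A) (y : I → ℝ) (hy : ∀ i, 0 ≤ ∑ j, (A i j : ℝ) * y j) (i : I) : 0 ≤ y i := by
  obtain ⟨u, hu, hAu⟩ := hfin
  have hu' : ∀ i, (0 : ℝ) < u i := fun i => by exact_mod_cast hu i
  have hAu' : ∀ i, (0 : ℝ) < ∑ j, (A i j : ℝ) * u j := fun i => by
    have := hAu i
    rw [finsum_eq_sum_of_fintype] at this
    exact_mod_cast this
  obtain ⟨i₀, -, hmin⟩ := Finset.exists_min_image Finset.univ (fun i => y i / u i) ⟨i, Finset.mem_univ i⟩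
  set t := y i₀ / u i₀
  have hle : ∀ j, t * u j ≤ y j := fun j => (le_div_iff₀ (hu' j)).1 (hmin j (Finset.mem_univ j))
  have hi₀ : y i₀ = t * u i₀ := by
    have := (hu' i₀).ne'
    simp only [t]; field_simp
  have h1 : ∑ j, (A i₀ j : ℝ) * y j ≤ t * ∑ j, (A i₀ j : ℝ) * u j := by
    rw [Finset.mul_sum]
    refine Finset.sum_le_sum fun j _ => ?_
    by_cases hj : i₀ = j
    · rw [← hj, hi₀]; linarith
    · have : (A i₀ j : ℝ) ≤ 0 := by exact_mod_cast hA.2.1 i₀ j hj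
      nlinarith [hle j]
  have ht : 0 ≤ t := by
    by_contra! ht
    have := mul_neg_of_neg_of_pos ht (hAu' i₀)
    linarith [hy i₀]
  exact (mul_nonneg ht (hu' i).le).trans (hle i)

theorem IsGCM.restrictM {I : Type*} {A : Matrix I I ℤ} (hA : IsGCM A) (T : Set I) :
    IsGCM (restrictM A T) :=
  ⟨fun i => hA.1 i, fun i j h => hA.2.1 i j fun h' => h (Subtype.ext h'), fun i j => hA.2.2 i j⟩

theorem sum_coe_set_eq {I X : Type*} [Fintype I] [AddCommMonoid X] (T : Set I) [Fintype T] (f : I → X)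
    (h : ∀ i ∉ T, f i = 0) : ∑ i : T, f i = ∑ i, f i := by
  rw [← Finset.sum_subtype (Finset.univ.filter (· ∈ T)) (by simp), Finset.sum_filter_of_ne]
  exact fun i _ hi => by_contra fun h' => hi (h i h')

variable {g : Type*} [LieRing g] [LieAlgebra ℂ g] {I : Type*} [Fintype I] [DecidableEq I]
  {A : Matrix I I ℤ}

theorem exists_sum_coroot {G : KacMoodyAlgebra A g} {T : Set I} {x : G.H}
    (hx : x ∈ Submodule.span ℂ (G.coroot '' T)) :
    ∃ p : I → ℂ, (∀ i ∉ T, p i = 0) ∧ x = ∑ i, p i • G.coroot i := by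
  rw [Finsupp.mem_span_image_iff_linearCombination] at hx
  obtain ⟨l, hl, rfl⟩ := hx
  refine ⟨l, fun i hi => ?_, by
    exact Finsupp.sum_fintype _ _ fun i => zero_smul ℂ _⟩
  exact Finsupp.notMem_support_iff.1 fun h => hi (hl h)

theorem IsHGen.re_pos (hA : IsGCM A) {ε : I → ℝ} (hε : ∀ i, 0 < ε i)
    (hεA : ∀ i j, ε i * A j i = ε j * A i j) {G : KacMoodyAlgebra A g} {T : Set I} {k : I}
    (hk : k ∈ T) (hfin : IsFiniteType (KMG.restrictM A T)) {Hk : G.H} (hH : IsHGen G T k Hk)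
    {p : I → ℂ} (hp : ∀ i ∉ T, p i = 0) (hHp : Hk = ∑ i, p i • G.coroot i) : 0 < (p k).re := by
  have h1 : ∀ j, ∑ i, (A j i : ℝ) * (ε i * (p i).re) = ε j * (G.root j Hk).re := fun j => by
    rw [hHp, map_sum, Complex.re_sum, Finset.mul_sum]
    refine Finset.sum_congr rfl fun i _ => ?_
    rw [map_smul, G.pairing, smul_eq_mul]
    simp only [Complex.mul_re, Complex.intCast_re, Complex.intCast_im, mul_zero, sub_zero]
    linear_combination (p i).re * hεA i j
  have h2 : ∀ j, ∑ i : T, (A j i : ℝ) * (ε i * (p i).re) = ε j * (G.root j Hk).re := fun j => by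
    rw [← h1]
    exact sum_coe_set_eq T (fun i => (A j i : ℝ) * (ε i * (p i).re)) fun i hi => by simp [hp i hi]
  have h3 : ∀ j : T, 0 ≤ ε j * (p j).re :=
    nonneg_of_isFiniteType (hA.restrictM T) hfin _ fun j => by
      refine le_of_le_of_eq ?_ (h2 j).symm
      rw [hH.2 j j.2]
      split_ifs
      · have := hε j
        simp [this.le]
      · simp
  have h4 : ∑ i : T, (A k i : ℝ) * (ε i * (p i).re) ≤ 2 * (ε k * (p k).re) := by
    rw [← Finset.sum_erase_add _ _ (Finset.mem_univ (⟨k, hk⟩ : T)), hA.1 k]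
    refine add_le_of_nonpos_left (Finset.sum_nonpos fun i hi => ?_)
    refine mul_nonpos_of_nonpos_of_nonneg ?_ (h3 i)
    have : k ≠ i := fun h => Finset.ne_of_mem_erase hi (Subtype.ext h.symm)
    exact_mod_cast hA.2.1 k i this
  rw [h2, hH.2 k hk, if_pos rfl, Complex.re_ofNat] at h4
  have := hε k
  exact pos_of_mul_pos_right (a := ε k) (by linarith) this.le

end Symmetrized

section CartanSup

variable {g : Type*} [LieRing g] [LieAlgebra ℂ g] {I : Type*} [Fintype I] [DecidableEq I]
  {A : Matrix I I ℤ} {S : Type*} [Fintype S] [DecidableEq S] {B : Matrix S S ℤ}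
  {m : Type*} [LieRing m] [LieAlgebra ℂ m]

namespace IsGraded

theorem Ik_subset_IreOf {G : KacMoodyAlgebra A g} {M : KacMoodyAlgebra B m} {φ : m →ₗ⁅ℂ⁆ g}
    {hle : M.H.map φ.toLinearMap ≤ G.H} {k : I} {s : S} (hk : k ∈ GammaOf G M φ hle s) :
    Ik G M φ hle k ⊆ IreOf G M φ hle := fun _ hi => ⟨k, ⟨s, hk⟩, hi⟩

theorem root_cartanIncl {G : KacMoodyAlgebra A g} {M : KacMoodyAlgebra B m} {φ : m →ₗ⁅ℂ⁆ g}
    {hle : M.H.map φ.toLinearMap ≤ G.H} (i : I) (x : M.H)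
    (hi : i ∈ IreOf G M φ hle) :
    G.root i (cartanIncl G M φ hle x) = 0 ∨ ∃ s, G.root i (cartanIncl G M φ hle x) = M.root s x := by
  obtain ⟨k, ⟨s, hk⟩, hi⟩ := hi
  rcases Ik_subset hk hi with h | h
  · exact .inr ⟨s, LinearMap.congr_fun h x⟩
  · exact .inl (LinearMap.congr_fun h x)

variable {G : KacMoodyAlgebra A g} {M : KacMoodyAlgebra B m} {φ : m →ₗ⁅ℂ⁆ g}
  {hle : M.H.map φ.toLinearMap ≤ G.H} (Γ : IsGraded G M φ hle)

include Γ

theorem nonempty_GammaOf (s : S) : ∃ k, k ∈ GammaOf G M φ hle s := by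
  obtain ⟨E, -, -, -, hE, -, -⟩ := Γ.exists_sl2Triples
  by_contra! h
  have h1 := hE s
  rw [Finset.sum_eq_zero fun k hk => absurd (Finset.mem_filter.1 hk).2 (h k)] at h1
  exact M.e_ne_zero s (Γ.grading.1 (h1.trans φ.map_zero.symm))

/-- The coroots of the grading subalgebra are combinations of the coroots of `I_re`, and a
symmetrization of `A` induces one of `B`. -/
theorem exists_coroot_eq {ε : I → ℝ} (hε : ∀ i, 0 < ε i) (hεA : ∀ i j, ε i * A j i = ε j * A i j) :
    ∃ (P : S → I → ℂ) (κ : S → ℂ),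
      (∀ s, cartanIncl G M φ hle (M.coroot s) = ∑ i, P s i • G.coroot i) ∧
      (∀ s, ∀ i ∉ IreOf G M φ hle, P s i = 0) ∧ (∀ s, κ s ≠ 0) ∧
      ∀ s x, ∑ i, P s i * (ε i * G.root i (cartanIncl G M φ hle x)) = κ s * M.root s x := by
  obtain ⟨E, F, Hc, hT, -, -, hco⟩ := Γ.exists_sl2Triples
  have hp : ∀ k, ∃ p : I → ℂ, ∀ s, k ∈ GammaOf G M φ hle s →
      (∀ i ∉ Ik G M φ hle k, p i = 0) ∧ Hc k = ∑ i, p i • G.coroot i := fun k => by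
    by_cases h : ∃ s, k ∈ GammaOf G M φ hle s
    · obtain ⟨s, hs⟩ := h
      obtain ⟨p, hp⟩ := exists_sum_coroot (hT s k hs).2.2.1.1
      exact ⟨p, fun _ _ => hp⟩
    · exact ⟨0, fun s hs => absurd ⟨s, hs⟩ h⟩
  choose p hp using hp
  refine ⟨fun s i => ∑ k with k ∈ GammaOf G M φ hle s, p k i,
    fun s => ∑ k with k ∈ GammaOf G M φ hle s, p k k * ε k, fun s => ?_, fun s i hi => ?_, fun s => ?_,
    fun s x => ?_⟩
  · refine Subtype.ext ((hco s).trans ?_)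
    simp only [Finset.sum_smul]
    rw [Finset.sum_comm, Submodule.coe_sum]
    exact Finset.sum_congr rfl fun k hk => congrArg Subtype.val (hp k s (Finset.mem_filter.1 hk).2).2
  · refine Finset.sum_eq_zero fun k hk => ?_
    have hk := (Finset.mem_filter.1 hk).2
    exact (hp k s hk).1 i fun h => hi (Ik_subset_IreOf hk h)
  · refine ne_of_apply_ne Complex.re (ne_of_gt ?_)
    rw [Complex.zero_re, Complex.re_sum]
    obtain ⟨k, hk⟩ := Γ.nonempty_GammaOf s
    refine Finset.sum_pos (fun k hk => ?_) ⟨k, by simpa using hk⟩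
    have hk := (Finset.mem_filter.1 hk).2
    rw [Complex.re_mul_ofReal]
    exact mul_pos ((hT s k hk).2.2.1.re_pos Γ.gcm hε hεA (self_mem_cmpnt (.inr rfl))
      (Γ.isFiniteType_of_subset (Ik_subset hk)) (hp k s hk).1 (hp k s hk).2) (hε k)
  · simp only [Finset.sum_mul]
    rw [Finset.sum_comm]
    refine Finset.sum_congr rfl fun k hk => ?_
    have hk := (Finset.mem_filter.1 hk).2
    rw [Finset.sum_eq_single k, mul_assoc]
    · congr 2
      exact LinearMap.congr_fun hk x
    · intro i _ hik
      by_cases hi : i ∈ Ik G M φ hle k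
      · have : i ∈ Jof G M φ hle := hi.1.resolve_right hik
        have : G.root i (cartanIncl G M φ hle x) = 0 := LinearMap.congr_fun this x
        rw [this, mul_zero, mul_zero]
      · rw [(hp k s hk).1 i hi, zero_mul]
    · exact fun h => absurd (Finset.mem_univ k) h

theorem sup_inf_le {ε : I → ℝ} (hε : ∀ i, 0 < ε i) (hεA : ∀ i j, ε i * A j i = ε j * A i j) :
    (LinearMap.range (cartanIncl G M φ hle) ⊔ Submodule.span ℂ (G.coroot '' IreOf G M φ hle)) ⊓
      hJsub G (IreOf G M φ hle) ≤ Submodule.span ℂ (G.coroot '' IreOf G M φ hle) := by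
  obtain ⟨P, κ, hP, hPT, hκ, hPκ⟩ := Γ.exists_coroot_eq hε hεA
  rintro x ⟨hx, hxN⟩
  obtain ⟨_, ⟨a, rfl⟩, h, hh, rfl⟩ := Submodule.mem_sup.1 hx
  refine add_mem ?_ hh
  have hxN' : ∀ i ∈ IreOf G M φ hle, G.root i (cartanIncl G M φ hle a) = -G.root i h := fun i hi => by
    have := (Submodule.mem_iInf _).1 ((Submodule.mem_iInf _).1 hxN i) hi
    rw [LinearMap.mem_ker, map_add] at this
    exact eq_neg_of_add_eq_zero_left this
  suffices ha : a ∈ Submodule.span ℂ (Set.range M.coroot) by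
    refine Submodule.span_induction (p := fun a _ => cartanIncl G M φ hle a ∈ _) ?_ ?_ ?_ ?_ ha
    · rintro _ ⟨s, rfl⟩
      rw [hP]
      refine sum_mem fun i _ => ?_
      by_cases hi : i ∈ IreOf G M φ hle
      · exact Submodule.smul_mem _ _ (Submodule.subset_span ⟨i, hi, rfl⟩)
      · rw [hPT s i hi, zero_smul]; exact zero_mem _
    · rw [map_zero]; exact zero_mem _
    · intro u v _ _ hu hv; rw [map_add]; exact add_mem hu hv
    · intro c u _ hu; rw [map_smul]; exact Submodule.smul_mem _ _ hu
  -- the induced symmetrization of `B`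
  have hsymm : ∀ s t, κ s * B t s = κ t * B s t := fun s t => by
    rw [← M.pairing, ← M.pairing, ← hPκ, ← hPκ]
    simp only [hP, map_sum, map_smul, G.pairing, smul_eq_mul, Finset.mul_sum]
    rw [Finset.sum_comm]
    refine Finset.sum_congr rfl fun i _ => Finset.sum_congr rfl fun j _ => ?_
    have : (ε i : ℂ) * A j i = ε j * A i j := by exact_mod_cast hεA i j
    linear_combination (P s j * P t i) * this.symm
  have := M.findimH
  let L : (S → ℂ) →ₗ[ℂ] Module.Dual ℂ M.H := Fintype.linearCombination ℂ fun s => κ s • M.root s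
  have hL : ∀ z v, L z v = ∑ s, z s * (κ s * M.root s v) := fun z v => by
    simp [L, Fintype.linearCombination_apply]
  have hLinj : Function.Injective L :=
    (M.indepRoot.units_smul fun s => Units.mk0 (κ s) (hκ s)).fintypeLinearCombination_injective
  let Z : Submodule ℂ (S → ℂ) := LinearMap.ker (B.map ((↑) : ℤ → ℂ)).transpose.mulVecLin
  have hZ : ∀ z ∈ Z, ∀ t, ∑ s, z s * (B s t : ℂ) = 0 := fun z hz t => by
    have := congrFun (LinearMap.mem_ker.1 hz) t
    simpa [Matrix.vecMul, dotProduct] using this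
  have hdimZ : finrank ℂ Z = gcmCorank B := by
    have h1 := LinearMap.finrank_range_add_finrank_ker (B.map ((↑) : ℤ → ℂ)).transpose.mulVecLin
    have h2 : finrank ℂ (LinearMap.range (B.map ((↑) : ℤ → ℂ)).transpose.mulVecLin) =
        (B.map ((↑) : ℤ → ℚ)).rank := by
      rw [← rank_map_complex, ← Matrix.rank_transpose (Matrix.map _ _)]
      have h3 : (B.map ((↑) : ℤ → ℚ)).map ((↑) : ℚ → ℂ) = B.map ((↑) : ℤ → ℂ) := by ext; simp
      rw [h3]
      rfl
    rw [h2, finrank_fintype_fun_eq_card] at h1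
    rw [gcmCorank]
    change _ + finrank ℂ Z = _ at h1
    omega
  have hspan : Submodule.span ℂ (Set.range M.coroot) = (Z.map L).dualCoannihilator := by
    refine Submodule.eq_of_le_of_finrank_eq ?_ ?_
    · rw [Submodule.span_le]
      rintro _ ⟨t, rfl⟩
      rw [SetLike.mem_coe, Submodule.mem_dualCoannihilator]
      rintro _ ⟨z, hz, rfl⟩
      rw [hL]
      have h1 := hZ z hz t
      calc _ = κ t * ∑ s, z s * (B s t : ℂ) := by
            rw [Finset.mul_sum]
            refine Finset.sum_congr rfl fun s _ => ?_
            rw [M.pairing]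
            linear_combination z s * hsymm s t
        _ = 0 := by rw [h1, mul_zero]
    · have h1 := Subspace.finrank_add_finrank_dualCoannihilator_eq (Z.map L)
      rw [(Submodule.equivMapOfInjective L hLinj Z).symm.finrank_eq, hdimZ, M.finrankH] at h1
      rw [finrank_span_eq_card M.indepCoroot]
      omega
  rw [hspan, Submodule.mem_dualCoannihilator]
  rintro _ ⟨z, hz, rfl⟩
  obtain ⟨q, hqT, rfl⟩ := exists_sum_coroot hh
  rw [hL]
  simp only [← hPκ]
  have hz0 : ∀ j ∈ IreOf G M φ hle, G.root j (cartanIncl G M φ hle (∑ s, z s • M.coroot s)) = 0 := by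
    intro j hj
    rcases root_cartanIncl j (∑ s, z s • M.coroot s) hj with h | ⟨t, h⟩
    · exact h
    · rw [h, ← hZ z hz t]
      simp [M.pairing]
  calc ∑ s, z s * ∑ i, P s i * (ε i * G.root i (cartanIncl G M φ hle a))
      = ∑ s, z s * ∑ i, P s i * (ε i * -∑ j, q j * (A j i : ℂ)) := by
        refine Finset.sum_congr rfl fun s _ => congrArg _ (Finset.sum_congr rfl fun i _ => ?_)
        by_cases hi : i ∈ IreOf G M φ hle
        · rw [hxN' i hi]; simp [G.pairing]
        · simp [hPT s i hi]
    _ = -∑ j, q j * (ε j * G.root j (cartanIncl G M φ hle (∑ s, z s • M.coroot s))) := by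
        simp only [map_sum, map_smul, hP, G.pairing, smul_eq_mul, Finset.mul_sum,
          ← Finset.sum_neg_distrib]
        refine (Finset.sum_congr rfl fun s _ => ?_).trans Finset.sum_comm
        rw [Finset.sum_comm]
        refine Finset.sum_congr rfl fun j _ => Finset.sum_congr rfl fun i _ => ?_
        have : (ε i : ℂ) * A j i = ε j * A i j := by exact_mod_cast hεA i j
        linear_combination (-z s * P s i * q j) * this
    _ = 0 := by
        refine neg_eq_zero.2 (Finset.sum_eq_zero fun j _ => ?_)
        by_cases hj : j ∈ IreOf G M φ hle
        · rw [hz0 j hj, mul_zero, mul_zero]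
        · rw [hqT j hj, zero_mul]

end IsGraded

end CartanSup

section Realization

theorem exists_ge_inf_eq_sup_eq_top {α : Type*} [Lattice α] [BoundedOrder α] [IsModularLattice α]
    [ComplementedLattice α] (a b : α) : ∃ c, a ≤ c ∧ c ⊓ b = a ⊓ b ∧ c ⊔ b = ⊤ := by
  obtain ⟨d, hd⟩ := exists_isCompl (a ⊓ b)
  have h1 : Disjoint a (d ⊓ b) := by
    rw [disjoint_iff, inf_comm d b, ← inf_assoc]
    exact disjoint_iff.1 hd.disjoint
  obtain ⟨c, hac, hc⟩ := h1.exists_isCompl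
  have hb : a ⊓ b ⊔ d ⊓ b = b := by
    rw [← sup_inf_assoc_of_le d (inf_le_right : a ⊓ b ≤ b), hd.sup_eq_top, top_inf_eq]
  refine ⟨c, hac, le_antisymm ?_ (inf_le_inf_right b hac), ?_⟩
  · have h2 : c ⊓ b = a ⊓ b ⊔ (d ⊓ b) ⊓ c := by
      rw [← sup_inf_assoc_of_le _ (inf_le_left.trans hac), hb, inf_comm]
    rw [h2, inf_comm _ c, hc.inf_eq_bot, sup_bot_eq]
  · exact top_le_iff.1 (hc.sup_eq_top.ge.trans (sup_le_sup_left inf_le_right c))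

variable {g : Type*} [LieRing g] [LieAlgebra ℂ g] {I : Type*} [Fintype I] [DecidableEq I]
  {A : Matrix I I ℤ} {S : Type*} [Fintype S] [DecidableEq S] {B : Matrix S S ℤ}
  {m : Type*} [LieRing m] [LieAlgebra ℂ m]

theorem mem_hJsub {G : KacMoodyAlgebra A g} {T : Set I} {x : G.H} :
    x ∈ hJsub G T ↔ ∀ i ∈ T, G.root i x = 0 := by
  simp [hJsub]

theorem finrank_hJsub (G : KacMoodyAlgebra A g) (T : Set I) [Fintype T] :
    finrank ℂ (hJsub G T) + Fintype.card T = finrank ℂ G.H := by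
  have := G.findimH
  let L : G.H →ₗ[ℂ] T → ℂ := LinearMap.pi fun i => G.root i
  have hL : LinearMap.range L = ⊤ := LinearMap.range_eq_top.2 fun v => by
    obtain ⟨x, hx⟩ := G.exists_root_eq fun i => if h : i ∈ T then v ⟨i, h⟩ else 0
    refine ⟨x, funext fun i => ?_⟩
    simp [L, hx]
  have hker : LinearMap.ker L = hJsub G T := by
    ext x
    rw [mem_hJsub, LinearMap.mem_ker]
    exact ⟨fun h i hi => congrFun h ⟨i, hi⟩, fun h => funext fun i => h i i.2⟩
  have := LinearMap.finrank_range_add_finrank_ker L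
  rw [hL, hker, finrank_top, finrank_fintype_fun_eq_card] at this
  omega

theorem finrank_span_coroot_inf_hJsub (G : KacMoodyAlgebra A g) (T : Set I) [Fintype T] [DecidableEq T] :
    finrank ℂ (Submodule.span ℂ (G.coroot '' T) ⊓ hJsub G T : Submodule ℂ G.H) =
      gcmCorank (restrictM A T) := by
  rw [hJsub, iInf_subtype', Set.image_eq_range]
  exact finrank_center_eq_gcmCorank (restrictM A T) (fun i : T => G.coroot i)
    (fun i : T => G.root i) (G.indepCoroot.comp _ Subtype.val_injective) fun i j => G.pairing i j

namespace IsGraded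

variable {G : KacMoodyAlgebra A g} {M : KacMoodyAlgebra B m} {φ : m →ₗ⁅ℂ⁆ g}
  {hle : M.H.map φ.toLinearMap ≤ G.H} (Γ : IsGraded G M φ hle)

include Γ

/-- The Cartan subspace of `g(I_re)`. -/
theorem exists_realization (hInd : Indecomposable A) (hSym : Symmetrizable A)
    [Fintype (IreOf G M φ hle)] [DecidableEq (IreOf G M φ hle)] :
    ∃ U : Submodule ℂ G.H, (∀ x, cartanIncl G M φ hle x ∈ U) ∧
      (∀ i ∈ IreOf G M φ hle, G.coroot i ∈ U) ∧
      (LinearIndependent ℂ fun i : IreOf G M φ hle => (G.root i).comp U.subtype) ∧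
      finrank ℂ U = Fintype.card (IreOf G M φ hle) + gcmCorank (restrictM A (IreOf G M φ hle)) := by
  obtain ⟨ε, hε, hεA⟩ := exists_pos_symmetrization Γ.gcm hInd hSym
  have := G.findimH
  have hsup := Γ.sup_inf_le hε hεA
  obtain ⟨U, hU, hUN, hUtop⟩ := exists_ge_inf_eq_sup_eq_top
    (LinearMap.range (cartanIncl G M φ hle) ⊔ Submodule.span ℂ (G.coroot '' IreOf G M φ hle)) (hJsub G (IreOf G M φ hle))
  have hUN' : U ⊓ hJsub G (IreOf G M φ hle) = Submodule.span ℂ (G.coroot '' IreOf G M φ hle) ⊓ hJsub G (IreOf G M φ hle) := by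
    rw [hUN]
    exact le_antisymm (le_inf hsup inf_le_right) (inf_le_inf_right _ le_sup_right)
  refine ⟨U, fun x => hU (Submodule.mem_sup_left ⟨x, rfl⟩),
    fun i hi => hU (Submodule.mem_sup_right (Submodule.subset_span ⟨i, hi, rfl⟩)), ?_, ?_⟩
  · rw [Fintype.linearIndependent_iff]
    intro c hc
    refine Fintype.linearIndependent_iff.1 (G.indepRoot.comp _ Subtype.val_injective) c ?_
    ext x
    obtain ⟨u, hu, v, hv, rfl⟩ := Submodule.mem_sup.1 (hUtop.ge (Submodule.mem_top (x := x)))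
    rw [map_add, LinearMap.zero_apply]
    have h1 := LinearMap.congr_fun hc ⟨u, hu⟩
    have h2 := mem_hJsub.1 hv
    simp only [LinearMap.sum_apply, LinearMap.smul_apply, LinearMap.comp_apply,
      Submodule.subtype_apply, LinearMap.zero_apply, Function.comp_apply] at h1 ⊢
    rw [h1, zero_add]
    exact Finset.sum_eq_zero fun i _ => by rw [h2 i i.2, smul_zero]
  · have h1 := Submodule.finrank_sup_add_finrank_inf_eq U (hJsub G (IreOf G M φ hle))
    rw [hUN', finrank_span_coroot_inf_hJsub, hUtop, finrank_top] at h1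
    have h2 := finrank_hJsub G (IreOf G M φ hle)
    omega

end IsGraded

theorem IsFinGrading.of_le {M : KacMoodyAlgebra B m} {φ : m →ₗ⁅ℂ⁆ g} (h : IsFinGrading M φ)
    {L : LieSubalgebra ℂ g} {φ₀ : m →ₗ⁅ℂ⁆ L} (hφ : ∀ x, (φ₀ x : g) = φ x)
    (htop : ⨆ χ, wtSpaceι (φ₀.toLinearMap ∘ₗ M.H.subtype) χ = ⊤) : IsFinGrading M φ₀ := by
  have hmap : ∀ χ, ∀ x ∈ wtSpaceι (φ₀.toLinearMap ∘ₗ M.H.subtype) χ,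
      (x : g) ∈ wtSpaceι (φ.toLinearMap ∘ₗ M.H.subtype) χ := fun χ x hx v => by
    have := congrArg Subtype.val (hx v)
    rw [LieSubalgebra.coe_bracket] at this
    exact (congrArg (⁅·, (x : g)⁆) (hφ v).symm).trans this
  refine ⟨fun x y hxy => h.1 (by rw [← hφ, ← hφ, hxy]), ?_, fun χ hχ => ?_⟩
  · rw [← htop]
    refine le_antisymm (iSup₂_le fun χ _ => le_iSup _ χ) (iSup_le fun χ => ?_)
    by_cases hχ : wtSpaceι (φ₀.toLinearMap ∘ₗ M.H.subtype) χ = ⊥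
    · rw [hχ]; exact bot_le
    · refine le_iSup₂_of_le χ (mem_of_iSup_wtSpaceι_eq_top h.2.1 fun h' => ?_) le_rfl
      obtain ⟨x, hx, hx0⟩ := Submodule.exists_mem_ne_zero_of_ne_bot hχ
      have := hmap χ x hx
      rw [h', Submodule.mem_bot] at this
      exact hx0 (Subtype.ext this)
  · have := h.2.2 χ hχ
    let ψ : wtSpaceι (φ₀.toLinearMap ∘ₗ M.H.subtype) χ →ₗ[ℂ]
        wtSpaceι (φ.toLinearMap ∘ₗ M.H.subtype) χ :=
      LinearMap.restrict L.toSubmodule.subtype (hmap χ)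
    exact FiniteDimensional.of_injective ψ fun x y hxy =>
      Subtype.ext (Subtype.ext (congrArg (Subtype.val : wtSpaceι (φ.toLinearMap ∘ₗ M.H.subtype) χ → g) hxy))

end Realization

section RealSubalgebra

variable {g : Type*} [LieRing g] [LieAlgebra ℂ g] {I : Type*} [Fintype I] [DecidableEq I]
  {A : Matrix I I ℤ} {S : Type*} [Fintype S] [DecidableEq S] {B : Matrix S S ℤ}
  {m : Type*} [LieRing m] [LieAlgebra ℂ m]

theorem KacMoodyAlgebra.apply_mem (M : KacMoodyAlgebra B m) (φ : m →ₗ⁅ℂ⁆ g) {L : LieSubalgebra ℂ g}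
    (hH : ∀ x : M.H, φ x ∈ L) (he : ∀ s, φ (M.e s) ∈ L) (hf : ∀ s, φ (M.f s) ∈ L) (x : m) :
    φ x ∈ L := by
  have h1 : (⊤ : LieSubalgebra ℂ m) ≤ L.comap φ := by
    rw [← M.generates, LieSubalgebra.lieSpan_le]
    rintro y ((hy | ⟨s, rfl⟩) | ⟨s, rfl⟩)
    · exact hH ⟨y, hy⟩
    · exact he s
    · exact hf s
  exact h1 (LieSubalgebra.mem_top x)

theorem Adapted.nonneg {G : KacMoodyAlgebra A g} {M : KacMoodyAlgebra B m} {φ : m →ₗ⁅ℂ⁆ g}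
    {hle : M.H.map φ.toLinearMap ≤ G.H} (h : Adapted G M φ hle) (i : I) :
    ∃ n : S → ℕ, resRoot G M φ hle i = ∑ s, (n s : ℂ) • M.root s := by
  have h1 : G.root i ∈ posRoots G := by
    refine ⟨⟨G.indepRoot.ne_zero i, fun h0 => G.e_ne_zero i ?_⟩, Pi.single i 1, ?_⟩
    · have : G.e i ∈ wtSpaceι G.H.subtype (G.root i) := fun x => G.lie_e x i
      rwa [h0, Submodule.mem_bot] at this
    · rw [Finset.sum_eq_single i] <;> simp +contextual
  rcases h _ h1 with h2 | ⟨-, c, hc⟩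
  · exact ⟨0, h2.trans (by simp)⟩
  · exact ⟨c, hc⟩

theorem IsGraded.exists_gIre {G : KacMoodyAlgebra A g} {M : KacMoodyAlgebra B m} {φ : m →ₗ⁅ℂ⁆ g}
    {hle : M.H.map φ.toLinearMap ≤ G.H} (Γ : IsGraded G M φ hle) (hInd : Indecomposable A)
    (hSym : Symmetrizable A) :
    ∃ (hIre : Submodule ℂ g) (hle2 : hIre ≤ G.H),
      M.H.map φ.toLinearMap ≤ hIre ∧
      (∀ i ∈ IreOf G M φ hle, ((G.coroot i : ↥G.H) : g) ∈ hIre) ∧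
      LinearIndependent ℂ (fun i : ↥(IreOf G M φ hle) =>
        (G.root i.1).comp (Submodule.inclusion hle2)) ∧
      FiniteDimensional ℂ ↥hIre ∧
      Module.finrank ℂ ↥hIre = Fintype.card ↥(IreOf G M φ hle) +
        gcmCorank (restrictM A (IreOf G M φ hle)) ∧
      ∃ GI : KacMoodyAlgebra (restrictM A (IreOf G M φ hle)) ↥(gIre G (IreOf G M φ hle) hIre),
        IsAssocKMIre G (IreOf G M φ hle) hIre GI ∧
        ∃ φ₀ : m →ₗ⁅ℂ⁆ ↥(gIre G (IreOf G M φ hle) hIre), (∀ x, (φ₀ x : g) = φ x) ∧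
          ∃ hle₀ : M.H.map φ₀.toLinearMap ≤ GI.H, IsGraded GI M φ₀ hle₀ ∧
            ∀ i, resRoot GI M φ₀ hle₀ i = resRoot G M φ hle i := by
  obtain ⟨U, haU, hcU, hindep, hrank⟩ := Γ.exists_realization hInd hSym
  have := G.findimH
  set hIre : Submodule ℂ g := U.map G.H.subtype
  have hle2 : hIre ≤ G.H := by
    rintro _ ⟨u, -, rfl⟩; exact u.2
  have hmem : ∀ u : G.H, u ∈ U → (u : g) ∈ hIre := fun u hu => ⟨u, hu, rfl⟩
  have ha : ∀ x : M.H, φ x ∈ hIre := fun x => hmem _ (haU x)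
  let ψ : U →ₗ[ℂ] hIre := LinearMap.restrict G.H.subtype fun u hu => hmem u hu
  set rt : IreOf G M φ hle → Module.Dual ℂ hIre := fun i => (G.root i.1).comp (Submodule.inclusion hle2)
  have hrt : LinearIndependent ℂ rt := LinearIndependent.of_comp ψ.dualMap hindep
  let co : IreOf G M φ hle → hIre := fun i => ⟨G.coroot i, hmem _ (hcU i i.2)⟩
  have hco : LinearIndependent ℂ co := by
    refine LinearIndependent.of_comp (Submodule.inclusion hle2) ?_
    exact G.indepCoroot.comp _ Subtype.val_injective
  have hfinrank : finrank ℂ hIre = Fintype.card ↥(IreOf G M φ hle) +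
        gcmCorank (restrictM A (IreOf G M φ hle)) :=
    (Submodule.equivMapOfInjective _ G.H.subtype_injective U).symm.finrank_eq.trans hrank
  have hfd : FiniteDimensional ℂ hIre := inferInstance
  have hgen : gIre G (IreOf G M φ hle) hIre = LieSubalgebra.lieSpan ℂ g
      ((hIre : Set g) ∪ Set.range (fun i : IreOf G M φ hle => G.e i) ∪
        Set.range (fun i : IreOf G M φ hle => G.f i)) := by
    rw [gIre]
    congr 2
    · congr 1
      ext x; simp [eq_comm]
    · ext x; simp [eq_comm]
  obtain ⟨GI, h1, h2, h3, h4, h5⟩ := exists_kacMoodyAlgebra (A := restrictM A (IreOf G M φ hle))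
    (gIre G (IreOf G M φ hle) hIre) hIre rt co
    (fun i => G.e i) (fun i => G.f i) hgen hfd hfinrank hrt hco (fun i j => G.pairing i j)
    (fun x hx y hy => G.abelian ⟨x, hle2 hx⟩ ⟨y, hle2 hy⟩) (fun x i => G.lie_e ⟨x, hle2 x.2⟩ i)
    (fun x i => G.lie_f ⟨x, hle2 x.2⟩ i) (fun i j => (G.e_f i j).trans (by simp [Subtype.ext_iff, co]))
    (fun i j hij => G.serre_e i j fun h => hij (Subtype.ext h))
    (fun i j hij => G.serre_f i j fun h => hij (Subtype.ext h))
  have hgS : gS G (IreOf G M φ hle) ≤ gIre G (IreOf G M φ hle) hIre :=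
    G.gS_le (fun i hi => LieSubalgebra.subset_lieSpan (.inl (.inr ⟨i, hi, rfl⟩)))
      fun i hi => LieSubalgebra.subset_lieSpan (.inr ⟨i, hi, rfl⟩)
  obtain ⟨E, F, Hc, hT, hE, hF, -⟩ := Γ.exists_sl2Triples
  have hφ : ∀ x, φ x ∈ gIre G (IreOf G M φ hle) hIre := by
    refine M.apply_mem φ (fun x => LieSubalgebra.subset_lieSpan (.inl (.inl (ha x)))) (fun s => ?_) fun s => ?_
    · rw [hE]
      refine sum_mem fun k hk => hgS (G.gS_mono (Ik_subset_IreOf (Finset.mem_filter.1 hk).2) ?_)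
      exact G.degOne_le_gS _ _ (hT s k (Finset.mem_filter.1 hk).2).1
    · rw [hF]
      refine sum_mem fun k hk => hgS (G.gS_mono (Ik_subset_IreOf (Finset.mem_filter.1 hk).2) ?_)
      rw [← gS_flip]
      exact G.flip.degOne_le_gS _ _ (hT s k (Finset.mem_filter.1 hk).2).2.1
  let φ₀ : m →ₗ⁅ℂ⁆ gIre G (IreOf G M φ hle) hIre :=
    { LinearMap.codRestrict (gIre G (IreOf G M φ hle) hIre).toSubmodule φ.toLinearMap hφ with
      map_lie' := fun {x y} => Subtype.ext (φ.map_lie x y) }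
  have hle₀ : M.H.map φ₀.toLinearMap ≤ GI.H := by
    rintro _ ⟨x, hx, rfl⟩
    have h6 : φ x ∈ hIre := ha ⟨x, hx⟩
    rw [← h1] at h6
    obtain ⟨y, hy, hyx⟩ := h6
    have : y = φ₀ x := Subtype.ext hyx
    rwa [this] at hy
  have hres : ∀ i, resRoot GI M φ₀ hle₀ i = resRoot G M φ hle i := fun i => by
    ext x
    exact h5 i (cartanIncl GI M φ₀ hle₀ x) ⟨φ x, ha x⟩ rfl
  refine ⟨hIre, hle2, ?_, fun i hi => hmem _ (hcU i hi), hrt, hfd, hfinrank, GI,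
    ⟨h1, h2, h3, h4⟩, φ₀, fun x => rfl, hle₀, ⟨Γ.gcm.restrictM _, Γ.gcm', ?_, fun i => ?_⟩, hres⟩
  · rintro _ ⟨x, hx, rfl⟩; exact ha ⟨x, hx⟩
  · refine Γ.grading.of_le (fun x => rfl) ?_
    rw [eq_top_iff, ← Pre.iSup_wtSpaceι GI.toPre]
    refine iSup_le fun χ => le_iSup_of_le (χ.comp (cartanIncl GI M φ₀ hle₀)) fun x hx v => ?_
    exact hx (cartanIncl GI M φ₀ hle₀ v)
  · rw [hres]; exact Γ.nonneg i

end RealSubalgebra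

/-! ### Weights of an algebra containing a Kac-Moody algebra -/

section Overalgebra

variable {g : Type*} [LieRing g] [LieAlgebra ℂ g] {L : Type*} [LieRing L] [LieAlgebra ℂ L]
  {K : Type*} [Fintype K] [DecidableEq K] {A : Matrix K K ℤ}

namespace KacMoodyAlgebra

variable {G : KacMoodyAlgebra A L} {ι : L →ₗ⁅ℂ⁆ g}

/-- The weight space of multidegree `d` for a Kac-Moody algebra mapping to `g`. -/
def U (G : KacMoodyAlgebra A L) (ι : L →ₗ⁅ℂ⁆ g) (d : K → ℤ) : Submodule ℂ g :=
  wtSpaceι (ι.toLinearMap ∘ₗ G.H.subtype) (G.toPre.wt d)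

theorem U_flip (d : K → ℤ) : G.flip.U ι d = G.U ι (-d) := by
  rw [U, U, Pre.wt_neg, ← Pre.wt_flip]

theorem U_reflect (hA : IsGCM A) (hι : Function.Injective ι) {k : K}
    (he : ∀ y, y ∈ LieSubalgebra.engel ℂ (ι (G.e k)))
    (hf : ∀ y, y ∈ LieSubalgebra.engel ℂ (ι (G.f k))) {d : K → ℤ} (h : G.U ι d ≠ ⊥) :
    G.U ι (d - Pi.single k (∑ j, A k j * d j)) ≠ ⊥ := by
  have t := G.isSl2Triple hA k
  have t' : IsSl2Triple ((ι.toLinearMap ∘ₗ G.H.subtype) (G.coroot k)) (ι (G.e k)) (ι (G.f k)) :=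
    { h_ne_zero := fun h0 => t.h_ne_zero (hι (h0.trans ι.map_zero.symm))
      lie_e_f := by rw [← LieHom.map_lie, t.lie_e_f]; rfl
      lie_h_e_nsmul := by
        have := congrArg ι t.lie_h_e_nsmul
        rwa [LieHom.map_lie, map_nsmul] at this
      lie_h_f_nsmul := by
        have := congrArg ι t.lie_h_f_nsmul
        rwa [LieHom.map_lie, map_neg, map_nsmul] at this }
  obtain ⟨n, h1, h2⟩ := exists_reflect t' (β := G.root k)
    (fun v => by
      have := congrArg ι (G.lie_e v k)
      rwa [LieHom.map_lie, map_smul] at this)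
    (fun v => by
      have := congrArg ι (G.lie_f v k)
      rwa [LieHom.map_lie, map_smul] at this)
    he hf (by rw [G.pairing, hA.1]; norm_num) h
  rw [G.wt_coroot] at h1
  rw [Int.cast_inj.1 h1, U, Pre.wt_sub, Pre.wt_single]
  exact h2

theorem sum_mul_nonneg_of_W_add_eq_bot (hA : IsGCM A) {k : K} {d : K → ℤ} (h : G.toPre.W d ≠ ⊥)
    (h' : G.toPre.W (d + Pi.single k 1) = ⊥) : 0 ≤ ∑ j, A k j * d j := by
  obtain ⟨x, hx, hx0⟩ := (Submodule.ne_bot_iff _).1 h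
  have h1 : ⁅G.e k, x⁆ ∈ G.toPre.W (d + Pi.single k 1) := by
    rw [Pre.W, Pre.wt_add, Pre.wt_single, Int.cast_one, one_smul, add_comm]
    exact lie_mem_wtSpaceι (G.toPre.e_mem_wtSpaceι k) hx
  rw [h', Submodule.mem_bot] at h1
  obtain ⟨N, hN, -⟩ := exists_nat_of_primitive (G.isSl2Triple hA k) hx0 (hx (G.coroot k)) h1
    (G.mem_engel_f k x)
  rw [wt_coroot] at hN
  have : ((∑ j, A k j * d j : ℤ) : ℂ) = ((N : ℤ) : ℂ) := by rw [hN]; norm_cast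
  rw [Int.cast_inj.1 this]
  exact Int.natCast_nonneg N

/-- The nonnegative weights of an algebra containing a Kac-Moody algebra are roots, if any of them
is obtained by adding a simple root to a smaller one. -/
theorem W_ne_bot_of_U_ne_bot (hA : IsGCM A) (hι : Function.Injective ι)
    (he : ∀ k y, y ∈ LieSubalgebra.engel ℂ (ι (G.e k)))
    (hf : ∀ k y, y ∈ LieSubalgebra.engel ℂ (ι (G.f k)))
    (h1 : ∀ d, G.U ι d ≠ ⊥ → 0 ≤ d ∨ d ≤ 0)
    (h3 : ∀ k (n : ℤ), 2 ≤ n → G.U ι (Pi.single k n) = ⊥)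
    (h4 : ∀ d, 0 ≤ d → d ≠ 0 → G.U ι d ≠ ⊥ →
      ∃ k, 0 ≤ d - Pi.single k 1 ∧ (d = Pi.single k 1 ∨ G.U ι (d - Pi.single k 1) ≠ ⊥))
    (d : K → ℤ) (hd : 0 ≤ d) (hd0 : d ≠ 0) (hU : G.U ι d ≠ ⊥) : G.toPre.W d ≠ ⊥ := by
  obtain ⟨n, hn⟩ : ∃ n : ℕ, ∑ k, (d k).toNat < n := ⟨_, Nat.lt_succ_self _⟩
  induction n generalizing d with
  | zero => omega
  | succ n ih =>
  have hlt : ∀ d', 0 ≤ d' → d' ≤ d → d' ≠ d → ∑ k, (d' k).toNat < n := fun d' h0 hle hne => by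
    refine lt_of_lt_of_le (Finset.sum_lt_sum (fun k _ => Int.toNat_le_toNat (hle k)) ?_)
      (Nat.lt_succ_iff.1 hn)
    by_contra! h
    refine hne (funext fun k => le_antisymm (hle k) ?_)
    have := h k (Finset.mem_univ k)
    have h5 : 0 ≤ d' k := h0 k
    have h6 : 0 ≤ d k := hd k
    omega
  obtain ⟨k, hk, hk'⟩ := h4 d hd hd0 hU
  have hek : G.toPre.W (Pi.single k 1) ≠ ⊥ := fun h => by
    have := G.toPre.e_mem_wtSpaceι k
    rw [Pre.W, Pre.wt_single, Int.cast_one, one_smul] at h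
    rw [h, Submodule.mem_bot] at this
    exact G.e_ne_zero k this
  by_cases hdk : d = Pi.single k 1
  · rwa [hdk]
  replace hk' := hk'.resolve_left hdk
  have hγ := ih (d - Pi.single k 1) hk (fun h => hdk (sub_eq_zero.1 h)) hk'
    (hlt _ hk (by simp) (by simp))
  intro hW
  have hN := sum_mul_nonneg_of_W_add_eq_bot hA (k := k) hγ (by rwa [sub_add_cancel])
  have hsub : ∀ (c : K → ℤ) (n : ℤ), ∑ j, A k j * (c - Pi.single k n : K → ℤ) j =
      (∑ j, A k j * c j) - 2 * n := fun c n => by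
    simp [mul_sub, Finset.sum_sub_distrib, Pi.single_apply, hA.1]
  rw [hsub] at hN
  have hU' := U_reflect hA hι (he k) (hf k) hU
  set N := ∑ j, A k j * d j with hNdef
  have hsingle : d ≠ Pi.single k (d k) := fun h => by
    have hdk1 : 2 ≤ d k := by
      have h5 := hk k
      simp at h5
      rcases h5.eq_or_lt with h6 | h6
      · exact absurd (by rw [h, ← h6]) hdk
      · omega
    exact hU (by rw [h]; exact h3 k _ hdk1)
  obtain ⟨j, hjk, hj⟩ : ∃ j, j ≠ k ∧ 0 < d j := by
    by_contra! h
    refine hsingle (funext fun j => ?_)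
    by_cases hj : j = k
    · subst hj; simp
    · rw [Pi.single_eq_of_ne hj]
      exact le_antisymm (h j hj) (hd j)
  have hd' : 0 ≤ d - Pi.single k N := by
    refine (h1 _ hU').resolve_right fun h => ?_
    have := h j
    simp [hjk] at this
    omega
  have hW' := ih _ hd' (fun h => by have := congrFun h j; simp [hjk] at this; omega) hU'
    (hlt _ hd' (by simp; omega) (fun h => by have := congrFun h k; simp at this; omega))
  have := G.W_reflect hA k hW'
  rw [hsub, ← hNdef] at this
  refine this ?_
  convert hW using 2
  rw [sub_sub, ← Pi.single_add]
  simp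
  ring

end KacMoodyAlgebra

end Overalgebra

/-! ### The algebra attached to a C-admissible pair -/

section Admissible

variable {g : Type*} [LieRing g] [LieAlgebra ℂ g] {I : Type*} [Fintype I] [DecidableEq I]
  {A : Matrix I I ℤ}

theorem span_coroot_inf_hJsub_eq_bot {G : KacMoodyAlgebra A g} (hA : IsGCM A) {J : Set I}
    (hfin : IsFiniteType (restrictM A J)) :
    Submodule.span ℂ (G.coroot '' J) ⊓ hJsub G J = ⊥ := by
  refine (Submodule.eq_bot_iff _).2 fun x hx => ?_
  obtain ⟨p, hp, rfl⟩ := exists_sum_coroot hx.1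
  have hx2 := mem_hJsub.1 hx.2
  have hdet := isUnit_det_of_isFiniteType (hA.restrictM J) hfin
  have h0 : (fun j : J => p j) = 0 := Matrix.eq_zero_of_vecMul_eq_zero hdet <| funext fun i => by
    have := hx2 i i.2
    rw [map_sum] at this
    rw [Pi.zero_apply, ← this]
    simp only [Matrix.vecMul, dotProduct, Matrix.map_apply, restrictM, map_smul, G.pairing,
      smul_eq_mul]
    exact sum_coe_set_eq J (fun j => p j * (A j i : ℂ)) fun j hj => by rw [hp j hj, zero_mul]
  refine Finset.sum_eq_zero fun i _ => ?_
  by_cases hi : i ∈ J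
  · have : p i = 0 := congrFun h0 ⟨i, hi⟩
    rw [this, zero_smul]
  · rw [hp i hi, zero_smul]

theorem CAdmissibleData.Hc_mem {G : KacMoodyAlgebra A g} {J : Set I} (D : CAdmissibleData G J)
    (k : {k : I // k ∉ J}) :
    D.Hc k ∈ hJsub G J := mem_hJsub.2 fun j hj => by
  have hjk : j ≠ k.1 := fun h => k.2 (h ▸ hj)
  by_cases hjI : j ∈ cmpnt A (J ∪ {k.1}) k.1
  · rw [(D.isHGen k).2 j hjI, if_neg hjk]
  · obtain ⟨p, hp, h⟩ := exists_sum_coroot (D.isHGen k).1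
    rw [h, map_sum]
    refine Finset.sum_eq_zero fun i _ => ?_
    rw [map_smul, G.pairing]
    by_cases hi : i ∈ cmpnt A (J ∪ {k.1}) k.1
    · by_cases hij : A i j = 0
      · simp [hij]
      · exact absurd (mem_cmpnt_of_ne_zero hi (.inl hj) hij) hjI
    · rw [hp i hi, zero_smul]

/-- Complements to the definition of a C-admissible pair. -/
structure CAdmissibleData.Regular {G : KacMoodyAlgebra A g} {J : Set I} (D : CAdmissibleData G J) :
    Prop where
  gcm : IsGCM A
  memE' : ∀ k : {k : I // k ∉ J}, D.E k ∈ G.degOne (cmpnt A (J ∪ {k.1}) k.1) k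
  memF' : ∀ k : {k : I // k ∉ J}, D.F k ∈ G.flip.degOne (cmpnt A (J ∪ {k.1}) k.1) k
  coeff_ne_zero : ∀ (k : {k : I // k ∉ J}) (p : I → ℂ), (∀ i ∉ cmpnt A (J ∪ {k.1}) k.1, p i = 0) →
    D.Hc k = ∑ i, p i • G.coroot i → p k ≠ 0
  engelE : ∀ k y, y ∈ LieSubalgebra.engel ℂ (D.E k)
  engelF : ∀ k y, y ∈ LieSubalgebra.engel ℂ (D.F k)

theorem notMem_cmpnt_of_ne {I : Type*} {A : Matrix I I ℤ} {J : Set I} {k l : {k : I // k ∉ J}}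
    (h : k ≠ l) : l.1 ∉ cmpnt A (J ∪ {k.1}) k.1 := fun hl =>
  (cmpnt_subset hl).elim l.2 fun h' => h (Subtype.ext h'.symm)

namespace CAdmissibleData.Regular

variable {G : KacMoodyAlgebra A g} {J : Set I} {D : CAdmissibleData G J} (R : D.Regular)

include R

theorem lie_E {h : G.H} (hh : h ∈ hJsub G J) (k : {k : I // k ∉ J}) :
    ⁅(h : g), D.E k⁆ = G.root k h • D.E k :=
  G.lie_degOne (fun j hj hjk => mem_hJsub.1 hh j ((cmpnt_subset hj).resolve_right hjk)) (R.memE' k)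

theorem lie_F {h : G.H} (hh : h ∈ hJsub G J) (k : {k : I // k ∉ J}) :
    ⁅(h : g), D.F k⁆ = -(G.root k h) • D.F k :=
  G.flip.lie_degOne (fun j hj hjk => neg_eq_zero.2
    (mem_hJsub.1 hh j ((cmpnt_subset hj).resolve_right hjk))) (R.memF' k)

theorem lie_E_F {k l : {k : I // k ∉ J}} (h : k ≠ l) : ⁅D.E k, D.F l⁆ = 0 := by
  have key : ∀ c x, G.toPre.Word (cmpnt A (J ∪ {k.1}) k.1) c x → c k = 1 → ⁅x, D.F l⁆ = 0 := by
    intro c x hc hck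
    have hF := R.memF' l
    generalize D.F l = y at hF
    induction hF using Submodule.span_induction with
    | mem y hy =>
      obtain ⟨d, hd, hdl⟩ := hy
      by_contra h0
      have h1 : ⁅x, y⁆ ∈ G.toPre.W (c + -d) := by
        rw [Pre.W, Pre.wt_add]
        exact lie_mem_wtSpaceι hc.mem_wtSpaceι (Pre.Word.mem_wtSpaceι_flip (P := G.toPre) hd)
      have h2 := hc.eq_zero_of_notMem (notMem_cmpnt_of_ne h)
      have h3 := hd.eq_zero_of_notMem (notMem_cmpnt_of_ne h.symm)
      rcases Pre.nonneg_or_nonpos_of_W_ne_bot (fun h => h0 (by rwa [h] at h1)) with h4 | h4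
      · have := h4 l; simp at this; omega
      · have := h4 k; simp at this; omega
    | zero => exact lie_zero _
    | add y z _ _ hy hz => rw [lie_add, hy, hz, add_zero]
    | smul a y _ hy => rw [lie_smul, hy, smul_zero]
  have hE := R.memE' k
  generalize D.E k = x at hE
  induction hE using Submodule.span_induction with
  | mem x hx => obtain ⟨c, hc, hck⟩ := hx; exact key c x hc hck
  | zero => exact zero_lie _
  | add y z _ _ hy hz => rw [add_lie, hy, hz, add_zero]
  | smul a y _ hy => rw [smul_lie, hy, smul_zero]

theorem exists_matrix : ∃ A3 : Matrix {k : I // k ∉ J} {k : I // k ∉ J} ℤ, IsGCM A3 ∧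
    (∀ k l, (A3 k l : ℂ) = G.root l.1 (D.Hc k)) ∧
    (∀ k l, k ≠ l → ((LieAlgebra.ad ℂ g (D.E k)) ^ (1 - A3 k l).toNat) (D.E l) = 0) ∧
    ∀ k l, k ≠ l → ((LieAlgebra.ad ℂ g (D.F k)) ^ (1 - A3 k l).toNat) (D.F l) = 0 := by
  have key : ∀ k l, ∃ z : ℤ, (z : ℂ) = G.root l.1 (D.Hc k) ∧ (k = l → z = 2) ∧
      (k ≠ l → z ≤ 0 ∧ (z = 0 ↔ ⁅D.E k, D.E l⁆ = 0) ∧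
        ((LieAlgebra.ad ℂ g (D.E k)) ^ (1 - z).toNat) (D.E l) = 0 ∧
        ((LieAlgebra.ad ℂ g (D.F k)) ^ (1 - z).toNat) (D.F l) = 0) := by
    intro k l
    by_cases hkl : k = l
    · subst hkl
      refine ⟨2, ?_, fun _ => rfl, fun h => absurd rfl h⟩
      rw [(D.isHGen k).2 k.1 (self_mem_cmpnt (.inr rfl)), if_pos rfl]
      norm_num
    · obtain ⟨N, h1, h2, h3⟩ := exists_nat_of_lowest (D.sl2 k) ((D.sl2 l).e_ne_zero)
        (R.lie_E (D.Hc_mem k) l) (by rw [← lie_skew, R.lie_E_F (Ne.symm hkl), neg_zero])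
        (R.engelE k _)
      obtain ⟨N', h1', h2', h3'⟩ := exists_nat_of_lowest (D.sl2 k).symm (D.sl2 l).f_ne_zero
        (μ := G.root l (D.Hc k)) (by rw [neg_lie, R.lie_F (D.Hc_mem k) l, neg_smul, neg_neg])
        (R.lie_E_F hkl) (R.engelF k _)
      have hN : N' = N := by
        rw [h1, neg_inj, Nat.cast_inj] at h1'; exact h1'.symm
      subst hN
      have ht : (1 - (-(N' : ℤ))).toNat = N' + 1 := by omega
      refine ⟨-N', by rw [h1]; push_cast; rfl, fun h => absurd h hkl,
        fun _ => ⟨by omega, ⟨fun h => ?_, fun h => ?_⟩, by rw [ht]; exact h3, by rw [ht]; exact h3'⟩⟩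
      · have h0 : N' = 0 := by omega
        subst h0
        simpa using h3
      · by_contra h0
        exact h2 1 (by omega) (by simpa using h)
  choose A3 h1 h2 h3 using key
  refine ⟨A3, ⟨fun k => h2 k k rfl, fun k l h => (h3 k l h).1, fun k l h => ?_⟩, h1,
    fun k l h => (h3 k l h).2.2.1, fun k l h => (h3 k l h).2.2.2⟩
  have hkl : k ≠ l := by
    rintro rfl
    rw [h2 k k rfl] at h
    norm_num at h
  rw [(h3 l k hkl.symm).2.1, ← lie_skew, (h3 k l hkl).2.1.1 h, neg_zero]

end CAdmissibleData.Regular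

end Admissible

section AdmissibleSubalgebra

variable {g : Type*} [LieRing g] [LieAlgebra ℂ g] {I : Type*} [Fintype I] [DecidableEq I]
  {A : Matrix I I ℤ}

namespace CAdmissibleData.Regular

variable {G : KacMoodyAlgebra A g} {J : Set I} {D : CAdmissibleData G J} (R : D.Regular)

include R

theorem exists_coeff : ∃ p : {k : I // k ∉ J} → I → ℂ, (∀ k, D.Hc k = ∑ i, p k i • G.coroot i) ∧
    (∀ k, p k k ≠ 0) ∧ ∀ k l, k ≠ l → p k l.1 = 0 := by
  choose p hp h using fun k => exists_sum_coroot (D.isHGen k).1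
  exact ⟨p, h, fun k => R.coeff_ne_zero k (p k) (hp k) (h k),
    fun k l hkl => hp k _ (notMem_cmpnt_of_ne hkl)⟩

theorem linearIndependent_Hc : LinearIndependent ℂ D.Hc := by
  obtain ⟨p, hp, hp0, hpl⟩ := R.exists_coeff
  refine Fintype.linearIndependent_iff.2 fun c hc l => ?_
  simp only [hp, Finset.smul_sum, smul_smul] at hc
  rw [Finset.sum_comm] at hc
  simp only [← Finset.sum_smul] at hc
  have := Fintype.linearIndependent_iff.1 G.indepCoroot _ hc l.1
  rw [Finset.sum_eq_single l (fun k _ hk => by rw [hpl k l hk, mul_zero])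
    (fun h => absurd (Finset.mem_univ l) h)] at this
  exact (mul_eq_zero.1 this).resolve_right (hp0 l)

theorem span_Hc_inf_eq :
    Submodule.span ℂ (Set.range D.Hc) ⊓ ⨅ k : {k : I // k ∉ J}, LinearMap.ker (G.root k) =
      Submodule.span ℂ (Set.range G.coroot) ⊓ ⨅ i, LinearMap.ker (G.root i) := by
  obtain ⟨p, hp, hp0, hpl⟩ := R.exists_coeff
  refine le_antisymm (fun x hx => ?_) fun x hx => ?_
  · have h1 := hx.1
    have h2 : ∀ k : {k : I // k ∉ J}, G.root k x = 0 := (Submodule.mem_iInf _).1 hx.2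
    refine ⟨Submodule.span_le.2 ?_ h1, (Submodule.mem_iInf _).2 fun i => LinearMap.mem_ker.2 ?_⟩
    · rintro _ ⟨k, rfl⟩
      rw [hp]
      exact sum_mem fun i _ => Submodule.smul_mem _ _ (Submodule.subset_span ⟨i, rfl⟩)
    · by_cases hi : i ∈ J
      · exact mem_hJsub.1 (Submodule.span_le.2 (by rintro _ ⟨k, rfl⟩; exact D.Hc_mem k) h1) i hi
      · exact h2 ⟨i, hi⟩
  · have h2 : ∀ i, G.root i x = 0 := (Submodule.mem_iInf _).1 hx.2
    refine ⟨?_, (Submodule.mem_iInf _).2 fun k => LinearMap.mem_ker.2 (h2 k.1)⟩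
    obtain ⟨q, -, hq⟩ := exists_sum_coroot (T := Set.univ) (by rw [Set.image_univ]; exact hx.1)
    set r := ∑ k : {k : I // k ∉ J}, (q k / p k k) • D.Hc k with hr
    have hmem : r ∈ Submodule.span ℂ (Set.range D.Hc) :=
      sum_mem fun k _ => Submodule.smul_mem _ _ (Submodule.subset_span ⟨k, rfl⟩)
    suffices h : x - r = 0 by rwa [sub_eq_zero.1 h]
    have hrc : r = ∑ i, (∑ k : {k : I // k ∉ J}, q k / p k k * p k i) • G.coroot i := by
      simp only [hr, hp, Finset.smul_sum, smul_smul, Finset.sum_smul]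
      exact Finset.sum_comm
    refine (Submodule.eq_bot_iff _).1 (span_coroot_inf_hJsub_eq_bot R.gcm D.finJ) _
      ⟨?_, sub_mem (mem_hJsub.2 fun i _ => h2 i)
        (sum_mem fun k _ => Submodule.smul_mem _ _ (D.Hc_mem k))⟩
    rw [hrc, hq, ← Finset.sum_sub_distrib]
    refine sum_mem fun i _ => ?_
    rw [← sub_smul]
    by_cases hi : i ∈ J
    · exact Submodule.smul_mem _ _ (Submodule.subset_span ⟨i, hi, rfl⟩)
    · rw [Finset.sum_eq_single (⟨i, hi⟩ : {k : I // k ∉ J})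
        (fun k _ hk => by rw [hpl k ⟨i, hi⟩ hk, mul_zero]) (fun h => absurd (Finset.mem_univ _) h),
        div_mul_cancel₀ _ (hp0 ⟨i, hi⟩), sub_self, zero_smul]
      exact zero_mem _

/-- The subalgebra attached to a C-admissible pair is a Kac-Moody algebra. -/
theorem exists_isAssocKM : ∃ (A3 : Matrix {k : I // k ∉ J} {k : I // k ∉ J} ℤ)
    (GJ : KacMoodyAlgebra A3 ↥D.gJ), IsGCM A3 ∧ D.IsAssocKM GJ ∧
      ∀ k (x : GJ.H) (y : G.H), ((x : D.gJ) : g) = y → GJ.root k x = G.root k y := by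
  obtain ⟨A3, hA3, hpair, hE, hF⟩ := R.exists_matrix
  have := G.findimH
  set h0 : Submodule ℂ g := (hJsub G J).map G.H.subtype
  have hle : h0 ≤ G.H := by
    rintro _ ⟨u, -, rfl⟩; exact u.2
  have hmem : ∀ u : G.H, u ∈ hJsub G J → (u : g) ∈ h0 := fun u hu => ⟨u, hu, rfl⟩
  have hmem' : ∀ x : h0, Submodule.inclusion hle x ∈ hJsub G J := by
    rintro ⟨_, u, hu, rfl⟩; exact hu
  let ψ : hJsub G J →ₗ[ℂ] h0 := LinearMap.restrict G.H.subtype fun u hu => hmem u hu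
  let rt : {k : I // k ∉ J} → Module.Dual ℂ h0 := fun k => (G.root k).comp (Submodule.inclusion hle)
  have hrt : LinearIndependent ℂ rt := by
    refine Fintype.linearIndependent_iff.2 fun c hc l => ?_
    obtain ⟨x, hx⟩ := G.exists_root_eq fun i => if i = l.1 then 1 else 0
    have hxJ : x ∈ hJsub G J := mem_hJsub.2 fun j hj => by
      rw [hx, if_neg (by rintro rfl; exact l.2 hj)]
    have h1 := LinearMap.congr_fun hc ⟨x, hmem x hxJ⟩
    have h2 : ∀ k, rt k ⟨x, hmem x hxJ⟩ = if k = l then 1 else 0 := fun k => by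
      refine (hx k).trans ?_
      simp only [Subtype.ext_iff]
    simpa [LinearMap.sum_apply, h2] using h1
  let co : {k : I // k ∉ J} → h0 := fun k => ⟨D.Hc k, hmem _ (D.Hc_mem k)⟩
  have hco : LinearIndependent ℂ co :=
    LinearIndependent.of_comp (Submodule.inclusion hle) R.linearIndependent_Hc
  have hcorank : gcmCorank A3 = gcmCorank A := by
    rw [← finrank_center_eq_gcmCorank A3 D.Hc (fun k => G.root k) R.linearIndependent_Hc
      fun k l => (hpair k l).symm, R.span_Hc_inf_eq,
      finrank_center_eq_gcmCorank A G.coroot G.root G.indepCoroot G.pairing]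
  have hrank : finrank ℂ h0 = Fintype.card {k : I // k ∉ J} + gcmCorank A3 := by
    have h1 := finrank_hJsub G J
    have h2 := (Submodule.equivMapOfInjective _ G.H.subtype_injective (hJsub G J)).finrank_eq
    have h3 := Fintype.card_subtype_compl (· ∈ J)
    have h4 := Fintype.card_subtype_le (· ∈ J)
    have h5 := G.finrankH
    rw [hcorank]
    have h6 : Fintype.card {i // i ∈ J} = Fintype.card J := rfl
    change finrank ℂ (hJsub G J) = finrank ℂ h0 at h2
    omega
  obtain ⟨GJ, h1, h2, h3, h4, h5⟩ := exists_kacMoodyAlgebra (A := A3) D.gJ h0 rt co D.E D.F rfl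
    inferInstance hrank hrt hco (fun k l => (hpair k l).symm)
    (fun x hx y hy => G.abelian ⟨x, hle hx⟩ ⟨y, hle hy⟩) (fun x k => R.lie_E (hmem' x) k)
    (fun x k => R.lie_F (hmem' x) k)
    (fun k l => by
      by_cases h : l = k
      · rw [if_pos h, h, (D.sl2 k).lie_e_f]
      · rw [if_neg h, R.lie_E_F (Ne.symm h)])
    hE hF
  refine ⟨A3, GJ, hA3, ⟨hpair, h1, h2, h3, h4⟩, fun k x y hxy => ?_⟩
  have hx : ((x : D.gJ) : g) ∈ h0 := h1 ▸ ⟨x, x.2, rfl⟩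
  exact (h5 k x ⟨_, hx⟩ rfl).trans (congrArg (G.root k) (Subtype.ext hxy))

end CAdmissibleData.Regular

end AdmissibleSubalgebra

/-! ### Gradations by the subalgebra attached to a C-admissible pair -/

section Restriction

variable {g : Type*} [LieRing g] [LieAlgebra ℂ g] {L : Type*} [LieRing L] [LieAlgebra ℂ L]
  {I : Type*} [Fintype I] [DecidableEq I] {A : Matrix I I ℤ} {J : Set I}
  {A3 : Matrix {k : I // k ∉ J} {k : I // k ∉ J} ℤ}

/-- The roots of `GJ` are the restrictions of the roots of `G`, those from `J` restricting to `0`. -/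
structure IsRestriction (G : KacMoodyAlgebra A g) (GJ : KacMoodyAlgebra A3 L) (ι : L →ₗ⁅ℂ⁆ g)
    (τ : GJ.H →ₗ[ℂ] G.H) : Prop where
  apply_eq : ∀ x : GJ.H, ι x = τ x
  root_eq_zero : ∀ j ∈ J, ∀ x, G.root j (τ x) = 0
  root_eq : ∀ (k : {k : I // k ∉ J}) x, G.root k (τ x) = GJ.root k x

namespace IsRestriction

variable {G : KacMoodyAlgebra A g} {GJ : KacMoodyAlgebra A3 L} {ι : L →ₗ⁅ℂ⁆ g}
  {τ : GJ.H →ₗ[ℂ] G.H} (h : IsRestriction G GJ ι τ)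

include h

theorem flip : IsRestriction G.flip GJ.flip ι τ where
  apply_eq := h.apply_eq
  root_eq_zero j hj x := neg_eq_zero.2 (h.root_eq_zero j hj x)
  root_eq k x := congrArg Neg.neg (h.root_eq k x)

theorem comp_eq : G.H.subtype ∘ₗ τ = ι.toLinearMap ∘ₗ GJ.H.subtype :=
  LinearMap.ext fun x => (h.apply_eq x).symm

theorem wt_comp (c : I → ℤ) : (G.toPre.wt c).comp τ = GJ.toPre.wt fun k => c k := by
  ext x
  rw [LinearMap.comp_apply, Pre.wt_apply, Pre.wt_apply]
  simp only [← h.root_eq]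
  symm
  refine (sum_coe_set_eq Jᶜ (fun i => (c i : ℂ) * G.root i (τ x)) fun j hj => ?_)
  rw [h.root_eq_zero j (not_not.1 hj), mul_zero]

theorem wtSpaceι_le (χ : Module.Dual ℂ G.H) :
    wtSpaceι G.H.subtype χ ≤ wtSpaceι (ι.toLinearMap ∘ₗ GJ.H.subtype) (χ.comp τ) :=
  fun x hx v => by
    rw [← h.comp_eq]
    exact hx (τ v)

theorem W_le_U (c : I → ℤ) : G.toPre.W c ≤ GJ.U ι fun k => c k := by
  rw [KacMoodyAlgebra.U, ← h.wt_comp]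
  exact h.wtSpaceι_le _

theorem exists_of_ne_bot {χ : Module.Dual ℂ GJ.H}
    (hχ : wtSpaceι (ι.toLinearMap ∘ₗ GJ.H.subtype) χ ≠ ⊥) :
    ∃ c : I → ℤ, χ = GJ.toPre.wt (fun k => c k) ∧ (c = 0 ∨
      (∃ x, x ≠ 0 ∧ G.toPre.Word Set.univ c x) ∨
      ∃ x, x ≠ 0 ∧ G.toPre.flip.Word Set.univ (-c) x) := by
  rw [← h.comp_eq] at hχ
  obtain ⟨c, hc, hw⟩ := Pre.exists_word (P := G.toPre) (τ := τ) hχ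
  exact ⟨c, hc.trans (h.wt_comp c), hw⟩

theorem nonneg_or_nonpos {d : {k : I // k ∉ J} → ℤ} (hd : GJ.U ι d ≠ ⊥) : 0 ≤ d ∨ d ≤ 0 := by
  obtain ⟨c, hc, hw⟩ := h.exists_of_ne_bot hd
  rw [Pre.wt_injective _ hc]
  rcases hw with rfl | ⟨x, -, hx⟩ | ⟨x, -, hx⟩
  · exact .inl le_rfl
  · exact .inl fun k => hx.nonneg k
  · exact .inr fun k => by simpa using hx.nonneg k

theorem exists_sub_of_word {c : I → ℤ} {x : g} (hx : G.toPre.Word Set.univ c x) (hx0 : x ≠ 0)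
    (hc : (fun k : {k : I // k ∉ J} => c k) ≠ 0) :
    ∃ k, 0 ≤ (fun k : {k : I // k ∉ J} => c k) - Pi.single k 1 ∧
      ((fun k : {k : I // k ∉ J} => c k) = Pi.single k 1 ∨
        GJ.U ι ((fun k : {k : I // k ∉ J} => c k) - Pi.single k 1) ≠ ⊥) := by
  have hJ : ∀ i ∈ J, ∀ k : {k : I // k ∉ J}, (Pi.single i 1 : I → ℤ) k = 0 := fun i hi k =>
    Pi.single_eq_of_ne (fun hki : (k : I) = i => k.2 (hki ▸ hi)) _
  have hK : ∀ i k : {k : I // k ∉ J}, (Pi.single i.1 1 : I → ℤ) k = (Pi.single i 1 : _ → ℤ) k :=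
    fun i k => by simp [Pi.single_apply, Subtype.ext_iff]
  induction hx with
  | base i _ =>
    by_cases hi : i ∈ J
    · exact absurd (funext (hJ i hi)) hc
    · have : (fun k : {k : I // k ∉ J} => (Pi.single i 1 : I → ℤ) k) = Pi.single ⟨i, hi⟩ 1 :=
        funext (hK ⟨i, hi⟩)
      exact ⟨⟨i, hi⟩, by rw [this, sub_self], .inl this⟩
  | step i c x _ hw ih =>
    have hx : x ≠ 0 := by rintro rfl; exact hx0 (lie_zero _)
    by_cases hi : i ∈ J
    · have : (fun k : {k : I // k ∉ J} => (c + Pi.single i 1 : I → ℤ) k) =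
          fun k : {k : I // k ∉ J} => c k :=
        funext fun k => by rw [Pi.add_apply, hJ i hi, add_zero]
      rw [this] at hc ⊢
      exact ih hx hc
    · have : (fun k : {k : I // k ∉ J} => (c + Pi.single i 1 : I → ℤ) k) - Pi.single ⟨i, hi⟩ 1 =
          fun k : {k : I // k ∉ J} => c k :=
        funext fun k => by rw [Pi.sub_apply, Pi.add_apply, hK ⟨i, hi⟩, add_sub_cancel_right]
      refine ⟨⟨i, hi⟩, ?_, .inr fun h0 => hx ?_⟩
      · rw [this]; exact fun k => hw.nonneg k
      · have := h.W_le_U c hw.mem_W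
        simp_all

theorem exists_sub {d : {k : I // k ∉ J} → ℤ} (hd : 0 ≤ d) (hd0 : d ≠ 0) (hU : GJ.U ι d ≠ ⊥) :
    ∃ k, 0 ≤ d - Pi.single k 1 ∧ (d = Pi.single k 1 ∨ GJ.U ι (d - Pi.single k 1) ≠ ⊥) := by
  obtain ⟨c, hc, hw⟩ := h.exists_of_ne_bot hU
  obtain rfl := Pre.wt_injective _ hc
  rcases hw with rfl | ⟨x, hx0, hx⟩ | ⟨x, -, hx⟩
  · exact absurd rfl hd0
  · exact h.exists_sub_of_word hx hx0 hd0
  · exact absurd (le_antisymm (fun k => by simpa using hx.nonneg k) hd) hd0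

theorem eq_zero_or_W_ne_bot (hA3 : IsGCM A3) (hι : Function.Injective ι)
    (he : ∀ k y, y ∈ LieSubalgebra.engel ℂ (ι (GJ.e k)))
    (hf : ∀ k y, y ∈ LieSubalgebra.engel ℂ (ι (GJ.f k)))
    (h3 : ∀ k (n : ℤ), 2 ≤ |n| → GJ.U ι (Pi.single k n) = ⊥) {d : {k : I // k ∉ J} → ℤ}
    (hU : GJ.U ι d ≠ ⊥) : d = 0 ∨ GJ.toPre.W d ≠ ⊥ := by
  by_cases hd0 : d = 0
  · exact .inl hd0
  right
  rcases h.nonneg_or_nonpos hU with hd | hd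
  · exact KacMoodyAlgebra.W_ne_bot_of_U_ne_bot hA3 hι he hf (fun _ => h.nonneg_or_nonpos)
      (fun k n hn => h3 k n (hn.trans (le_abs_self n))) (fun _ => h.exists_sub) d hd hd0 hU
  · have := KacMoodyAlgebra.W_ne_bot_of_U_ne_bot (G := GJ.flip) hA3 hι hf he
      (fun _ => h.flip.nonneg_or_nonpos)
      (fun k n hn => by
        rw [KacMoodyAlgebra.U_flip, ← Pi.single_neg]
        exact h3 k _ (by rw [abs_neg]; exact hn.trans (le_abs_self n)))
      (fun _ => h.flip.exists_sub) (-d) (neg_nonneg.2 hd) (neg_ne_zero.2 hd0)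
      (by rwa [KacMoodyAlgebra.U_flip, neg_neg])
    have h5 := Pre.W_flip GJ.toPre (-d)
    rw [neg_neg] at h5
    rwa [← h5]

theorem isFinGrading (hA3 : IsGCM A3) (hι : Function.Injective ι)
    (he : ∀ k y, y ∈ LieSubalgebra.engel ℂ (ι (GJ.e k)))
    (hf : ∀ k y, y ∈ LieSubalgebra.engel ℂ (ι (GJ.f k)))
    (h3 : ∀ k (n : ℤ), 2 ≤ |n| → GJ.U ι (Pi.single k n) = ⊥)
    (hfd : ∀ χ, FiniteDimensional ℂ (wtSpaceι (ι.toLinearMap ∘ₗ GJ.H.subtype) χ)) :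
    IsFinGrading GJ ι := by
  refine ⟨hι, ?_, fun χ _ => hfd χ⟩
  rw [eq_top_iff, ← Pre.iSup_wtSpaceι G.toPre]
  refine iSup_le fun χ => (h.wtSpaceι_le χ).trans ?_
  by_cases h0 : wtSpaceι (ι.toLinearMap ∘ₗ GJ.H.subtype) (χ.comp τ) = ⊥
  · rw [h0]; exact bot_le
  refine le_iSup₂_of_le (χ.comp τ) ?_ le_rfl
  obtain ⟨c, hc, -⟩ := h.exists_of_ne_bot h0
  rw [hc] at h0 ⊢
  rcases h.eq_zero_or_W_ne_bot hA3 hι he hf h3 h0 with h1 | h1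
  · rw [h1, Pre.wt_zero]; exact .inl rfl
  · by_cases h2 : GJ.toPre.wt (fun k : {k : I // k ∉ J} => c k) = 0
    · exact .inl h2
    · exact .inr ⟨h2, h1⟩

end IsRestriction

end Restriction

/-! ### Gradations whose simple roots restrict to zero or to simple roots -/

section AllReal

variable {g : Type*} [LieRing g] [LieAlgebra ℂ g] {I : Type*} [Fintype I] [DecidableEq I]
  {A : Matrix I I ℤ} {S : Type*} [Fintype S] [DecidableEq S] {B : Matrix S S ℤ}
  {m : Type*} [LieRing m] [LieAlgebra ℂ m]

theorem IsGraded.exists_regular {G : KacMoodyAlgebra A g} {M : KacMoodyAlgebra B m} {φ : m →ₗ⁅ℂ⁆ g}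
    {hle : M.H.map φ.toLinearMap ≤ G.H} (Γ : IsGraded G M φ hle) {ε : I → ℝ} (hε : ∀ i, 0 < ε i)
    (hεA : ∀ i j, ε i * A j i = ε j * A i j)
    (h1 : ∀ i, i ∈ Jof G M φ hle ∨ ∃ s, i ∈ GammaOf G M φ hle s) :
    ∃ D : CAdmissibleData G (Jof G M φ hle), D.Regular ∧ ∀ x, φ x ∈ D.gJ := by
  obtain ⟨E, F, Hc, hT, hE, hF, -⟩ := Γ.exists_sl2Triples
  have h2 : ∀ k : {k : I // k ∉ Jof G M φ hle}, ∃ s, k.1 ∈ GammaOf G M φ hle s :=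
    fun k => (h1 k).resolve_left k.2
  choose s hs using h2
  let D : CAdmissibleData G (Jof G M φ hle) :=
    { finJ := Γ.isFiniteType_Jof
      Hc := fun k => Hc k
      E := fun k => E k
      F := fun k => F k
      finIk := fun k => Γ.isFiniteType_of_subset (Ik_subset (hs k))
      isHGen := fun k => (hT _ k (hs k)).2.2.1
      memE := fun k => G.degOne_le_gS _ _ (hT _ k (hs k)).1
      memF := fun k => by
        rw [← gS_flip]
        exact G.flip.degOne_le_gS _ _ (hT _ k (hs k)).2.1
      sl2 := fun k => (hT _ k (hs k)).2.2.2
      a1 := fun k => Γ.a1GradedBy (hs k) (hT _ k (hs k)).2.2.1 }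
  have hEmem : ∀ s, ∀ k ∈ GammaOf G M φ hle s, E k ∈ D.gJ := fun s k hk =>
    LieSubalgebra.subset_lieSpan (.inl (.inr ⟨⟨k, Γ.notMem_Jof hk⟩, rfl⟩))
  have hFmem : ∀ s, ∀ k ∈ GammaOf G M φ hle s, F k ∈ D.gJ := fun s k hk =>
    LieSubalgebra.subset_lieSpan (.inr ⟨⟨k, Γ.notMem_Jof hk⟩, rfl⟩)
  refine ⟨D, ⟨Γ.gcm, fun k => (hT _ k (hs k)).1, fun k => (hT _ k (hs k)).2.1, fun k p hp h h0 => ?_,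
    fun k => Γ.mem_engel (Γ.degOne_le_V (hs k) (hT _ k (hs k)).1),
    fun k => Γ.flip.mem_engel (s := s k) (Γ.flip.degOne_le_V (k := k.1) ?_ ?_)⟩,
    M.apply_mem φ (fun x => LieSubalgebra.subset_lieSpan (.inl (.inl ?_))) (fun s => ?_) fun s => ?_⟩
  · have := (D.isHGen k).re_pos Γ.gcm hε hεA (self_mem_cmpnt (.inr rfl)) (D.finIk k) hp h
    rw [h0] at this
    exact lt_irrefl _ this
  · rw [GammaOf_flip]; exact hs k
  · rw [Ik, Jof_flip]; exact (hT _ k (hs k)).2.1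
  · exact ⟨cartanIncl G M φ hle x, mem_hJsub.2 fun j hj => LinearMap.congr_fun hj x, rfl⟩
  · rw [hE]
    exact sum_mem fun k hk => hEmem s k (Finset.mem_filter.1 hk).2
  · rw [hF]
    exact sum_mem fun k hk => hFmem s k (Finset.mem_filter.1 hk).2

theorem IsGraded.exists_isFinGrading {G : KacMoodyAlgebra A g} {M : KacMoodyAlgebra B m}
    {φ : m →ₗ⁅ℂ⁆ g} {hle : M.H.map φ.toLinearMap ≤ G.H} (Γ : IsGraded G M φ hle) {ε : I → ℝ}
    (hε : ∀ i, 0 < ε i) (hεA : ∀ i j, ε i * A j i = ε j * A i j)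
    (h1 : ∀ i, i ∈ Jof G M φ hle ∨ ∃ s, i ∈ GammaOf G M φ hle s) :
    ∃ (D : CAdmissibleData G (Jof G M φ hle))
      (A3 : Matrix {k : I // k ∉ Jof G M φ hle} {k : I // k ∉ Jof G M φ hle} ℤ)
      (GJ : KacMoodyAlgebra A3 ↥D.gJ),
      D.IsAssocKM GJ ∧ IsFinGrading GJ D.gJ.incl ∧ ∀ x, φ x ∈ D.gJ := by
  obtain ⟨D, R, hφ⟩ := Γ.exists_regular hε hεA h1
  obtain ⟨A3, GJ, hA3, hassoc, hroot⟩ := R.exists_isAssocKM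
  refine ⟨D, A3, GJ, hassoc, ?_, hφ⟩
  have hmap := hassoc.2.1
  have hτ : ∀ x : GJ.H, ∃ y ∈ hJsub G (Jof G M φ hle), (y : g) = (x : D.gJ) := fun x => by
    have : ((x : D.gJ) : g) ∈ GJ.H.map D.gJ.toSubmodule.subtype := ⟨x, x.2, rfl⟩
    rw [hmap] at this
    exact this
  let τ : GJ.H →ₗ[ℂ] G.H := LinearMap.codRestrict G.H (D.gJ.toSubmodule.subtype ∘ₗ GJ.H.subtype)
    fun x => by
      obtain ⟨y, -, hy⟩ := hτ x
      have : ((x : D.gJ) : g) ∈ G.H := hy ▸ y.2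
      exact this
  have hres : IsRestriction G GJ D.gJ.incl τ :=
    { apply_eq := fun x => rfl
      root_eq_zero := fun j hj x => by
        obtain ⟨y, hy, hyx⟩ := hτ x
        have : τ x = y := Subtype.ext hyx.symm
        rw [this]
        exact mem_hJsub.1 hy j hj
      root_eq := fun k x => (hroot k x (τ x) rfl).symm }
  have hσ : ∀ x : M.H, (⟨φ x, hφ x⟩ : D.gJ) ∈ GJ.H := fun x => by
    have h2 : φ x ∈ (hJsub G (Jof G M φ hle)).map G.H.subtype :=
      ⟨cartanIncl G M φ hle x, mem_hJsub.2 fun j hj => LinearMap.congr_fun hj x, rfl⟩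
    rw [← hmap] at h2
    obtain ⟨y, hy, hyx⟩ := h2
    have : y = ⟨φ x, hφ x⟩ := Subtype.ext hyx
    rwa [this] at hy
  let σ : M.H →ₗ[ℂ] GJ.H := LinearMap.codRestrict GJ.H
    (LinearMap.codRestrict D.gJ.toSubmodule (φ.toLinearMap ∘ₗ M.H.subtype) fun x => hφ x) hσ
  have hle' : ∀ χ, wtSpaceι (D.gJ.incl.toLinearMap ∘ₗ GJ.H.subtype) χ ≤
      wtSpaceι (φ.toLinearMap ∘ₗ M.H.subtype) (χ.comp σ) := fun χ x hx v => hx (σ v)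
  have hsingle : ∀ (k : {k : I // k ∉ Jof G M φ hle}) (s : S), k.1 ∈ GammaOf G M φ hle s → ∀ n : ℤ,
      GJ.U D.gJ.incl (Pi.single k n) ≤ Γ.V (Pi.single s n) := fun k s hk n => by
    refine (hle' _).trans_eq ?_
    rw [IsGraded.V, Pre.wt_single, Pre.wt_single, LinearMap.smul_comp]
    congr 2
    refine Eq.trans ?_ hk
    ext x
    exact hroot k (σ x) (cartanIncl G M φ hle x) rfl
  refine hres.isFinGrading hA3 Subtype.val_injective (fun k y => ?_) (fun k y => ?_) (fun k n hn => ?_)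
    fun χ => ?_
  · rw [LieSubalgebra.coe_incl, hassoc.2.2.2.1]
    exact R.engelE k y
  · rw [LieSubalgebra.coe_incl, hassoc.2.2.2.2]
    exact R.engelF k y
  · obtain ⟨s, hs⟩ := (h1 k).resolve_left k.2
    by_contra h0
    rcases Γ.V_ne_bot (ne_bot_of_le_ne_bot h0 (hsingle k s hs n)) with h2 | h2
    · have := Pi.single_eq_zero_iff.1 h2
      rw [this] at hn
      norm_num at hn
    · rcases le_abs.1 hn with h3 | h3
      · exact h2 (Pre.W_single_eq_bot h3)
      · refine h2 ?_
        rw [← neg_neg (Pi.single s n : S → ℤ), ← Pre.W_flip, ← Pi.single_neg]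
        exact Pre.W_single_eq_bot h3
  · have := Γ.finiteDimensional_wtSpaceι (χ.comp σ)
    exact Submodule.finiteDimensional_of_le (hle' χ)

end AllReal

end KMG

open KMG

section Statement

attribute [local instance] Classical.propDecidable

variable {I : Type*} [Fintype I] [DecidableEq I] {A : Matrix I I ℤ}
variable {g : Type*} [LieRing g] [LieAlgebra ℂ g]
variable {S : Type*} [Fintype S] [DecidableEq S] {B : Matrix S S ℤ}
variable {m : Type*} [LieRing m] [LieAlgebra ℂ m]

theorem statement11
    (hGCM : IsGCM A) (hInd : Indecomposable A) (hSym : Symmetrizable A)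
    (G : KacMoodyAlgebra A g)
    (hBgcm : IsGCM B) (hBind : Indecomposable B)
    (M : KacMoodyAlgebra B m) (φ : m →ₗ⁅ℂ⁆ g)
    (hgr : IsFinGrading M φ) (hle : M.H.map φ.toLinearMap ≤ G.H)
    (hadapt : Adapted G M φ hle) :
    ∃ (hIre : Submodule ℂ g) (hle2 : hIre ≤ G.H),
      M.H.map φ.toLinearMap ≤ hIre ∧
      (∀ i ∈ IreOf G M φ hle, ((G.coroot i : ↥G.H) : g) ∈ hIre) ∧
      LinearIndependent ℂ (fun i : ↥(IreOf G M φ hle) =>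
        (G.root i.1).comp (Submodule.inclusion hle2)) ∧
      FiniteDimensional ℂ ↥hIre ∧
      Module.finrank ℂ ↥hIre = Fintype.card ↥(IreOf G M φ hle) +
        gcmCorank (restrictM A (IreOf G M φ hle)) ∧
      (∀ x : m, φ x ∈ gIre G (IreOf G M φ hle) hIre) ∧
      ∃ (A'' : Matrix ↥(IreOf G M φ hle) ↥(IreOf G M φ hle) ℤ)
        (GI : KacMoodyAlgebra A'' ↥(gIre G (IreOf G M φ hle) hIre)),
          (∀ i j, A'' i j = A i.1 j.1) ∧
          IsAssocKMIre G (IreOf G M φ hle) hIre GI ∧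
          ∃ (D2 : CAdmissibleData GI {i : ↥(IreOf G M φ hle) | i.1 ∈ Jof G M φ hle})
            (A3 : Matrix
              {k : ↥(IreOf G M φ hle) // k ∉ {i : ↥(IreOf G M φ hle) | i.1 ∈ Jof G M φ hle}}
              {k : ↥(IreOf G M φ hle) // k ∉ {i : ↥(IreOf G M φ hle) | i.1 ∈ Jof G M φ hle}} ℤ)
            (GJ2 : KacMoodyAlgebra A3 ↥D2.gJ),
              D2.IsAssocKM GJ2 ∧ IsFinGrading GJ2 D2.gJ.incl ∧
              ∀ x : m, φ x ∈ D2.gJ.map (gIre G (IreOf G M φ hle) hIre).incl := by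
  have Γ : IsGraded G M φ hle := ⟨hGCM, hBgcm, hgr, hadapt.nonneg⟩
  obtain ⟨hIre, hle2, haI, hcI, hind, hfd, hrk, GI, hassoc, φ₀, hφ₀, hle₀, Γ₀, hres⟩ :=
    Γ.exists_gIre hInd hSym
  obtain ⟨ε, hε, hεA⟩ := exists_pos_symmetrization hGCM hInd hSym
  have hJ : Jof GI M φ₀ hle₀ = {i : ↥(IreOf G M φ hle) | i.1 ∈ Jof G M φ hle} :=
    Set.ext fun i => by rw [Jof, Set.mem_ofPred_eq, hres]; rfl
  have h1 : ∀ i, i ∈ Jof GI M φ₀ hle₀ ∨ ∃ s, i ∈ GammaOf GI M φ₀ hle₀ s := by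
    rintro ⟨i, k, ⟨s, hs⟩, hi⟩
    rcases cmpnt_subset hi with h | h
    · exact .inl ((hres _).trans h)
    · obtain rfl : i = k := h
      exact .inr ⟨s, (hres _).trans hs⟩
  have h2 := Γ₀.exists_isFinGrading (ε := fun i => ε i) (fun i => hε i) (fun i j => hεA i j) h1
  rw [hJ] at h2
  obtain ⟨D2, A3, GJ2, hD, hfin, hφJ⟩ := h2
  exact ⟨hIre, hle2, haI, hcI, hind, hfd, hrk, fun x => hφ₀ x ▸ (φ₀ x).2, _, GI, fun _ _ => rfl,
    hassoc, D2, A3, GJ2, hD, hfin, fun x => ⟨φ₀ x, hφJ x, hφ₀ x⟩⟩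

end Statement
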